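/- Let p ≥ 4 and n be integers with 2 ≤ n ≤ p − 2, and set c = 2p+1. Consider a 2-coloring of the edges of the complete graph on a vertex set V with |V| = n + 3p + 3. Let Q be a blue cycle on 2p+2 vertices such that s(Q) ≥ s(C) for every monochromatic cycle C on 2p+2 vertices in this coloring. If s(Q) ≥ p + 1, then the coloring contains a monochromatic copy of S_c(n,2). -/

import Mathlib

open SimpleGraph

/-- The relation generating the edges of the linked double star `S_c(n,m)`:
vertices are `a_1, …, a_c` (the link, modelled by `Fin c`), the spokes
`v_1, …, v_n` of the `n`-star at `a_1` (modelled by `Fin n`), and the spokes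
`w_1, …, w_m` of the `m`-star at `a_c` (modelled by `Fin m`). -/
def ldsRel (c n m : ℕ) : (Fin c ⊕ Fin n ⊕ Fin m) → (Fin c ⊕ Fin n ⊕ Fin m) → Prop
  | Sum.inl i, Sum.inl j => (j : ℕ) = (i : ℕ) + 1
  | Sum.inl i, Sum.inr (Sum.inl _) => (i : ℕ) = 0
  | Sum.inl i, Sum.inr (Sum.inr _) => (i : ℕ) = c - 1
  | _, _ => False

/-- The linked double star `S_c(n,m)`. -/
def LinkedDoubleStar (c n m : ℕ) : SimpleGraph (Fin c ⊕ Fin n ⊕ Fin m) :=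
  SimpleGraph.fromRel (ldsRel c n m)

/-- `G` contains a (not necessarily induced) subgraph isomorphic to `H`. -/
def HasCopy {α β : Type*} (H : SimpleGraph α) (G : SimpleGraph β) : Prop :=
  ∃ f : α → β, Function.Injective f ∧ ∀ ⦃a b⦄, H.Adj a b → G.Adj (f a) (f b)

/-- A 2-coloring of the complete graph on `β` is encoded by the graph `G` of red
edges (so `Gᶜ` is the graph of blue edges).  `HasMonoLDS G c n m` says this
coloring contains a monochromatic copy of `S_c(n,m)`. -/
def HasMonoLDS {β : Type*} (G : SimpleGraph β) (c n m : ℕ) : Prop :=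
  HasCopy (LinkedDoubleStar c n m) G ∨ HasCopy (LinkedDoubleStar c n m) Gᶜ

/-- Every 2-coloring of the edges of `K_r` contains a monochromatic `S_c(n,m)`. -/
def IsRamseyLDS (c n m r : ℕ) : Prop :=
  ∀ G : SimpleGraph (Fin r), HasMonoLDS G c n m

/-- The Ramsey number of the linked double star `S_c(n,m)`: the least positive
`r` such that every 2-coloring of the edges of `K_r` contains a monochromatic
copy of `S_c(n,m)`. -/
noncomputable def ramseyLDS (c n m : ℕ) : ℕ :=
  sInf {r | 0 < r ∧ IsRamseyLDS c n m r}

/-- `f` exhibits a cycle on `L` vertices in `G` (the vertices `f 0, f 1, …`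
arranged cyclically, consecutive ones adjacent in `G`). -/
def IsCycleMap {β : Type*} {L : ℕ} (G : SimpleGraph β) (f : ZMod L → β) : Prop :=
  Function.Injective f ∧ ∀ i : ZMod L, G.Adj (f i) (f (i + 1))

/-- For a monochromatic cycle with vertex set `C`, all of whose edges have the
color given by the graph `H`, `cycStat H C` is the maximum over vertices
`z ∉ C` of the number of `H`-edges from `z` into `C` (denoted `s(C)`). -/
noncomputable def cycStat {β : Type*} (H : SimpleGraph β) (C : Set β) : ℕ :=
  sSup ((fun z => ({w ∈ C | H.Adj z w}).ncard) '' Cᶜ)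

namespace LDS
open scoped Classical
universe u
variable {V : Type u}

/-- Embedding lemma: a path on `2p+1` vertices with disjoint leaf sets at its ends. -/
theorem hasCopy_of_spine (H : SimpleGraph V) (p n m : ℕ) (s : ℕ → V)
    (hinj : ∀ i ≤ 2 * p, ∀ j ≤ 2 * p, s i = s j → i = j)
    (hadj : ∀ i < 2 * p, H.Adj (s i) (s (i + 1)))
    (L1 L2 : Finset V) (h1 : n ≤ L1.card) (h2 : m ≤ L2.card) (hd : Disjoint L1 L2)
    (hs1 : ∀ i ≤ 2 * p, s i ∉ L1) (hs2 : ∀ i ≤ 2 * p, s i ∉ L2)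
    (ha1 : ∀ v ∈ L1, H.Adj (s 0) v) (ha2 : ∀ v ∈ L2, H.Adj (s (2 * p)) v) :
    HasCopy (LinkedDoubleStar (2 * p + 1) n m) H := by
  obtain ⟨f1⟩ : Nonempty (Fin n ↪ L1) := by
    apply Function.Embedding.nonempty_of_card_le; simpa using h1
  obtain ⟨f2⟩ : Nonempty (Fin m ↪ L2) := by
    apply Function.Embedding.nonempty_of_card_le; simpa using h2
  have key : ∀ a b, ldsRel (2 * p + 1) n m a b →
      H.Adj (Sum.elim (fun i : Fin (2 * p + 1) => s i) (Sum.elim (fun i => (f1 i : V)) (fun i => (f2 i : V))) a)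
        (Sum.elim (fun i : Fin (2 * p + 1) => s i) (Sum.elim (fun i => (f1 i : V)) (fun i => (f2 i : V))) b) := by
    rintro (i | i | i) (j | j | j) h <;> simp only [ldsRel] at h <;> try exact h.elim
    · simp only [Sum.elim_inl]
      rw [h]; apply hadj; have := j.2; omega
    · simp only [Sum.elim_inl, Sum.elim_inr]
      rw [h]; exact ha1 _ (f1 j).2
    · simp only [Sum.elim_inl, Sum.elim_inr]
      have : (i : ℕ) = 2 * p := by omega
      rw [this]; exact ha2 _ (f2 j).2
  refine ⟨Sum.elim (fun i : Fin (2 * p + 1) => s i) (Sum.elim (fun i => (f1 i : V)) (fun i => (f2 i : V))), ?_, ?_⟩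
  · rintro (i | i | i) (j | j | j) h <;> simp only [Sum.elim_inl, Sum.elim_inr] at h
    · have := hinj i (by have := i.2; omega) j (by have := j.2; omega) h
      rw [Fin.ext this]
    · exact absurd (h ▸ (f1 j).2) (hs1 i (by have := i.2; omega))
    · exact absurd (h ▸ (f2 j).2) (hs2 i (by have := i.2; omega))
    · exact absurd (h ▸ (f1 i).2) (hs1 j (by have := j.2; omega))
    · rw [f1.injective (Subtype.ext h)]
    · exact absurd (h ▸ (f2 j).2) (Finset.disjoint_left.1 hd (f1 i).2)
    · exact absurd (h ▸ (f2 i).2) (hs2 j (by have := j.2; omega))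
    · exact absurd (h ▸ (f2 i).2) (Finset.disjoint_left.1 hd (f1 j).2)
    · rw [f2.injective (Subtype.ext h)]
  · intro a b hab
    rw [LinkedDoubleStar, SimpleGraph.fromRel_adj] at hab
    rcases hab.2 with h | h
    · exact key _ _ h
    · exact (key _ _ h).symm

/-- The same, with the `n`-star at the other end. -/
theorem hasCopy_of_spine' (H : SimpleGraph V) (p n m : ℕ) (s : ℕ → V)
    (hinj : ∀ i ≤ 2 * p, ∀ j ≤ 2 * p, s i = s j → i = j)
    (hadj : ∀ i < 2 * p, H.Adj (s i) (s (i + 1)))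
    (L1 L2 : Finset V) (h1 : m ≤ L1.card) (h2 : n ≤ L2.card) (hd : Disjoint L1 L2)
    (hs1 : ∀ i ≤ 2 * p, s i ∉ L1) (hs2 : ∀ i ≤ 2 * p, s i ∉ L2)
    (ha1 : ∀ v ∈ L1, H.Adj (s 0) v) (ha2 : ∀ v ∈ L2, H.Adj (s (2 * p)) v) :
    HasCopy (LinkedDoubleStar (2 * p + 1) n m) H := by
  refine hasCopy_of_spine H p n m (fun k => s (2 * p - k)) ?_ ?_ L2 L1 h2 h1 hd.symm
    (fun i _ => hs2 _ (by omega)) (fun i _ => hs1 _ (by omega)) ?_ ?_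
  · intro i hi j hj h
    have := hinj _ (by omega) _ (by omega) h
    omega
  · intro i hi
    have := (hadj (2 * p - (i + 1)) (by omega)).symm
    rwa [show 2 * p - (i + 1) + 1 = 2 * p - i by omega] at this
  · simpa using ha2
  · simpa using ha1

/-- Interleaving `α 0, β 0, α 1, β 1, …, β (p-1), α p`. -/
def inter (α β : ℕ → V) (k : ℕ) : V := if k % 2 = 0 then α (k / 2) else β (k / 2)

theorem inter_inj (α β : ℕ → V) (p : ℕ)
    (hα : ∀ i ≤ p, ∀ j ≤ p, α i = α j → i = j) (hβ : ∀ i < p, ∀ j < p, β i = β j → i = j)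
    (hd : ∀ i ≤ p, ∀ j < p, α i ≠ β j) :
    ∀ i ≤ 2 * p, ∀ j ≤ 2 * p, inter α β i = inter α β j → i = j := by
  intro i hi j hj h
  unfold inter at h
  split_ifs at h with h1 h2 h2
  · have := hα _ (by omega) _ (by omega) h; omega
  · exact absurd h (hd _ (by omega) _ (by omega))
  · exact absurd h.symm (hd _ (by omega) _ (by omega))
  · have := hβ _ (by omega) _ (by omega) h; omega

theorem inter_adj (H : SimpleGraph V) (α β : ℕ → V) (p : ℕ)
    (h1 : ∀ i < p, H.Adj (β i) (α i)) (h2 : ∀ i < p, H.Adj (β i) (α (i + 1))) :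
    ∀ i < 2 * p, H.Adj (inter α β i) (inter α β (i + 1)) := by
  intro i hi
  unfold inter
  split_ifs with h3 h4 h4
  · omega
  · rw [show (i + 1) / 2 = i / 2 by omega]; exact (h1 _ (by omega)).symm
  · rw [show (i + 1) / 2 = i / 2 + 1 by omega]; exact h2 _ (by omega)
  · omega

theorem inter_notMem (α β : ℕ → V) (p : ℕ) (L : Finset V)
    (h1 : ∀ i ≤ p, α i ∉ L) (h2 : ∀ i < p, β i ∉ L) : ∀ i ≤ 2 * p, inter α β i ∉ L := by
  intro i hi
  unfold inter
  split_ifs with h3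
  · exact h1 _ (by omega)
  · exact h2 _ (by omega)

theorem hasCopy_inter (H : SimpleGraph V) (p n m : ℕ) (α β : ℕ → V)
    (hα : ∀ i ≤ p, ∀ j ≤ p, α i = α j → i = j) (hβ : ∀ i < p, ∀ j < p, β i = β j → i = j)
    (hd : ∀ i ≤ p, ∀ j < p, α i ≠ β j)
    (h1 : ∀ i < p, H.Adj (β i) (α i)) (h2 : ∀ i < p, H.Adj (β i) (α (i + 1)))
    (L1 L2 : Finset V) (hc1 : n ≤ L1.card) (hc2 : m ≤ L2.card) (hL : Disjoint L1 L2)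
    (hs1 : ∀ i ≤ p, α i ∉ L1) (ht1 : ∀ i < p, β i ∉ L1)
    (hs2 : ∀ i ≤ p, α i ∉ L2) (ht2 : ∀ i < p, β i ∉ L2)
    (ha1 : ∀ v ∈ L1, H.Adj (α 0) v) (ha2 : ∀ v ∈ L2, H.Adj (α p) v) :
    HasCopy (LinkedDoubleStar (2 * p + 1) n m) H := by
  refine hasCopy_of_spine H p n m (inter α β) (inter_inj α β p hα hβ hd) (inter_adj H α β p h1 h2)
    L1 L2 hc1 hc2 hL (inter_notMem α β p L1 hs1 ht1) (inter_notMem α β p L2 hs2 ht2) ?_ ?_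
  · simpa [inter] using ha1
  · simpa [inter] using ha2

theorem hasCopy_inter' (H : SimpleGraph V) (p n m : ℕ) (α β : ℕ → V)
    (hα : ∀ i ≤ p, ∀ j ≤ p, α i = α j → i = j) (hβ : ∀ i < p, ∀ j < p, β i = β j → i = j)
    (hd : ∀ i ≤ p, ∀ j < p, α i ≠ β j)
    (h1 : ∀ i < p, H.Adj (β i) (α i)) (h2 : ∀ i < p, H.Adj (β i) (α (i + 1)))
    (L1 L2 : Finset V) (hc1 : m ≤ L1.card) (hc2 : n ≤ L2.card) (hL : Disjoint L1 L2)
    (hs1 : ∀ i ≤ p, α i ∉ L1) (ht1 : ∀ i < p, β i ∉ L1)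
    (hs2 : ∀ i ≤ p, α i ∉ L2) (ht2 : ∀ i < p, β i ∉ L2)
    (ha1 : ∀ v ∈ L1, H.Adj (α 0) v) (ha2 : ∀ v ∈ L2, H.Adj (α p) v) :
    HasCopy (LinkedDoubleStar (2 * p + 1) n m) H := by
  refine hasCopy_of_spine' H p n m (inter α β) (inter_inj α β p hα hβ hd) (inter_adj H α β p h1 h2)
    L1 L2 hc1 hc2 hL (inter_notMem α β p L1 hs1 ht1) (inter_notMem α β p L2 hs2 ht2) ?_ ?_
  · simpa [inter] using ha1
  · simpa [inter] using ha2

/-- Alternating path `w 0, y 0, w 1, y 1, …, w (m-1), y (m-1)`. -/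
structure AP (r : V → V → Prop) (m : ℕ) (w y : ℕ → V) : Prop where
  wi : ∀ i < m, ∀ j < m, w i = w j → i = j
  yi : ∀ i < m, ∀ j < m, y i = y j → i = j
  e1 : ∀ i < m, r (y i) (w i)
  e2 : ∀ i, i + 1 < m → r (y i) (w (i + 1))

noncomputable def im (m : ℕ) (w : ℕ → V) : Finset V := (Finset.range m).image w

theorem mem_im {m : ℕ} {w : ℕ → V} {v : V} : v ∈ im m w ↔ ∃ i < m, w i = v := by
  simp [im]

theorem AP.card_w {r : V → V → Prop} {m : ℕ} {w y : ℕ → V} (h : AP r m w y) : (im m w).card = m := by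
  rw [im, Finset.card_image_of_injOn, Finset.card_range]
  intro a ha b hb hab
  exact h.wi a (by simpa using ha) b (by simpa using hb) hab

theorem AP.card_y {r : V → V → Prop} {m : ℕ} {w y : ℕ → V} (h : AP r m w y) : (im m y).card = m := by
  rw [im, Finset.card_image_of_injOn, Finset.card_range]
  intro a ha b hb hab
  exact h.yi a (by simpa using ha) b (by simpa using hb) hab

/-- `Reach r z m W A e`: there is an alternating path starting at `z`, with `B`-vertex set `W`,
`A`-vertex set `A` (both of size `m > 0`), ending at `e ∈ A`. -/
def Reach (r : V → V → Prop) (z : V) (m : ℕ) (W A : Finset V) (e : V) : Prop :=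
  ∃ w y, AP r m w y ∧ w 0 = z ∧ 0 < m ∧ im m w = W ∧ im m y = A ∧ y (m - 1) = e

theorem AP.rotate {r : V → V → Prop} {m : ℕ} {w y : ℕ → V} (h : AP r m w y) {i : ℕ}
    (hi : i + 1 < m) (hr : r (y (m - 1)) (w i)) :
    AP r m (fun k => if k ≤ i then w k else w (m + i - k))
      (fun k => if k < i then y k else y (m - 1 + i - k)) := by
  refine ⟨?_, ?_, ?_, ?_⟩
  · intro a ha b hb hab
    try simp only at hab
    split_ifs at hab <;> have := h.wi _ (by omega) _ (by omega) hab <;> omega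
  · intro a ha b hb hab
    try simp only at hab
    split_ifs at hab <;> have := h.yi _ (by omega) _ (by omega) hab <;> omega
  · intro k hk
    try simp only
    rcases lt_trichotomy k i with h1 | h1 | h1
    · rw [if_pos h1, if_pos h1.le]; exact h.e1 k hk
    · subst h1
      rw [if_neg (lt_irrefl _), if_pos le_rfl, show m - 1 + k - k = m - 1 by omega]; exact hr
    · rw [if_neg (by omega), if_neg (by omega)]
      have := h.e2 (m - 1 + i - k) (by omega)
      rwa [show m - 1 + i - k + 1 = m + i - k by omega] at this
  · intro k hk
    try simp only
    rcases lt_trichotomy k i with h1 | h1 | h1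
    · rw [if_pos h1, if_pos (by omega)]; exact h.e2 k hk
    · subst h1
      rw [if_neg (lt_irrefl _), if_neg (by omega), show m - 1 + k - k = m - 1 by omega,
        show m + k - (k + 1) = m - 1 by omega]; exact h.e1 _ (by omega)
    · rw [if_neg (by omega), if_neg (by omega), show m + i - (k + 1) = m - 1 + i - k by omega]
      exact h.e1 _ (by omega)

theorem im_rotate_w {m i : ℕ} (hi : i + 1 < m) (w : ℕ → V) :
    im m (fun k => if k ≤ i then w k else w (m + i - k)) = im m w := by
  ext v
  simp only [mem_im]
  constructor
  · rintro ⟨k, hk, rfl⟩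
    split_ifs
    · exact ⟨k, hk, rfl⟩
    · exact ⟨_, by omega, rfl⟩
  · rintro ⟨k, hk, rfl⟩
    by_cases h : k ≤ i
    · exact ⟨k, hk, by rw [if_pos h]⟩
    · exact ⟨m + i - k, by omega, by rw [if_neg (by omega)]; congr 1; omega⟩

theorem im_rotate_y {m i : ℕ} (hi : i + 1 < m) (y : ℕ → V) :
    im m (fun k => if k < i then y k else y (m - 1 + i - k)) = im m y := by
  ext v
  simp only [mem_im]
  constructor
  · rintro ⟨k, hk, rfl⟩
    split_ifs
    · exact ⟨k, hk, rfl⟩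
    · exact ⟨_, by omega, rfl⟩
  · rintro ⟨k, hk, rfl⟩
    by_cases h : k < i
    · exact ⟨k, hk, by rw [if_pos h]⟩
    · exact ⟨m - 1 + i - k, by omega, by rw [if_neg (by omega)]; congr 1; omega⟩

/-- Replacing the end vertex. -/
theorem AP.replace {r : V → V → Prop} {m : ℕ} {w y : ℕ → V} (h : AP r m w y) (hm : 0 < m) {x : V}
    (hx : x ∉ im m y) (hr : r x (w (m - 1))) :
    AP r m w (Function.update y (m - 1) x) := by
  have hx' : ∀ i < m, y i ≠ x := fun i hi h => hx (mem_im.2 ⟨i, hi, h⟩)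
  refine ⟨h.wi, ?_, ?_, ?_⟩
  · intro a ha b hb hab
    simp only [Function.update_apply] at hab
    split_ifs at hab
    · omega
    · exact absurd hab.symm (hx' b hb)
    · exact absurd hab (hx' a ha)
    · exact h.yi a ha b hb hab
  · intro k hk
    simp only [Function.update_apply]
    split_ifs with h1
    · rw [h1]; exact hr
    · exact h.e1 k hk
  · intro k hk
    rw [Function.update_of_ne (by omega)]
    exact h.e2 k hk

theorem AP.im_replace {r : V → V → Prop} {m : ℕ} {w y : ℕ → V} (h : AP r m w y) (hm : 0 < m) (x : V) :
    im m (Function.update y (m - 1) x) = insert x ((im m y).erase (y (m - 1))) := by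
  ext v
  simp only [mem_im, Finset.mem_insert, Finset.mem_erase, Function.update_apply]
  constructor
  · rintro ⟨k, hk, h1⟩
    split_ifs at h1 with h2
    · exact Or.inl h1.symm
    · refine Or.inr ⟨?_, k, hk, h1⟩
      rintro rfl
      exact h2 (h.yi _ hk _ (by omega) h1)
  · rintro (rfl | ⟨h1, k, hk, rfl⟩)
    · exact ⟨m - 1, by omega, by simp⟩
    · refine ⟨k, hk, ?_⟩
      rw [if_neg]
      rintro rfl
      exact h1 rfl

theorem AP.extend {r : V → V → Prop} {m : ℕ} {w y : ℕ → V} (h : AP r m w y) (hm : 0 < m) {x u : V}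
    (hx : x ∉ im m y) (hu : u ∉ im m w) (hr : r (y (m - 1)) u) (hr' : r x u) :
    AP r (m + 1) (Function.update w m u) (Function.update y m x) := by
  have hx' : ∀ i < m, y i ≠ x := fun i hi h => hx (mem_im.2 ⟨i, hi, h⟩)
  have hu' : ∀ i < m, w i ≠ u := fun i hi h => hu (mem_im.2 ⟨i, hi, h⟩)
  refine ⟨?_, ?_, ?_, ?_⟩
  · intro a ha b hb hab
    simp only [Function.update_apply] at hab
    split_ifs at hab
    · omega
    · exact absurd hab.symm (hu' b (by omega))
    · exact absurd hab (hu' a (by omega))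
    · exact h.wi a (by omega) b (by omega) hab
  · intro a ha b hb hab
    simp only [Function.update_apply] at hab
    split_ifs at hab
    · omega
    · exact absurd hab.symm (hx' b (by omega))
    · exact absurd hab (hx' a (by omega))
    · exact h.yi a (by omega) b (by omega) hab
  · intro k hk
    simp only [Function.update_apply]
    split_ifs with h1
    · exact hr'
    · exact h.e1 k (by omega)
  · intro k hk
    rw [Function.update_of_ne (show k ≠ m by omega)]
    by_cases h1 : k + 1 = m
    · rw [h1, Function.update_self]
      rwa [show k = m - 1 by omega]
    · rw [Function.update_of_ne h1]
      exact h.e2 k (by omega)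

theorem im_succ_update (m : ℕ) (w : ℕ → V) (u : V) :
    im (m + 1) (Function.update w m u) = insert u (im m w) := by
  ext v
  simp only [mem_im, Finset.mem_insert, Function.update_apply]
  constructor
  · rintro ⟨k, hk, h1⟩
    split_ifs at h1 with h2
    · exact Or.inl h1.symm
    · exact Or.inr ⟨k, by omega, h1⟩
  · rintro (rfl | ⟨k, hk, rfl⟩)
    · exact ⟨m, by omega, by simp⟩
    · exact ⟨k, by omega, by rw [if_neg (by omega)]⟩

theorem AP.mono {r : V → V → Prop} {m k : ℕ} {w y : ℕ → V} (h : AP r m w y) (hk : k ≤ m) :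
    AP r k w y :=
  ⟨fun i hi j hj => h.wi i (by omega) j (by omega), fun i hi j hj => h.yi i (by omega) j (by omega),
    fun i hi => h.e1 i (by omega), fun i hi => h.e2 i (by omega)⟩

theorem im_mono {m k : ℕ} (w : ℕ → V) (hk : k ≤ m) : im k w ⊆ im m w := by
  intro v hv
  obtain ⟨i, hi, h⟩ := mem_im.1 hv
  exact mem_im.2 ⟨i, by omega, h⟩

theorem Reach.card_W {r : V → V → Prop} {z : V} {m : ℕ} {W A : Finset V} {e : V}
    (h : Reach r z m W A e) : W.card = m := by
  obtain ⟨w, y, hP, -, -, rfl, rfl, -⟩ := h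
  exact hP.card_w

theorem Reach.card_A {r : V → V → Prop} {z : V} {m : ℕ} {W A : Finset V} {e : V}
    (h : Reach r z m W A e) : A.card = m := by
  obtain ⟨w, y, hP, -, -, rfl, rfl, -⟩ := h
  exact hP.card_y

theorem Reach.e_mem {r : V → V → Prop} {z : V} {m : ℕ} {W A : Finset V} {e : V}
    (h : Reach r z m W A e) : e ∈ A := by
  obtain ⟨w, y, hP, -, hm, rfl, rfl, rfl⟩ := h
  exact mem_im.2 ⟨m - 1, by omega, rfl⟩

theorem Reach.extend {r : V → V → Prop} {z : V} {m : ℕ} {W A : Finset V} {e : V}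
    (h : Reach r z m W A e) {x u : V} (hx : x ∉ A) (hu : u ∉ W) (hr : r e u) (hr' : r x u) :
    Reach r z (m + 1) (insert u W) (insert x A) x := by
  obtain ⟨w, y, hP, hz, hm, rfl, rfl, rfl⟩ := h
  refine ⟨_, _, hP.extend hm hx hu hr hr', ?_, by omega, im_succ_update _ _ _,
    im_succ_update _ _ _, by simp⟩
  rw [Function.update_of_ne (by omega)]; exact hz

theorem AP.reach_rotate {r : V → V → Prop} {m : ℕ} {w y : ℕ → V} (h : AP r m w y) {i : ℕ}
    (hi : i + 1 < m) (hr : r (y (m - 1)) (w i)) :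
    Reach r (w 0) m (im m w) (im m y) (y i) := by
  refine ⟨_, _, h.rotate hi hr, by simp, by omega, im_rotate_w hi w, im_rotate_y hi y, ?_⟩
  try simp only
  rw [if_neg (by omega)]
  congr 1; omega

/-- Drop `y i`, with new end `x`. -/
theorem AP.reach_drop {r : V → V → Prop} {m : ℕ} {w y : ℕ → V} (h : AP r m w y) {i : ℕ}
    (hi : i + 1 < m) (hr : r (y (m - 1)) (w i)) {x : V} (hx : x ∉ im m y) (hxr : r x (w (i + 1))) :
    Reach r (w 0) m (im m w) (insert x ((im m y).erase (y i))) x := by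
  have h1 := h.rotate hi hr
  have hx' : x ∉ im m (fun k => if k < i then y k else y (m - 1 + i - k)) := by
    rwa [im_rotate_y hi]
  have h2 := h1.replace (by omega) hx' (by
    (try simp only); rw [if_neg (by omega), show m + i - (m - 1) = i + 1 by omega]; exact hxr)
  refine ⟨_, _, h2, by simp, by omega, im_rotate_w hi w, ?_, by simp⟩
  rw [h1.im_replace (by omega), im_rotate_y hi]
  try simp only
  rw [if_neg (by omega), show m - 1 + i - (m - 1) = i by omega]

theorem AP.reach_replace {r : V → V → Prop} {m : ℕ} {w y : ℕ → V} (h : AP r m w y) (hm : 0 < m)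
    {x : V} (hx : x ∉ im m y) (hxr : r x (w (m - 1))) :
    Reach r (w 0) m (im m w) (insert x ((im m y).erase (y (m - 1)))) x :=
  ⟨_, _, h.replace hm hx hxr, rfl, hm, rfl, h.im_replace hm x, by simp⟩

/-- Drop both `y i` and `y j`, ending at `y j` again. -/
theorem AP.reach_double {r : V → V → Prop} {m : ℕ} {w y : ℕ → V} (h : AP r m w y) {i j : ℕ}
    (hij : i < j) (hj : j + 1 < m) (hr : r (y (m - 1)) (w i)) {x : V} (hx : x ∉ im m y)
    (hxr : r x (w (i + 1))) (hxr' : r x (w (j + 1))) :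
    Reach r (w 0) m (im m w) (insert x ((im m y).erase (y i))) (y j) := by
  have hi : i + 1 < m := by omega
  have h1 := h.rotate hi hr
  have hx' : x ∉ im m (fun k => if k < i then y k else y (m - 1 + i - k)) := by
    rwa [im_rotate_y hi]
  have h2 := h1.replace (by omega) hx' (by
    (try simp only); rw [if_neg (by omega), show m + i - (m - 1) = i + 1 by omega]; exact hxr)
  have h3 := h2.reach_rotate (i := m + i - j - 1) (by omega) (by
    simp only [Function.update_self]
    rw [if_neg (by omega), show m + i - (m + i - j - 1) = j + 1 by omega]; exact hxr')
  rw [h1.im_replace (by omega), im_rotate_y hi, im_rotate_w hi] at h3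
  try simp only at h3
  rw [if_pos (Nat.zero_le i), if_neg (show ¬ m - 1 < i by omega),
    show m - 1 + i - (m - 1) = i by omega,
    Function.update_of_ne (show m + i - j - 1 ≠ m - 1 by omega),
    if_neg (show ¬ m + i - j - 1 < i by omega),
    show m - 1 + i - (m + i - j - 1) = j by omega] at h3
  exact h3

end LDS

namespace LDS
open scoped Classical
universe u
variable {V : Type u}

/-- Number of path indices adjacent to `v`. -/
noncomputable def tt (r : V → V → Prop) (m : ℕ) (w : ℕ → V) (v : V) : ℕ :=
  ((Finset.range m).filter (fun i => r v (w i))).card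

/-- Degree into a finite set. -/
noncomputable def dg (r : V → V → Prop) (B : Finset V) (v : V) : ℕ := (B.filter (r v)).card

/-- No common neighbour in `B \ W`. -/
def Perp (r : V → V → Prop) (B W : Finset V) (v v' : V) : Prop :=
  ∀ u ∈ B, u ∉ W → r v u → r v' u → False

theorem Perp.symm {r : V → V → Prop} {B W : Finset V} {v v' : V} (h : Perp r B W v v') :
    Perp r B W v' v := fun u hu hw h1 h2 => h u hu hw h2 h1

theorem not_perp {r : V → V → Prop} {B W : Finset V} {v v' : V} (h : ¬ Perp r B W v v') :
    ∃ u ∈ B, u ∉ W ∧ r v u ∧ r v' u := by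
  unfold Perp at h; push Not at h
  obtain ⟨u, h1, h2, h3, h4, -⟩ := h
  exact ⟨u, h1, h2, h3, h4⟩

theorem Perp.disj {r : V → V → Prop} {B W : Finset V} {v v' : V} (h : Perp r B W v v') :
    Disjoint ((B \ W).filter (r v)) ((B \ W).filter (r v')) := by
  rw [Finset.disjoint_left]
  intro u hu hu'
  simp only [Finset.mem_filter, Finset.mem_sdiff] at hu hu'
  exact h u hu.1.1 hu.1.2 hu.2 hu'.2

theorem AP.tt_eq {r : V → V → Prop} {m : ℕ} {w y : ℕ → V} (h : AP r m w y) (v : V) :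
    tt r m w v = dg r (im m w) v := by
  unfold tt dg im
  rw [Finset.filter_image, Finset.card_image_of_injOn]
  intro a ha b hb hab
  simp at ha hb
  exact h.wi a ha.1 b hb.1 hab

theorem tt_le (r : V → V → Prop) (m : ℕ) (w : ℕ → V) (v : V) : tt r m w v ≤ m := by
  unfold tt
  exact (Finset.card_filter_le _ _).trans (by simp)

theorem dg_split (r : V → V → Prop) {B W : Finset V} (hW : W ⊆ B) (v : V) :
    dg r B v = dg r W v + ((B \ W).filter (r v)).card := by
  unfold dg
  rw [← Finset.card_union_of_disjoint, ← Finset.filter_union, Finset.union_sdiff_of_subset hW]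
  exact Finset.disjoint_filter_filter Finset.disjoint_sdiff

theorem AP.crossing {r : V → V → Prop} {m k : ℕ} {w y : ℕ → V} (h : AP r m w y) (hm : 0 < m)
    {B : Finset V} (hW : im m w ⊆ B) {x : V}
    (he : k ≤ dg r B (y (m - 1))) (hx : k ≤ dg r B x) (hp : Perp r B (im m w) (y (m - 1)) x) :
    2 * k ≤ ((Finset.range (m - 1)).filter
      (fun i => r (y (m - 1)) (w i) ∧ r x (w (i + 1)))).card + B.card + 1 := by
  set e := y (m - 1) with hedef
  rw [dg_split r hW, ← h.tt_eq] at he hx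
  have h1 : ((B \ im m w).filter (r e)).card + ((B \ im m w).filter (r x)).card
      ≤ (B \ im m w).card := by
    rw [← Finset.card_union_of_disjoint hp.disj]
    exact Finset.card_le_card (Finset.union_subset (Finset.filter_subset _ _) (Finset.filter_subset _ _))
  rw [Finset.card_sdiff_of_subset hW, h.card_w] at h1
  have hWc := Finset.card_le_card hW
  rw [h.card_w] at hWc
  set P := (Finset.range (m - 1)).filter (fun i => r e (w i)) with hP
  set Q := (Finset.range (m - 1)).filter (fun i => r x (w (i + 1))) with hQ
  have h2 : tt r m w e ≤ P.card + 1 := by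
    unfold tt
    rw [← Finset.card_insert_of_notMem (a := m - 1) (s := P) (by simp [hP])]
    apply Finset.card_le_card
    intro i hi
    simp only [Finset.mem_filter, Finset.mem_range] at hi
    simp only [Finset.mem_insert, hP, Finset.mem_filter, Finset.mem_range]
    by_cases hh : i = m - 1
    · exact Or.inl hh
    · exact Or.inr ⟨by omega, hi.2⟩
  have h3 : tt r m w x ≤ Q.card + 1 := by
    unfold tt
    have : Q.card = (Q.image (fun i => i + 1)).card := by
      rw [Finset.card_image_of_injective]; intro a b; simp
    rw [this, ← Finset.card_insert_of_notMem (a := 0) (s := Q.image (fun i => i + 1)) (by simp)]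
    apply Finset.card_le_card
    intro i hi
    simp only [Finset.mem_filter, Finset.mem_range] at hi
    simp only [Finset.mem_insert, hQ, Finset.mem_filter, Finset.mem_range, Finset.mem_image]
    by_cases hh : i = 0
    · exact Or.inl hh
    · exact Or.inr ⟨i - 1, ⟨by omega, by rw [show i - 1 + 1 = i by omega]; exact hi.2⟩, by omega⟩
  have h4 : P.card + Q.card = (P ∪ Q).card + (P ∩ Q).card := (Finset.card_union_add_card_inter P Q).symm
  have h5 : (P ∪ Q).card ≤ m - 1 := by
    calc (P ∪ Q).card ≤ (Finset.range (m - 1)).card := Finset.card_le_card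
          (Finset.union_subset (Finset.filter_subset _ _) (Finset.filter_subset _ _))
      _ = _ := by simp
  have h6 : P ∩ Q = (Finset.range (m - 1)).filter (fun i => r e (w i) ∧ r x (w (i + 1))) := by
    rw [hP, hQ, Finset.filter_and]
  rw [← h6]
  omega

theorem AP.cross {r : V → V → Prop} {m k : ℕ} {w y : ℕ → V} (h : AP r m w y) (hm : 0 < m)
    {B : Finset V} (hW : im m w ⊆ B) {x : V} (hb : B.card + 2 ≤ 2 * k)
    (he : k ≤ dg r B (y (m - 1))) (hx : k ≤ dg r B x) (hxA : x ∉ im m y)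
    (hp : Perp r B (im m w) (y (m - 1)) x) :
    ∃ v, Reach r (w 0) m (im m w) (insert x ((im m y).erase v)) x := by
  have := h.crossing hm hW he hx hp
  obtain ⟨i, hi⟩ := Finset.card_pos.1 (show 0 < _ by
    by_contra hc
    rw [Nat.pos_iff_ne_zero, not_not] at hc
    rw [hc] at this; omega)
  simp only [Finset.mem_filter, Finset.mem_range] at hi
  exact ⟨y i, h.reach_drop (by omega) hi.2.1 hxA hi.2.2⟩

theorem Reach.cross {r : V → V → Prop} {z : V} {m k : ℕ} {W A : Finset V} {e : V}
    (h : Reach r z m W A e) {B : Finset V} (hW : W ⊆ B) {x : V} (hb : B.card + 2 ≤ 2 * k)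
    (he : k ≤ dg r B e) (hx : k ≤ dg r B x) (hxA : x ∉ A) (hp : Perp r B W e x) :
    ∃ v, Reach r z m W (insert x (A.erase v)) x := by
  obtain ⟨w, y, hP, rfl, hm, rfl, rfl, rfl⟩ := h
  exact hP.cross hm hW hb he hx hxA hp

theorem lemG {r : V → V → Prop} {m k : ℕ} {w y : ℕ → V} (h : AP r m w y) (hm : 0 < m)
    {B : Finset V} (hW : im m w ⊆ B) (hb : B.card + 2 ≤ 2 * k) (hmk : m < k)
    (K : Finset V) (hK3 : 3 ≤ K.card) (hdK : ∀ x ∈ K, k ≤ dg r B x)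
    (hdY : ∀ i < m, k ≤ dg r B (y i))
    (hmiss : 2 * (m - tt r m w (y (m - 1))) ≤ ∑ x ∈ K, (m - tt r m w x))
    (C1 : ∀ x ∈ K, ∀ x' ∈ K, x ≠ x' → Perp r B (im m w) x x')
    (C2 : ∀ i, i + 1 < m → r (y (m - 1)) (w i) → ∀ x ∈ K, Perp r B (im m w) (y i) x)
    (C3 : ∀ i j, i < j → j + 1 < m → r (y (m - 1)) (w i) → r (y (m - 1)) (w j) →
      ∀ x ∈ K, r x (w (i + 1)) → r x (w (j + 1)) → Perp r B (im m w) (y i) (y j)) : False := by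
  set e := y (m - 1) with hedef
  set U : V → Finset V := fun v => (B \ im m w).filter (r v) with hU
  set M := ∑ x ∈ K, (m - tt r m w x) with hM
  set G := (Finset.range (m - 1)).filter
    (fun i => r e (w i) ∧ (K.filter (fun x => ¬ r x (w (i + 1)))).card ≤ 1) with hG
  have hWc := Finset.card_le_card hW
  rw [h.card_w] at hWc
  have hUc : ∀ v, k ≤ dg r B v → (k - m) + (m - tt r m w v) ≤ (U v).card := by
    intro v hv
    rw [dg_split r hW, ← h.tt_eq] at hv
    have := tt_le r m w v
    change k ≤ _ + (U v).card at hv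
    omega
  -- bound on the size of G
  have hGc : m - 1 ≤ G.card + M := by
    set N1 := (Finset.range (m - 1)).filter (fun i => ¬ r e (w i)) with hN1
    set N2 := (Finset.range (m - 1)).filter
      (fun i => 2 ≤ (K.filter (fun x => ¬ r x (w (i + 1)))).card) with hN2
    have h1 : Finset.range (m - 1) ⊆ G ∪ (N1 ∪ N2) := by
      intro i hi
      simp only [hG, hN1, hN2, Finset.mem_union, Finset.mem_filter, hi, true_and]
      by_cases h1 : r e (w i)
      · by_cases h2 : (K.filter (fun x => ¬ r x (w (i + 1)))).card ≤ 1
        · exact Or.inl ⟨h1, h2⟩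
        · exact Or.inr (Or.inr (by omega))
      · exact Or.inr (Or.inl h1)
    have h2 := Finset.card_le_card h1
    rw [Finset.card_range] at h2
    have h3 := Finset.card_union_le G (N1 ∪ N2)
    have h4 := Finset.card_union_le N1 N2
    have hcompl : ∀ v, ((Finset.range m).filter (fun i => ¬ r v (w i))).card = m - tt r m w v := by
      intro v
      have := Finset.card_filter_add_card_filter_not (s := Finset.range m) (fun i => r v (w i))
      rw [Finset.card_range] at this
      unfold tt; omega
    have h5 : N1.card ≤ m - tt r m w e := by
      rw [← hcompl]
      apply Finset.card_le_card
      intro i hi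
      simp only [hN1, Finset.mem_filter, Finset.mem_range] at hi ⊢
      exact ⟨by omega, hi.2⟩
    have h6 : 2 * N2.card ≤ M := by
      calc 2 * N2.card = ∑ i ∈ N2, 2 := by simp [mul_comm]
        _ ≤ ∑ i ∈ N2, (K.filter (fun x => ¬ r x (w (i + 1)))).card := by
            apply Finset.sum_le_sum
            intro i hi
            exact (Finset.mem_filter.1 hi).2
        _ ≤ ∑ i ∈ Finset.range (m - 1), (K.filter (fun x => ¬ r x (w (i + 1)))).card :=
            Finset.sum_le_sum_of_subset (Finset.filter_subset _ _)
        _ = ∑ x ∈ K, ((Finset.range (m - 1)).filter (fun i => ¬ r x (w (i + 1)))).card := by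
            simp only [Finset.card_filter]
            exact Finset.sum_comm
        _ ≤ M := by
            apply Finset.sum_le_sum
            intro x _
            rw [← hcompl]
            apply Finset.card_le_card_of_injOn (fun i => i + 1)
            · intro i hi
              simp only [Finset.coe_filter, Finset.mem_range, Set.mem_setOf_eq] at hi ⊢
              exact ⟨by omega, hi.2⟩
            · intro a _ b _ hab
              simpa using hab
    omega
  have hS1 : K.card * (k - m) + M ≤ (K.biUnion U).card := by
    rw [Finset.card_biUnion (fun x hx x' hx' hne => (C1 x hx x' hx' hne).disj), hM,
      ← smul_eq_mul, ← Finset.sum_const, ← Finset.sum_add_distrib]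
    exact Finset.sum_le_sum (fun x hx => hUc x (hdK x hx))
  have hGpair : ∀ i ∈ G, ∀ j ∈ G, i < j → Perp r B (im m w) (y i) (y j) := by
    intro i hi j hj hij
    simp only [hG, Finset.mem_filter, Finset.mem_range] at hi hj
    obtain ⟨x, hxK, hx⟩ : ∃ x ∈ K, x ∉ (K.filter (fun x => ¬ r x (w (i + 1)))) ∪
        (K.filter (fun x => ¬ r x (w (j + 1)))) := by
      by_contra hc
      push Not at hc
      have h1 := Finset.card_le_card (show K ⊆ _ from hc)
      have h2 := Finset.card_union_le (K.filter (fun x => ¬ r x (w (i + 1))))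
        (K.filter (fun x => ¬ r x (w (j + 1))))
      omega
    simp only [Finset.mem_union, Finset.mem_filter, hxK, true_and, not_or, not_not] at hx
    exact C3 i j hij (by omega) hi.2.1 hj.2.1 x hxK hx.1 hx.2
  have hS2 : G.card * (k - m) ≤ (G.biUnion (fun i => U (y i))).card := by
    rw [Finset.card_biUnion, ← smul_eq_mul, ← Finset.sum_const]
    · apply Finset.sum_le_sum
      intro i hi
      simp only [hG, Finset.mem_filter, Finset.mem_range] at hi
      have := hUc (y i) (hdY i (by omega))
      omega
    · intro i hi j hj hne
      rcases lt_or_gt_of_ne hne with hlt | hlt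
      · exact (hGpair i hi j hj hlt).disj
      · exact (hGpair j hj i hi hlt).disj.symm
  have hdisj : Disjoint (K.biUnion U) (G.biUnion (fun i => U (y i))) := by
    rw [Finset.disjoint_biUnion_left]
    intro x hx
    rw [Finset.disjoint_biUnion_right]
    intro i hi
    simp only [hG, Finset.mem_filter, Finset.mem_range] at hi
    exact (C2 i (by omega) hi.2.1 x hx).disj.symm
  have htot : (K.biUnion U).card + (G.biUnion (fun i => U (y i))).card ≤ B.card - m := by
    rw [← Finset.card_union_of_disjoint hdisj, ← h.card_w, ← Finset.card_sdiff_of_subset hW]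
    apply Finset.card_le_card
    apply Finset.union_subset
    · exact Finset.biUnion_subset.2 (fun x _ => Finset.filter_subset _ _)
    · exact Finset.biUnion_subset.2 (fun x _ => Finset.filter_subset _ _)
  have h1 : 3 * (k - m) ≤ K.card * (k - m) := Nat.mul_le_mul_right _ hK3
  have h2 : G.card * 1 ≤ G.card * (k - m) := Nat.mul_le_mul_left _ (by omega)
  omega

end LDS

namespace LDS
open scoped Classical
universe u
variable {V : Type u}

theorem exists_max {α : Type*} (P : α → Prop) (f : α → ℕ) (N : ℕ) (hN : ∀ a, P a → f a ≤ N)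
    (hne : ∃ a, P a) : ∃ a, P a ∧ ∀ a', P a' → f a' ≤ f a := by
  obtain ⟨a0, ha0⟩ := hne
  have h1 := Nat.findGreatest_spec (P := fun t => ∃ a, P a ∧ f a = t) (hN a0 ha0) ⟨a0, ha0, rfl⟩
  obtain ⟨a, ha, hfa⟩ := h1
  refine ⟨a, ha, fun a' ha' => ?_⟩
  rw [hfa]
  exact Nat.le_findGreatest (hN a' ha') ⟨a', ha', rfl⟩

/-- There is a path of level `m` inside `(A, B)` starting from `z`. -/
def Lev (r : V → V → Prop) (z : V) (𝒜 ℬ : Finset V) (m : ℕ) : Prop :=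
  ∃ W A e, W ⊆ ℬ ∧ A ⊆ 𝒜 ∧ Reach r z m W A e

theorem lev_one {r : V → V → Prop} {z : V} {𝒜 ℬ : Finset V} (hz : z ∈ ℬ) {a : V} (ha : a ∈ 𝒜)
    (h : r a z) : Lev r z 𝒜 ℬ 1 := by
  refine ⟨{z}, {a}, a, by simpa using hz, by simpa using ha, fun _ => z, fun _ => a, ?_, rfl, by omega, ?_, ?_, rfl⟩
  · refine ⟨?_, ?_, ?_, ?_⟩
    · intros; omega
    · intros; omega
    · intros; exact h
    · intros; omega
  · simp [im]
  · simp [im]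

theorem exists_last (P : ℕ → Prop) {T : ℕ} (hT : 1 ≤ T) (h1 : P 1) (hn : ¬ P T) :
    ∃ m, 1 ≤ m ∧ m < T ∧ P m ∧ ¬ P (m + 1) := by
  by_contra hc
  push Not at hc
  apply hn
  have : ∀ m, 1 ≤ m → m ≤ T → P m := by
    intro m hm
    induction m, hm using Nat.le_induction with
    | base => intro _; exact h1
    | succ k hk ih => intro h; exact hc k hk (by omega) (ih (by omega))
  exact this T hT le_rfl

theorem Lev.trunc {r : V → V → Prop} {z : V} {𝒜 ℬ : Finset V} {m k : ℕ} (h : Lev r z 𝒜 ℬ m)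
    (hk : 0 < k) (hkm : k ≤ m) : Lev r z 𝒜 ℬ k := by
  obtain ⟨W, A, e, hW, hA, w, y, hP, hz, hm, rfl, rfl, he⟩ := h
  exact ⟨_, _, _, (im_mono w hkm).trans hW, (im_mono y hkm).trans hA, w, y, hP.mono hkm, hz, hk,
    rfl, rfl, rfl⟩

theorem Lev.mono {r : V → V → Prop} {z : V} {𝒜 𝒜' ℬ : Finset V} {m : ℕ} (h : Lev r z 𝒜 ℬ m)
    (hs : 𝒜 ⊆ 𝒜') : Lev r z 𝒜' ℬ m := by
  obtain ⟨W, A, e, hW, hA, h⟩ := h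
  exact ⟨W, A, e, hW, hA.trans hs, h⟩

/-- If level `m+1` is not attained, the end is perpendicular to all unused vertices. -/
theorem Reach.perp_of_not {r : V → V → Prop} {z : V} {𝒜 ℬ : Finset V} {m : ℕ} {W A : Finset V}
    {e : V} (h : Reach r z m W A e) (hW : W ⊆ ℬ) (hA : A ⊆ 𝒜) (hn : ¬ Lev r z 𝒜 ℬ (m + 1))
    {x : V} (hx : x ∈ 𝒜) (hxA : x ∉ A) : Perp r ℬ W e x := by
  intro u hu huW h1 h2
  exact hn ⟨_, _, _, Finset.insert_subset hu hW, Finset.insert_subset hx hA,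
    h.extend hxA huW h1 h2⟩

theorem ins_sub {𝒜 A : Finset V} {x : V} (hx : x ∈ 𝒜) (hA : A ⊆ 𝒜) (v : V) :
    insert x (A.erase v) ⊆ 𝒜 :=
  Finset.insert_subset hx ((Finset.erase_subset _ _).trans hA)

theorem lemJ {r : V → V → Prop} {z : V} {𝒜 ℬ : Finset V} {k T : ℕ}
    (hdeg : ∀ a ∈ 𝒜, k ≤ dg r ℬ a) (hb : ℬ.card + 2 ≤ 2 * k) (hz : z ∈ ℬ)
    (hza : ∃ a ∈ 𝒜, r a z) (hT1 : 1 ≤ T) (hTk : T ≤ k) (hTA : T + 2 ≤ 𝒜.card) :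
    Lev r z 𝒜 ℬ T := by
  by_contra hn
  obtain ⟨a, ha, haz⟩ := hza
  obtain ⟨m, hm1, hmT, hLm, hLm'⟩ := exists_last _ hT1 (lev_one hz ha haz) hn
  obtain ⟨⟨W, A, e⟩, ⟨hW, hA, hR⟩, hmax⟩ := exists_max
    (fun q : Finset V × Finset V × V => q.1 ⊆ ℬ ∧ q.2.1 ⊆ 𝒜 ∧ Reach r z m q.1 q.2.1 q.2.2)
    (fun q => dg r q.1 q.2.2) m
    (fun q hq => by
      have := hq.2.2.card_W
      exact (Finset.card_filter_le _ _).trans this.le)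
    (by obtain ⟨W, A, e, h⟩ := hLm; exact ⟨(W, A, e), h⟩)
  try simp only at hW hA hR hmax
  have hR' := hR
  obtain ⟨w, y, hP, hw0, hm, rfl, rfl, rfl⟩ := hR
  set K := 𝒜 \ im m y with hK
  have hKc : K.card = 𝒜.card - m := by rw [hK, Finset.card_sdiff_of_subset hA, hP.card_y]
  have hAm : ∀ i < m, y i ∈ 𝒜 := fun i hi => hA (mem_im.2 ⟨i, hi, rfl⟩)
  have hcross : ∀ x ∈ K, ∃ v, Reach r z m (im m w) (insert x ((im m y).erase v)) x := by
    intro x hx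
    rw [hK, Finset.mem_sdiff] at hx
    exact hR'.cross hW hb (hdeg _ (hAm _ (by omega))) (hdeg _ hx.1) hx.2
      (hR'.perp_of_not hW hA hLm' hx.1 hx.2)
  have hle : ∀ x ∈ K, tt r m w x ≤ tt r m w (y (m - 1)) := by
    intro x hx
    obtain ⟨v, hv⟩ := hcross x hx
    rw [hP.tt_eq, hP.tt_eq]
    rw [hK, Finset.mem_sdiff] at hx
    exact hmax (im m w, _, x) ⟨hW, ins_sub hx.1 hA v, hv⟩
  refine lemG hP hm hW hb (by omega) K (by omega) ?_ ?_ ?_ ?_ ?_ ?_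
  · intro x hx; exact hdeg x (Finset.mem_sdiff.1 hx).1
  · intro i hi; exact hdeg _ (hAm i hi)
  · calc 2 * (m - tt r m w (y (m - 1))) ≤ K.card * (m - tt r m w (y (m - 1))) :=
          Nat.mul_le_mul_right _ (by omega)
      _ = ∑ x ∈ K, (m - tt r m w (y (m - 1))) := by simp
      _ ≤ _ := Finset.sum_le_sum (fun x hx => by have := hle x hx; omega)
  · intro x hx x' hx' hne
    obtain ⟨v, hv⟩ := hcross x hx
    rw [hK, Finset.mem_sdiff] at hx hx'
    refine hv.perp_of_not hW (ins_sub hx.1 hA v) hLm' hx'.1 ?_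
    rw [Finset.mem_insert, Finset.mem_erase]
    rintro (h | h)
    · exact hne h.symm
    · exact hx'.2 h.2
  · intro i hi hr x hx
    rw [hK, Finset.mem_sdiff] at hx
    have := hP.reach_rotate hi hr
    rw [hw0] at this
    exact this.perp_of_not hW hA hLm' hx.1 hx.2
  · intro i j hij hj hri hrj x hx h1 h2
    rw [hK, Finset.mem_sdiff] at hx
    have := hP.reach_double hij hj hri hx.2 h1 h2
    rw [hw0] at this
    refine (this.perp_of_not hW (ins_sub hx.1 hA _) hLm' (hAm i (by omega)) ?_).symm
    rw [Finset.mem_insert, Finset.mem_erase]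
    rintro (h | h)
    · exact hx.2 (mem_im.2 ⟨i, by omega, h⟩)
    · exact h.1 rfl

theorem lemJO {r : V → V → Prop} {z : V} {𝒜 ℬ : Finset V} {k T : ℕ}
    (hdeg : ∀ a ∈ 𝒜, k ≤ dg r ℬ a) (hb : ℬ.card + 4 ≤ 2 * k) (hz : z ∈ ℬ)
    (hza : ∃ a ∈ 𝒜, r a z) (hT1 : 1 ≤ T) (hTk : T ≤ k) (hTA : T ≤ 𝒜.card)
    (hO : (𝒜.filter (fun a => ¬ ∀ b ∈ ℬ, r a b)).card ≤ 4) :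
    Lev r z 𝒜 ℬ T := by
  by_contra hn
  obtain ⟨a, ha, haz⟩ := hza
  obtain ⟨m, hm1, hmT, ⟨W, A, e, hW, hA, hR⟩, hLm'⟩ := exists_last _ hT1 (lev_one hz ha haz) hn
  have hR' := hR
  obtain ⟨w, y, hP, hw0, hm, rfl, rfl, rfl⟩ := hR
  obtain ⟨x, hx, hxA⟩ : ∃ x ∈ 𝒜, x ∉ im m y := by
    by_contra hc
    push Not at hc
    have := Finset.card_le_card (show 𝒜 ⊆ im m y from hc)
    rw [hP.card_y] at this; omega
  have hAm : ∀ i < m, y i ∈ 𝒜 := fun i hi => hA (mem_im.2 ⟨i, hi, rfl⟩)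
  have hU : ∀ v ∈ 𝒜, ∃ u ∈ ℬ, u ∉ im m w ∧ r v u := by
    intro v hv
    by_contra hc
    push Not at hc
    have h1 : ℬ.filter (r v) ⊆ im m w := by
      intro u hu
      rw [Finset.mem_filter] at hu
      by_contra h2
      exact hc u hu.1 h2 hu.2
    have h2 := Finset.card_le_card h1
    have h3 := hdeg v hv
    rw [hP.card_w] at h2
    unfold dg at h3; omega
  have hnf : ∀ v ∈ 𝒜, ∀ v' ∈ 𝒜, Perp r ℬ (im m w) v v' → ¬ ∀ b ∈ ℬ, r v b := by
    intro v hv v' hv' hp hall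
    obtain ⟨u, hu, huW, hr⟩ := hU v' hv'
    exact hp u hu huW (hall u hu) hr
  have hpe := hR'.perp_of_not hW hA hLm' hx hxA
  have hcr := hP.crossing hm hW (hdeg _ (hAm (m - 1) (by omega))) (hdeg x hx) hpe
  set I := (Finset.range (m - 1)).filter (fun i => r (y (m - 1)) (w i) ∧ r x (w (i + 1))) with hI
  have hsub : insert x (insert (y (m - 1)) (I.image y)) ⊆ 𝒜.filter (fun a => ¬ ∀ b ∈ ℬ, r a b) := by
    intro v hv
    rw [Finset.mem_insert, Finset.mem_insert, Finset.mem_image] at hv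
    rw [Finset.mem_filter]
    rcases hv with rfl | rfl | ⟨i, hi, rfl⟩
    · exact ⟨hx, hnf _ hx _ (hAm _ (by omega)) hpe.symm⟩
    · exact ⟨hAm _ (by omega), hnf _ (hAm _ (by omega)) _ hx hpe⟩
    · simp only [hI, Finset.mem_filter, Finset.mem_range] at hi
      have h1 := hP.reach_drop (by omega) hi.2.1 hxA hi.2.2
      rw [hw0] at h1
      refine ⟨hAm i (by omega), hnf _ (hAm _ (by omega)) x hx
        (h1.perp_of_not hW (ins_sub hx hA _) hLm' (hAm i (by omega)) ?_).symm⟩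
      rw [Finset.mem_insert, Finset.mem_erase]
      rintro (h | h)
      · exact hxA (mem_im.2 ⟨i, by omega, h⟩)
      · exact h.1 rfl
  have hc := Finset.card_le_card hsub
  rw [Finset.card_insert_of_notMem, Finset.card_insert_of_notMem, Finset.card_image_of_injOn] at hc
  · omega
  · intro i hi j hj hij
    simp only [hI, Finset.coe_filter, Finset.mem_range, Set.mem_setOf_eq] at hi hj
    exact hP.yi i (by omega) j (by omega) hij
  · rw [Finset.mem_image]
    rintro ⟨i, hi, h⟩
    simp only [hI, Finset.mem_filter, Finset.mem_range] at hi
    have := hP.yi _ (by omega) _ (by omega) h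
    omega
  · rw [Finset.mem_insert, Finset.mem_image]
    rintro (h | ⟨i, hi, h⟩)
    · exact hxA (mem_im.2 ⟨m - 1, by omega, h.symm⟩)
    · simp only [hI, Finset.mem_filter, Finset.mem_range] at hi
      exact hxA (mem_im.2 ⟨i, by omega, h⟩)

end LDS

namespace LDS
open scoped Classical
universe u
variable {V : Type u}

theorem Perp.mono {r : V → V → Prop} {B W W' : Finset V} {v v' : V} (h : Perp r B W v v')
    (hs : W ⊆ W') : Perp r B W' v v' := fun u hu hw => h u hu (fun hmem => hw (hs hmem))

/-- Shortcut: replace `w i, y i, w (i+1), y (i+1), w (i+2)` by `w i, x, w (i+2)`. -/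
theorem AP.shortcut {r : V → V → Prop} {m : ℕ} {w y : ℕ → V} (h : AP r (m + 1) w y) {i : ℕ}
    (hi : i + 2 ≤ m) {x : V} (hx : x ∉ im (m + 1) y) (h1 : r x (w i)) (h2 : r x (w (i + 2))) :
    AP r m (fun k => if k ≤ i then w k else w (k + 1))
      (fun k => if k < i then y k else if k = i then x else y (k + 1)) := by
  have hx' : ∀ i < m + 1, y i ≠ x := fun i hi h => hx (mem_im.2 ⟨i, hi, h⟩)
  refine ⟨?_, ?_, ?_, ?_⟩
  · intro a ha b hb hab
    try simp only at hab
    split_ifs at hab <;> have := h.wi _ (by omega) _ (by omega) hab <;> omega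
  · intro a ha b hb hab
    try simp only at hab
    split_ifs at hab
    any_goals first | omega | exact absurd hab (hx' _ (by omega)) | exact absurd hab.symm (hx' _ (by omega))
    all_goals have := h.yi _ (by omega) _ (by omega) hab
    all_goals omega
  · intro k hk
    try simp only
    rcases lt_trichotomy k i with h3 | h3 | h3
    · rw [if_pos h3, if_pos h3.le]; exact h.e1 k (by omega)
    · subst h3
      rw [if_neg (lt_irrefl _), if_pos rfl, if_pos le_rfl]; exact h1
    · rw [if_neg (by omega), if_neg (by omega), if_neg (by omega)]
      exact h.e1 _ (by omega)
  · intro k hk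
    try simp only
    rcases lt_trichotomy k i with h3 | h3 | h3
    · rw [if_pos h3, if_pos (by omega)]; exact h.e2 k (by omega)
    · subst h3
      rw [if_neg (lt_irrefl _), if_pos rfl, if_neg (by omega)]; exact h2
    · rw [if_neg (by omega), if_neg (by omega), if_neg (by omega)]
      exact h.e2 _ (by omega)

theorem endLemma {r : V → V → Prop} {z : V} {𝒜 ℬ Y : Finset V} {p : ℕ} (hp : 4 ≤ p)
    (hdeg : ∀ a ∈ 𝒜, p ≤ dg r ℬ a) (hb : ℬ.card + 3 ≤ 2 * p) (hz : z ∈ ℬ)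
    (hY : Y ⊆ 𝒜) (hY4 : Y.card = 4) (hA : p + 5 ≤ 𝒜.card)
    (hza : ∃ a ∈ 𝒜 \ Y, r a z) :
    ∃ W A e, W ⊆ ℬ ∧ A ⊆ 𝒜 ∧ e ∈ Y ∧ Reach r z p W A e ∧ 2 ≤ (Y \ A).card := by
  by_contra hcon
  set 𝒳 := 𝒜 \ Y with h𝒳
  have hXA : 𝒳 ⊆ 𝒜 := Finset.sdiff_subset
  have hXc : p + 1 ≤ 𝒳.card := by
    rw [h𝒳, Finset.card_sdiff_of_subset hY]; omega
  have hYX : ∀ y ∈ Y, ∀ A ⊆ 𝒳, y ∉ A := by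
    intro y hy A hA h
    have := hA h
    rw [h𝒳, Finset.mem_sdiff] at this
    exact this.2 hy
  have hwin : ∀ W A e a b, Reach r z p W A e → W ⊆ ℬ → A ⊆ insert a (insert b 𝒳) →
      a ∈ Y → b ∈ Y → e ∈ Y → False := by
    intro W A e a b hR hW hA' ha hb' he
    apply hcon
    refine ⟨W, A, e, hW, ?_, he, hR, ?_⟩
    · exact hA'.trans (Finset.insert_subset (hY ha) (Finset.insert_subset (hY hb') hXA))
    · have h1 : Y \ {a, b} ⊆ Y \ A := by
        intro v hv
        rw [Finset.mem_sdiff] at hv ⊢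
        refine ⟨hv.1, fun hvA => ?_⟩
        have := hA' hvA
        rw [Finset.mem_insert, Finset.mem_insert] at this
        rcases this with h | h | h
        · exact hv.2 (by simp [h])
        · exact hv.2 (by simp [h])
        · exact hYX v hv.1 𝒳 subset_rfl h
      have h2 := Finset.card_le_card h1
      have h3 := Finset.le_card_sdiff {a, b} Y
      have h4 := Finset.card_le_two (a := a) (b := b)
      omega
  -- Step 1
  have s1a : ∀ W A e, Reach r z (p - 1) W A e → W ⊆ ℬ → A ⊆ 𝒳 → ∀ y ∈ Y, Perp r ℬ W e y := by
    intro W A e hR hW hAX y hy u hu huW h1 h2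
    have h3 := hR.extend (hYX y hy A hAX) huW h1 h2
    rw [show p - 1 + 1 = p by omega] at h3
    exact hwin _ _ _ y y h3 (Finset.insert_subset hu hW)
      (by rw [Finset.insert_idem]; exact Finset.insert_subset_insert _ hAX) hy hy hy
  have s1b : ∀ W A e, Reach r z (p - 1) W A e → W ⊆ ℬ → A ⊆ 𝒳 → ∀ y ∈ Y, ∀ y' ∈ Y, y ≠ y' →
      Perp r ℬ W y y' := by
    intro W A e hR hW hAX y hy y' hy' hne u hu huW h1 h2
    obtain ⟨v, hv⟩ := hR.cross (k := p) hW (by omega) (hdeg e (hXA (hAX hR.e_mem)))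
      (hdeg y (hY hy)) (hYX y hy A hAX) (s1a W A e hR hW hAX y hy)
    have hnot : y' ∉ insert y (A.erase v) := by
      rw [Finset.mem_insert, Finset.mem_erase]
      rintro (h | h)
      · exact hne h.symm
      · exact hYX y' hy' A hAX h.2
    have h3 := hv.extend hnot huW h1 h2
    rw [show p - 1 + 1 = p by omega] at h3
    exact hwin _ _ _ y' y h3 (Finset.insert_subset hu hW)
      (Finset.insert_subset_insert _ (Finset.insert_subset_insert _
        ((Finset.erase_subset _ _).trans hAX))) hy' hy hy'
  have hLev : Lev r z 𝒳 ℬ (p - 1) :=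
    lemJ (k := p) (fun a ha => hdeg a (hXA ha)) (by omega) hz hza (by omega) (by omega) (by omega)
  -- Step 2
  have hnp : ¬ Lev r z 𝒳 ℬ (p - 1 + 1) := by
    rw [show p - 1 + 1 = p by omega]
    rintro ⟨W, A, e, hW, hAX, hR⟩
    have hR' := hR
    obtain ⟨w, y, hP, hw0, hm, rfl, rfl, rfl⟩ := hR
    have hperp : ∀ a ∈ Y, ∀ a' ∈ Y, a ≠ a' → Perp r ℬ (im p w) a a' := by
      intro a ha a' ha' hne
      have hsub := im_mono w (show p - 1 ≤ p by omega)
      refine (s1b (im (p - 1) w) (im (p - 1) y) (y (p - 1 - 1)) ⟨w, y, hP.mono (by omega), hw0, by omega, rfl, rfl, rfl⟩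
        (hsub.trans hW) ((im_mono y (by omega)).trans hAX) a ha a' ha' hne).mono hsub
    obtain ⟨a0, a1, a2, ha0, ha1, ha2, h01, h02, h12⟩ : ∃ a0 a1 a2, a0 ∈ Y ∧ a1 ∈ Y ∧ a2 ∈ Y ∧
        a0 ≠ a1 ∧ a0 ≠ a2 ∧ a1 ≠ a2 := by
      have := Finset.two_lt_card_iff.1 (show 2 < Y.card by omega)
      obtain ⟨a, b, c, h⟩ := this
      exact ⟨a, b, c, h.1, h.2.1, h.2.2.1, h.2.2.2.1, h.2.2.2.2.1, h.2.2.2.2.2⟩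
    have hem := hR'.e_mem
    by_cases hpe : Perp r ℬ (im p w) (y (p - 1)) a0
    · obtain ⟨v, hv⟩ := hR'.cross (k := p) hW (by omega) (hdeg _ (hXA (hAX hem)))
        (hdeg a0 (hY ha0)) (hYX a0 ha0 _ hAX) hpe
      exact hwin _ _ _ a0 a0 hv hW (by
        rw [Finset.insert_idem]
        exact Finset.insert_subset_insert _ ((Finset.erase_subset _ _).trans hAX)) ha0 ha0 ha0
    · obtain ⟨u, hu, huW, hu1, hu2⟩ := not_perp hpe
      have hE := hP.extend hm (hYX a0 ha0 _ hAX) huW hu1 hu2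
      have hsc : ∀ a ∈ Y, a ≠ a0 → ∀ i, i + 2 < p → r a (w i) → r a (w (i + 2)) → False := by
        intro a ha hne i hi h1 h2
        have hnot : a ∉ im (p + 1) (Function.update y p a0) := by
          rw [im_succ_update, Finset.mem_insert]
          rintro (h | h)
          · exact hne h
          · exact hYX a ha _ hAX h
        have h3 := hE.shortcut (i := i) (by omega) hnot
          (by rw [Function.update_of_ne (by omega)]; exact h1)
          (by rw [Function.update_of_ne (by omega)]; exact h2)
        refine hwin _ _ a0 a0 a ⟨_, _, h3, ?_, by omega, rfl, rfl, ?_⟩ ?_ ?_ ha0 ha ha0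
        · try simp only
          rw [if_pos (Nat.zero_le _), Function.update_of_ne (by omega)]; exact hw0
        · try simp only
          rw [if_neg (by omega), if_neg (by omega), show p - 1 + 1 = p by omega, Function.update_self]
        · intro v hv
          rw [mem_im] at hv
          obtain ⟨j, hj, rfl⟩ := hv
          have hmem : ∀ j < p + 1, (Function.update w p u) j ∈ ℬ := by
            intro j hj
            rw [Function.update_apply]
            split_ifs with h5
            · exact hu
            · exact hW (mem_im.2 ⟨j, by omega, rfl⟩)
          split_ifs
          · exact hmem _ (by omega)
          · exact hmem _ (by omega)
        · intro v hv
          rw [mem_im] at hv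
          obtain ⟨j, hj, rfl⟩ := hv
          have hmem : ∀ j < p + 1, (Function.update y p a0) j ∈ insert a0 (insert a 𝒳) := by
            intro j hj
            rw [Function.update_apply]
            split_ifs with h5
            · simp
            · have := hAX (mem_im.2 ⟨j, by omega, rfl⟩)
              simp [this]
          split_ifs
          · exact hmem _ (by omega)
          · simp
          · exact hmem _ (by omega)
      have hbd : ∀ a ∈ Y, a ≠ a0 → p ≤ 2 * ((ℬ \ im p w).filter (r a)).card + 2 := by
        intro a ha hne
        have h1 := hdeg a (hY ha)
        rw [dg_split r hW, ← hP.tt_eq] at h1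
        have h2 : 2 * tt r p w a ≤ p + 2 := by
          unfold tt
          set S := (Finset.range p).filter (fun i => r a (w i)) with hS
          have h3 : Disjoint S (S.image (fun i => i + 2)) := by
            rw [Finset.disjoint_left]
            intro i hi hi'
            rw [Finset.mem_image] at hi'
            obtain ⟨j, hj, rfl⟩ := hi'
            simp only [hS, Finset.mem_filter, Finset.mem_range] at hi hj
            exact hsc a ha hne j hi.1 hj.2 hi.2
          have h4 : (S.image (fun i => i + 2)).card = S.card := by
            rw [Finset.card_image_of_injective]; intro a b; simp
          have h5 : (S ∪ S.image (fun i => i + 2)).card ≤ (Finset.range (p + 2)).card := by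
            apply Finset.card_le_card
            apply Finset.union_subset
            · intro i hi
              simp only [hS, Finset.mem_filter, Finset.mem_range] at hi ⊢
              omega
            · intro i hi
              rw [Finset.mem_image] at hi
              obtain ⟨j, hj, rfl⟩ := hi
              simp only [hS, Finset.mem_filter, Finset.mem_range] at hj ⊢
              omega
          rw [Finset.card_union_of_disjoint h3, h4, Finset.card_range] at h5
          omega
        omega
      have h1 := hbd a1 ha1 h01.symm
      have h2 := hbd a2 ha2 h02.symm
      have h3 : ((ℬ \ im p w).filter (r a1)).card + ((ℬ \ im p w).filter (r a2)).card
          ≤ (ℬ \ im p w).card := by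
        rw [← Finset.card_union_of_disjoint (hperp a1 ha1 a2 ha2 h12).disj]
        exact Finset.card_le_card (Finset.union_subset (Finset.filter_subset _ _) (Finset.filter_subset _ _))
      have hWc := Finset.card_le_card hW
      rw [Finset.card_sdiff_of_subset hW, hP.card_w] at h3
      rw [hP.card_w] at hWc
      omega
  -- Step 3
  obtain ⟨⟨W, A, e⟩, ⟨hW, hAX, hR⟩, hmax⟩ := exists_max
    (fun q : Finset V × Finset V × V => q.1 ⊆ ℬ ∧ q.2.1 ⊆ 𝒳 ∧ Reach r z (p - 1) q.1 q.2.1 q.2.2)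
    (fun q => dg r q.1 q.2.2) (p - 1)
    (fun q hq => by
      have := hq.2.2.card_W
      exact (Finset.card_filter_le _ _).trans this.le)
    (by obtain ⟨W, A, e, h⟩ := hLev; exact ⟨(W, A, e), h⟩)
  try simp only at hW hAX hR hmax
  have hR' := hR
  obtain ⟨w, y, hP, hw0, hm, rfl, rfl, rfl⟩ := hR
  set X := 𝒳 \ im (p - 1) y with hX
  have hXcard : 2 ≤ X.card := by
    rw [hX, Finset.card_sdiff_of_subset hAX, hP.card_y]; omega
  have hAm : ∀ i < p - 1, y i ∈ 𝒳 := fun i hi => hAX (mem_im.2 ⟨i, hi, rfl⟩)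
  have hcross : ∀ x ∈ X, ∃ v, Reach r z (p - 1) (im (p - 1) w) (insert x ((im (p - 1) y).erase v)) x := by
    intro x hx
    rw [hX, Finset.mem_sdiff] at hx
    exact hR'.cross (k := p) hW (by omega) (hdeg _ (hXA (hAm _ (by omega)))) (hdeg _ (hXA hx.1)) hx.2
      (hR'.perp_of_not hW hAX hnp hx.1 hx.2)
  have hle : ∀ x ∈ X, tt r (p - 1) w x ≤ tt r (p - 1) w (y (p - 1 - 1)) := by
    intro x hx
    obtain ⟨v, hv⟩ := hcross x hx
    rw [hP.tt_eq, hP.tt_eq]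
    rw [hX, Finset.mem_sdiff] at hx
    exact hmax (im (p - 1) w, _, x) ⟨hW, ins_sub hx.1 hAX v, hv⟩
  have hdisj : Disjoint X Y := by
    rw [Finset.disjoint_left]
    intro v hv hvY
    exact hYX v hvY _ Finset.sdiff_subset hv
  have hrot : ∀ i, i + 1 < p - 1 → r (y (p - 1 - 1)) (w i) →
      Reach r z (p - 1) (im (p - 1) w) (im (p - 1) y) (y i) := by
    intro i hi hr
    have := hP.reach_rotate hi hr
    rwa [hw0] at this
  refine lemG hP hm hW (k := p) (by omega) (by omega) (X ∪ Y) ?_ ?_ ?_ ?_ ?_ ?_ ?_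
  · rw [Finset.card_union_of_disjoint hdisj]; omega
  · intro x hx
    rw [Finset.mem_union] at hx
    rcases hx with hx | hx
    · exact hdeg x (hXA (Finset.mem_sdiff.1 hx).1)
    · exact hdeg x (hY hx)
  · intro i hi; exact hdeg _ (hXA (hAm i hi))
  · calc 2 * (p - 1 - tt r (p - 1) w (y (p - 1 - 1))) ≤ X.card * (p - 1 - tt r (p - 1) w (y (p - 1 - 1))) :=
          Nat.mul_le_mul_right _ (by omega)
      _ = ∑ x ∈ X, (p - 1 - tt r (p - 1) w (y (p - 1 - 1))) := by simp
      _ ≤ ∑ x ∈ X, (p - 1 - tt r (p - 1) w x) :=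
          Finset.sum_le_sum (fun x hx => by have := hle x hx; omega)
      _ ≤ _ := Finset.sum_le_sum_of_subset Finset.subset_union_left
  · have hxy : ∀ x ∈ X, ∀ a ∈ Y, Perp r ℬ (im (p - 1) w) x a := by
      intro x hx a ha
      obtain ⟨v, hv⟩ := hcross x hx
      rw [hX, Finset.mem_sdiff] at hx
      exact s1a _ _ _ hv hW (ins_sub hx.1 hAX v) a ha
    intro x hx x' hx' hne
    rw [Finset.mem_union] at hx hx'
    rcases hx with hx | hx <;> rcases hx' with hx' | hx'
    · obtain ⟨v, hv⟩ := hcross x hx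
      rw [hX, Finset.mem_sdiff] at hx hx'
      refine hv.perp_of_not hW (ins_sub hx.1 hAX v) hnp hx'.1 ?_
      rw [Finset.mem_insert, Finset.mem_erase]
      rintro (h | h)
      · exact hne h.symm
      · exact hx'.2 h.2
    · exact hxy x hx x' hx'
    · exact (hxy x' hx' x hx).symm
    · exact s1b _ _ _ hR' hW hAX x hx x' hx' hne
  · intro i hi hr x hx
    rw [Finset.mem_union] at hx
    rcases hx with hx | hx
    · rw [hX, Finset.mem_sdiff] at hx
      exact (hrot i hi hr).perp_of_not hW hAX hnp hx.1 hx.2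
    · exact s1a _ _ _ (hrot i hi hr) hW hAX x hx
  · intro i j hij hj hri hrj x hx h1 h2
    have hxA : x ∉ im (p - 1) y := by
      rw [Finset.mem_union] at hx
      rcases hx with hx | hx
      · exact (Finset.mem_sdiff.1 hx).2
      · exact hYX x hx _ hAX
    have hd := hP.reach_double hij hj hri hxA h1 h2
    rw [hw0] at hd
    have hyi : y i ∉ insert x ((im (p - 1) y).erase (y i)) := by
      rw [Finset.mem_insert, Finset.mem_erase]
      rintro (h | h)
      · exact hxA (mem_im.2 ⟨i, by omega, h⟩)
      · exact h.1 rfl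
    rw [Finset.mem_union] at hx
    rcases hx with hx | hx
    · rw [hX, Finset.mem_sdiff] at hx
      exact (hd.perp_of_not hW (ins_sub hx.1 hAX _) hnp (hAm i (by omega)) hyi).symm
    · intro u hu huW hu1 hu2
      have hE := hd.extend hyi huW hu2 hu1
      rw [show p - 1 + 1 = p by omega] at hE
      obtain ⟨a, ha, hax⟩ := Finset.exists_mem_ne (show 1 < Y.card by omega) x
      have haA : a ∉ insert (y i) (insert x ((im (p - 1) y).erase (y i))) := by
        rw [Finset.mem_insert, Finset.mem_insert, Finset.mem_erase]
        rintro (h | h | h)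
        · exact hYX a ha _ hAX (mem_im.2 ⟨i, by omega, h.symm⟩)
        · exact hax h
        · exact hYX a ha _ hAX h.2
      obtain ⟨v, hv⟩ := hE.cross (k := p) (Finset.insert_subset hu hW) (by omega)
        (hdeg _ (hXA (hAm i (by omega)))) (hdeg a (hY ha)) haA
        ((s1a _ _ _ (hrot i (by omega) hri) hW hAX a ha).mono (Finset.subset_insert _ _))
      refine hwin _ _ _ a x hv (Finset.insert_subset hu hW) ?_ ha hx ha
      apply Finset.insert_subset_insert
      refine (Finset.erase_subset _ _).trans ?_
      apply Finset.insert_subset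
      · exact Finset.mem_insert_of_mem (hAm i (by omega))
      · exact Finset.insert_subset_insert _ ((Finset.erase_subset _ _).trans hAX)

end LDS

namespace LDS
open scoped Classical
universe u
variable {V : Type u}

/-- A spine with one extra leaf at each end, all other leaves taken from `Z`. -/
theorem coreBlue (H : SimpleGraph V) (p n : ℕ) (s : ℕ → V)
    (hinj : ∀ i ≤ 2 * p, ∀ j ≤ 2 * p, s i = s j → i = j)
    (hadj : ∀ i < 2 * p, H.Adj (s i) (s (i + 1))) (Z : Finset V) (x1 x2 : V)
    (hsZ : ∀ i ≤ 2 * p, s i ∉ Z) (hx1 : ∀ i ≤ 2 * p, s i ≠ x1) (hx2 : ∀ i ≤ 2 * p, s i ≠ x2)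
    (h12 : x1 ≠ x2) (hx1Z : x1 ∉ Z) (hx2Z : x2 ∉ Z) (ha1 : H.Adj (s 0) x1)
    (ha2 : H.Adj (s (2 * p)) x2) (hd0 : n ≤ dg H.Adj Z (s 0)) (hd1 : 1 ≤ dg H.Adj Z (s (2 * p))) :
    HasCopy (LinkedDoubleStar (2 * p + 1) n 2) H := by
  obtain ⟨z, hz⟩ := Finset.card_pos.1 (show 0 < (Z.filter (H.Adj (s (2 * p)))).card from hd1)
  rw [Finset.mem_filter] at hz
  refine hasCopy_of_spine H p n 2 s hinj hadj (insert x1 ((Z.filter (H.Adj (s 0))).erase z)) {x2, z}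
    ?_ ?_ ?_ ?_ ?_ ?_ ?_
  · rw [Finset.card_insert_of_notMem (by simp [hx1Z])]
    have := Finset.pred_card_le_card_erase (s := Z.filter (H.Adj (s 0))) (a := z)
    unfold dg at hd0; omega
  · rw [Finset.card_pair]
    rintro rfl; exact hx2Z hz.1
  · rw [Finset.disjoint_left]
    intro v hv hv'
    simp only [Finset.mem_insert, Finset.mem_erase, Finset.mem_filter, Finset.mem_singleton] at hv hv'
    rcases hv with rfl | hv
    · rcases hv' with h | h
      · exact h12 h
      · exact hx1Z (h ▸ hz.1)
    · rcases hv' with h | h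
      · exact hx2Z (h ▸ hv.2.1)
      · exact hv.1 h
  · intro i hi h
    simp only [Finset.mem_insert, Finset.mem_erase, Finset.mem_filter] at h
    rcases h with h | h
    · exact hx1 i hi h
    · exact hsZ i hi h.2.1
  · intro i hi h
    simp only [Finset.mem_insert, Finset.mem_singleton] at h
    rcases h with h | h
    · exact hx2 i hi h
    · exact hsZ i hi (h ▸ hz.1)
  · intro v hv
    simp only [Finset.mem_insert, Finset.mem_erase, Finset.mem_filter] at hv
    rcases hv with rfl | hv
    · exact ha1
    · exact hv.2.2
  · intro v hv
    simp only [Finset.mem_insert, Finset.mem_singleton] at hv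
    rcases hv with rfl | rfl
    · exact ha2
    · exact hz.2

theorem cycA1 (H : SimpleGraph V) (p n : ℕ) (hp : 1 ≤ p) (f : ℕ → V)
    (hinj : ∀ i < 2 * p + 3, ∀ j < 2 * p + 3, f i = f j → i = j)
    (hadj : ∀ i < 2 * p + 2, H.Adj (f i) (f (i + 1))) (hcl : H.Adj (f (2 * p + 2)) (f 0))
    (Z : Finset V) (hZ : ∀ i < 2 * p + 3, f i ∉ Z) (h0 : n ≤ dg H.Adj Z (f 0))
    (h3 : 1 ≤ dg H.Adj Z (f 3)) : HasCopy (LinkedDoubleStar (2 * p + 1) n 2) H := by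
  refine coreBlue H p n (fun k => if k = 0 then f 0 else f (2 * p + 3 - k)) ?_ ?_ Z (f 1) (f 2)
    ?_ ?_ ?_ ?_ (hZ _ (by omega)) (hZ _ (by omega)) ?_ ?_ ?_ ?_
  · intro i hi j hj h
    try simp only at h
    split_ifs at h <;> first | omega | (have := hinj _ (by omega) _ (by omega) h; omega)
  · intro i hi
    try simp only
    by_cases h : i = 0
    · subst h
      rw [if_pos rfl, if_neg (by omega)]
      exact hcl.symm
    · rw [if_neg h, if_neg (by omega)]
      have := (hadj (2 * p + 3 - (i + 1)) (by omega)).symm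
      rwa [show 2 * p + 3 - (i + 1) + 1 = 2 * p + 3 - i by omega] at this
  · intro i hi
    try simp only
    split_ifs
    · exact hZ _ (by omega)
    · exact hZ _ (by omega)
  · intro i hi h
    try simp only at h
    split_ifs at h <;> (have := hinj _ (by omega) _ (by omega) h; omega)
  · intro i hi h
    try simp only at h
    split_ifs at h <;> (have := hinj _ (by omega) _ (by omega) h; omega)
  · intro h
    have := hinj _ (by omega) _ (by omega) h; omega
  · rw [if_pos rfl]; exact hadj 0 (by omega)
  · rw [if_neg (by omega), show 2 * p + 3 - 2 * p = 3 by omega]; exact (hadj 2 (by omega)).symm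
  · rw [if_pos rfl]; exact h0
  · rw [if_neg (by omega), show 2 * p + 3 - 2 * p = 3 by omega]; exact h3

theorem cycA2 (H : SimpleGraph V) (p n : ℕ) (hp : 1 ≤ p) (f : ℕ → V)
    (hinj : ∀ i < 2 * p + 3, ∀ j < 2 * p + 3, f i = f j → i = j)
    (hadj : ∀ i < 2 * p + 2, H.Adj (f i) (f (i + 1))) (hcl : H.Adj (f (2 * p + 2)) (f 0))
    (Z : Finset V) (hZ : ∀ i < 2 * p + 3, f i ∉ Z) (h0 : n ≤ dg H.Adj Z (f 0)) (j : ℕ)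
    (hj2 : 2 ≤ j) (hj : j ≤ 2 * p + 1)
    (h3 : 1 ≤ dg H.Adj Z (f j)) (he : H.Adj (f (j - 2)) (f (2 * p + 1))) :
    HasCopy (LinkedDoubleStar (2 * p + 1) n 2) H := by
  have e0 : (if 0 ≤ j - 2 then f 0 else f (2 * p + j - 0)) = f 0 := if_pos (by omega)
  have e1 : (if 2 * p ≤ j - 2 then f (2 * p) else f (2 * p + j - 2 * p)) = f j := by
    rw [if_neg (by omega), show 2 * p + j - 2 * p = j by omega]
  refine coreBlue H p n (fun k => if k ≤ j - 2 then f k else f (2 * p + j - k)) ?_ ?_ Z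
    (f (2 * p + 2)) (f (j - 1))
    ?_ ?_ ?_ ?_ (hZ _ (by omega)) (hZ _ (by omega)) ?_ ?_ ?_ ?_
  · intro i hi j hj h
    try simp only at h
    split_ifs at h <;> first | omega | (have := hinj _ (by omega) _ (by omega) h; omega)
  · intro i hi
    try simp only
    rcases lt_trichotomy i (j - 2) with h | h | h
    · rw [if_pos (by omega), if_pos (by omega)]; exact hadj i (by omega)
    · rw [if_pos (by omega), if_neg (by omega), show 2 * p + j - (i + 1) = 2 * p + 1 by omega, h]
      exact he
    · rw [if_neg (by omega), if_neg (by omega)]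
      have := (hadj (2 * p + j - (i + 1)) (by omega)).symm
      rwa [show 2 * p + j - (i + 1) + 1 = 2 * p + j - i by omega] at this
  · intro i hi
    try simp only
    split_ifs
    · exact hZ _ (by omega)
    · exact hZ _ (by omega)
  · intro i hi h
    try simp only at h
    split_ifs at h <;> (have := hinj _ (by omega) _ (by omega) h; omega)
  · intro i hi h
    try simp only at h
    split_ifs at h <;> (have := hinj _ (by omega) _ (by omega) h; omega)
  · intro h
    have := hinj _ (by omega) _ (by omega) h; omega
  · rw [e0]; exact hcl.symm
  · rw [e1]
    have := (hadj (j - 1) (by omega)).symm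
    rwa [show j - 1 + 1 = j by omega] at this
  · rw [e0]; exact h0
  · rw [e1]; exact h3

/-- Complete bipartite red graph between `O` and `Z`, with possibly extra leaves `E` at `z`. -/
theorem bipFull (H : SimpleGraph V) (p n : ℕ) (O Z E : Finset V) (hOZ : ∀ o ∈ O, ∀ z ∈ Z, H.Adj o z)
    (hdis : Disjoint O Z) (hEZ : Disjoint E Z) (hEO : Disjoint E O)
    (z : V) (hz : z ∈ Z) (hE : ∀ x ∈ E, H.Adj z x)
    (hZc : p + 1 ≤ Z.card) (hOc : p + 2 ≤ O.card) (hc : p + n + 2 ≤ O.card + E.card) :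
    HasCopy (LinkedDoubleStar (2 * p + 1) n 2) H := by
  obtain ⟨O1, hO1, hO1c⟩ := Finset.exists_subset_card_eq (show p ≤ O.card by omega)
  obtain ⟨L2, hL2, hL2c⟩ := Finset.exists_subset_card_eq (show 2 ≤ (O \ O1).card by
    rw [Finset.card_sdiff_of_subset hO1]; omega)
  obtain ⟨Z1, hZ1, hZ1c⟩ := Finset.exists_subset_card_eq (show p ≤ (Z.erase z).card by
    rw [Finset.card_erase_of_mem hz]; omega)
  set L1 := (O \ O1) \ L2 ∪ E with hL1
  have ho := Finset.disjoint_left.1 hdis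
  have hEo := Finset.disjoint_left.1 hEO
  have hEz := Finset.disjoint_left.1 hEZ
  have hL1c : n ≤ L1.card := by
    rw [hL1, Finset.card_union_of_disjoint, Finset.card_sdiff_of_subset hL2,
      Finset.card_sdiff_of_subset hO1]
    · omega
    · rw [Finset.disjoint_left]
      intro v hv hv'
      simp only [Finset.mem_sdiff] at hv
      exact hEo hv' hv.1.1
  set b := (O1.equivFinOfCardEq hO1c).symm with hb
  set a := (Z1.equivFinOfCardEq hZ1c).symm with ha
  set β : ℕ → V := fun i => if h : i < p then (b ⟨i, h⟩ : V) else z with hβ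
  set α : ℕ → V := fun i => if h : 0 < i ∧ i - 1 < p then (a ⟨i - 1, h.2⟩ : V) else z with hα
  have hβm : ∀ i < p, β i ∈ O1 := by
    intro i hi; simp only [hβ, dif_pos hi]; exact (b _).2
  have hαm : ∀ i, 0 < i → i ≤ p → α i ∈ Z1 := by
    intro i hi hi'; simp only [hα, dif_pos (show 0 < i ∧ i - 1 < p by omega)]; exact (a _).2
  have hα0 : α 0 = z := by simp [hα]
  have hαZ : ∀ i ≤ p, α i ∈ Z := by
    intro i hi
    rcases Nat.eq_zero_or_pos i with h | h
    · rw [h, hα0]; exact hz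
    · exact Finset.mem_of_mem_erase (hZ1 (hαm i h hi))
  have hzZ1 : z ∉ Z1 := fun h => by simpa using hZ1 h
  have hβO : ∀ i < p, β i ∈ O := fun i hi => hO1 (hβm i hi)
  refine hasCopy_inter H p n 2 α β ?_ ?_ ?_ ?_ ?_ L1 L2 hL1c hL2c.ge ?_ ?_ ?_ ?_ ?_ ?_ ?_
  · intro i hi j hj h
    rcases Nat.eq_zero_or_pos i with h1 | h1 <;> rcases Nat.eq_zero_or_pos j with h2 | h2
    · omega
    · rw [h1, hα0] at h; exact absurd (h ▸ hαm j h2 hj) hzZ1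
    · rw [h2, hα0] at h; exact absurd (h ▸ hαm i h1 hi) hzZ1
    · simp only [hα, dif_pos (show 0 < i ∧ i - 1 < p by omega), dif_pos (show 0 < j ∧ j - 1 < p by omega)] at h
      have := a.injective (Subtype.ext h)
      simp only [Fin.mk.injEq] at this
      omega
  · intro i hi j hj h
    simp only [hβ, dif_pos hi, dif_pos hj] at h
    have := b.injective (Subtype.ext h)
    simpa using this
  · intro i hi j hj h
    exact ho (hβO j hj) (h ▸ hαZ i hi)
  · intro i hi; exact hOZ _ (hβO i hi) _ (hαZ i (by omega))
  · intro i hi; exact hOZ _ (hβO i hi) _ (hαZ (i + 1) (by omega))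
  · rw [Finset.disjoint_left]
    intro v hv hv'
    rw [hL1, Finset.mem_union, Finset.mem_sdiff] at hv
    rcases hv with hv | hv
    · exact hv.2 hv'
    · exact hEo hv (Finset.mem_sdiff.1 (hL2 hv')).1
  · intro i hi h
    rw [hL1, Finset.mem_union, Finset.mem_sdiff, Finset.mem_sdiff] at h
    rcases h with h | h
    · exact ho h.1.1 (hαZ i hi)
    · exact hEz h (hαZ i hi)
  · intro i hi h
    rw [hL1, Finset.mem_union, Finset.mem_sdiff, Finset.mem_sdiff] at h
    rcases h with h | h
    · exact h.1.2 (hβm i hi)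
    · exact hEo h (hβO i hi)
  · intro i hi h
    exact ho (Finset.mem_sdiff.1 (hL2 h)).1 (hαZ i hi)
  · intro i hi h
    exact (Finset.mem_sdiff.1 (hL2 h)).2 (hβm i hi)
  · intro v hv
    rw [hα0]
    rw [hL1, Finset.mem_union, Finset.mem_sdiff, Finset.mem_sdiff] at hv
    rcases hv with h | h
    · exact (hOZ _ h.1.1 _ hz).symm
    · exact hE v h
  · intro v hv
    exact (hOZ _ (Finset.mem_sdiff.1 (hL2 hv)).1 _ (hαZ p le_rfl)).symm

end LDS

namespace LDS
open scoped Classical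
universe u
variable {V : Type u}

theorem sum_dg_comm (r : V → V → Prop) (hr : ∀ a b, r a b → r b a) (C Z : Finset V) :
    ∑ x ∈ C, dg r Z x = ∑ z ∈ Z, dg r C z := by
  unfold dg
  simp only [Finset.card_filter]
  rw [Finset.sum_comm]
  refine Finset.sum_congr rfl (fun z _ => Finset.sum_congr rfl (fun x _ => ?_))
  have : r x z ↔ r z x := ⟨hr _ _, hr _ _⟩
  simp only [this]

theorem caseA0 (R : SimpleGraph V) (p n : ℕ) (hp : 4 ≤ p) (hn2 : 2 ≤ n) (hnp : n + 2 ≤ p)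
    (C Z : Finset V) (hCZ : Disjoint C Z) (hC : C.card = 2 * p + 3) (hZ : Z.card = n + p)
    (hdeg : ∀ x ∈ C, p + 1 ≤ dg R.Adj Z x) : HasCopy (LinkedDoubleStar (2 * p + 1) n 2) R := by
  have hsum := sum_dg_comm R.Adj (fun a b h => h.symm) C Z
  have hlow : (2 * p + 3) * (p + 1) ≤ ∑ z ∈ Z, dg R.Adj C z := by
    rw [← hsum, ← hC, ← smul_eq_mul, ← Finset.sum_const]
    exact Finset.sum_le_sum hdeg
  have hdle : ∀ z, dg R.Adj C z ≤ 2 * p + 3 := by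
    intro z; rw [← hC]; exact Finset.card_filter_le _ _
  have htwo : 1 < (Z.filter (fun z => p + 3 ≤ dg R.Adj C z)).card := by
    by_contra hc
    rw [← Finset.sum_filter_add_sum_filter_not Z (fun z => p + 3 ≤ dg R.Adj C z)] at hlow
    have h1 : ∑ z ∈ Z.filter (fun z => p + 3 ≤ dg R.Adj C z), dg R.Adj C z ≤
        (Z.filter (fun z => p + 3 ≤ dg R.Adj C z)).card * (2 * p + 3) := by
      rw [← smul_eq_mul, ← Finset.sum_const]
      exact Finset.sum_le_sum (fun z _ => hdle z)
    have h2 : ∑ z ∈ Z.filter (fun z => ¬ p + 3 ≤ dg R.Adj C z), dg R.Adj C z ≤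
        (Z.filter (fun z => ¬ p + 3 ≤ dg R.Adj C z)).card * (p + 2) := by
      rw [← smul_eq_mul, ← Finset.sum_const]
      refine Finset.sum_le_sum (fun z hz => ?_)
      have := (Finset.mem_filter.1 hz).2
      omega
    have h3 := Finset.card_filter_add_card_filter_not (s := Z) (fun z => p + 3 ≤ dg R.Adj C z)
    rw [hZ] at h3
    set q1 := (Z.filter (fun z => p + 3 ≤ dg R.Adj C z)).card
    set q2 := (Z.filter (fun z => ¬ p + 3 ≤ dg R.Adj C z)).card
    have hq : q1 = 0 ∨ q1 = 1 := by omega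
    rcases hq with hq | hq
    · rw [hq] at h1 h3
      have : q2 ≤ 2 * p := by omega
      nlinarith
    · rw [hq] at h1 h3
      have : q2 + 3 ≤ 2 * p := by omega
      nlinarith
  obtain ⟨z1, hz1, z2, hz2, hne⟩ := Finset.one_lt_card.1 htwo
  rw [Finset.mem_filter] at hz1 hz2
  obtain ⟨F, hF, hFc⟩ := Finset.exists_subset_card_eq (show n ≤ (C.filter (R.Adj z1)).card by
    have := hz1.2; unfold dg at this; omega)
  obtain ⟨Y, hY, hYc⟩ := Finset.exists_subset_card_eq (show 4 ≤ (C.filter (R.Adj z2) \ F).card by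
    have h1 := hz2.2; unfold dg at h1
    have h2 := Finset.le_card_sdiff F (C.filter (R.Adj z2))
    omega)
  have hFC : F ⊆ C := hF.trans (Finset.filter_subset _ _)
  have hYC : ∀ v ∈ Y, v ∈ C ∧ R.Adj z2 v ∧ v ∉ F := by
    intro v hv
    have := hY hv
    rw [Finset.mem_sdiff, Finset.mem_filter] at this
    exact ⟨this.1.1, this.1.2, this.2⟩
  have hYA : Y ⊆ C \ F := by
    intro v hv
    rw [Finset.mem_sdiff]; exact ⟨(hYC v hv).1, (hYC v hv).2.2⟩
  have hcz := Finset.disjoint_left.1 hCZ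
  obtain ⟨W, A, e, hW, hA, heY, hR, h2⟩ := endLemma (r := R.Adj) (z := z1) (𝒜 := C \ F)
    (ℬ := Z.erase z2) (Y := Y) (p := p) hp
    (by
      intro a ha
      have h1 := hdeg a (Finset.mem_sdiff.1 ha).1
      unfold dg at h1 ⊢
      rw [Finset.filter_erase]
      have := Finset.pred_card_le_card_erase (s := Z.filter (R.Adj a)) (a := z2)
      omega)
    (by rw [Finset.card_erase_of_mem hz2.1]; omega)
    (Finset.mem_erase.2 ⟨hne, hz1.1⟩) hYA hYc
    (by rw [Finset.card_sdiff_of_subset hFC]; omega)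
    (by
      by_contra hc
      push Not at hc
      have h1 : C.filter (R.Adj z1) ⊆ F ∪ Y := by
        intro v hv
        rw [Finset.mem_filter] at hv
        by_contra hv'
        rw [Finset.mem_union, not_or] at hv'
        exact hc v (by simp only [Finset.mem_sdiff]; exact ⟨⟨hv.1, hv'.1⟩, hv'.2⟩) hv.2.symm
      have h2 := Finset.card_le_card h1
      have h3 := Finset.card_union_le F Y
      have h4 := hz1.2
      unfold dg at h4
      omega)
  obtain ⟨w, y, hP, hw0, hm, rfl, rfl, rfl⟩ := hR
  have hwm : ∀ i < p, w i ∈ Z ∧ w i ≠ z2 := by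
    intro i hi
    have := hW (mem_im.2 ⟨i, hi, rfl⟩)
    rw [Finset.mem_erase] at this
    exact ⟨this.2, this.1⟩
  have hym : ∀ i < p, y i ∈ C ∧ y i ∉ F := by
    intro i hi
    have := hA (mem_im.2 ⟨i, hi, rfl⟩)
    rwa [Finset.mem_sdiff] at this
  have hαZ : ∀ i ≤ p, (if i < p then w i else z2) ∈ Z := by
    intro i hi
    split_ifs with h
    · exact (hwm i h).1
    · exact hz2.1
  refine hasCopy_inter R p n 2 (fun i => if i < p then w i else z2) y ?_ hP.yi ?_ ?_ ?_ F
    (Y \ im p y) hFc.ge h2 ?_ ?_ ?_ ?_ ?_ ?_ ?_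
  · intro i hi j hj h
    try simp only at h
    split_ifs at h with h3 h4 h4
    · exact hP.wi i h3 j h4 h
    · exact absurd h (hwm i h3).2
    · exact absurd h.symm (hwm j h4).2
    · omega
  · intro i hi j hj h
    exact hcz (hym j hj).1 (h ▸ hαZ i hi)
  · intro i hi
    try simp only
    rw [if_pos hi]; exact hP.e1 i hi
  · intro i hi
    try simp only
    split_ifs with h
    · exact hP.e2 i h
    · rw [show i = p - 1 by omega]; exact (hYC _ heY).2.1.symm
  · rw [Finset.disjoint_left]
    intro v hv hv'
    exact (hYC v (Finset.mem_sdiff.1 hv').1).2.2 hv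
  · intro i hi h
    exact hcz (hFC h) (hαZ i hi)
  · intro i hi h; exact (hym i hi).2 h
  · intro i hi h
    exact hcz (hYC _ (Finset.mem_sdiff.1 h).1).1 (hαZ i hi)
  · intro i hi h
    exact (Finset.mem_sdiff.1 h).2 (mem_im.2 ⟨i, hi, rfl⟩)
  · intro v hv
    try simp only
    rw [if_pos (by omega), hw0]
    exact (Finset.mem_filter.1 (hF hv)).2
  · intro v hv
    try simp only
    rw [if_neg (by omega)]
    exact (hYC v (Finset.mem_sdiff.1 hv).1).2.1

theorem common_nbr (r : V → V → Prop) (Z : Finset V) (a b : V)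
    (h : Z.card < dg r Z a + dg r Z b) : ∃ z ∈ Z, r a z ∧ r b z := by
  unfold dg at h
  have h1 := Finset.card_union_add_card_inter (Z.filter (r a)) (Z.filter (r b))
  have h2 : (Z.filter (r a) ∪ Z.filter (r b)).card ≤ Z.card :=
    Finset.card_le_card (Finset.union_subset (Finset.filter_subset _ _) (Finset.filter_subset _ _))
  obtain ⟨z, hz⟩ := Finset.card_pos.1 (show 0 < (Z.filter (r a) ∩ Z.filter (r b)).card by omega)
  simp only [Finset.mem_inter, Finset.mem_filter] at hz
  exact ⟨z, hz.1.1, hz.1.2, hz.2.2⟩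

theorem nbr_outside (r : V → V → Prop) (Z W : Finset V) (a : V)
    (h : W.card < dg r Z a) : ∃ z ∈ Z, z ∉ W ∧ r a z := by
  by_contra hc
  push Not at hc
  have : Z.filter (r a) ⊆ W := by
    intro v hv
    rw [Finset.mem_filter] at hv
    by_contra h'
    exact hc v hv.1 h' hv.2
  have := Finset.card_le_card this
  unfold dg at h; omega

theorem caseA1end (R : SimpleGraph V) (p n : ℕ) (hp : 4 ≤ p) (hnp : n + 2 ≤ p)
    (Z : Finset V) (hZ : Z.card = n + p) (𝒜 : Finset V) (hAZ : Disjoint 𝒜 Z)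
    (hAne : 𝒜.Nonempty) (hdeg : ∀ a ∈ 𝒜, p + 1 ≤ dg R.Adj Z a) (o1 o2 x x' : V)
    (h1Z : o1 ∉ Z) (h2Z : o2 ∉ Z) (hxZ : x ∉ Z) (hx'Z : x' ∉ Z)
    (h1A : o1 ∉ 𝒜) (h2A : o2 ∉ 𝒜) (hxA : x ∉ 𝒜) (hx'A : x' ∉ 𝒜)
    (h12 : o1 ≠ o2) (hxx : x ≠ x') (hxo : x ≠ o1) (hxo' : x' ≠ o1)
    (ho2x : R.Adj o2 x) (ho2x' : R.Adj o2 x') (ho1 : ∀ z ∈ Z, R.Adj o1 z)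
    (hdo2 : p + 1 ≤ dg R.Adj Z o2)
    (hLev : ∀ z ∈ Z, (∃ a ∈ 𝒜, R.Adj a z) → Lev R.Adj z 𝒜 Z (p - 1)) :
    HasCopy (LinkedDoubleStar (2 * p + 1) n 2) R := by
  obtain ⟨a0, ha0⟩ := hAne
  obtain ⟨z, hz, hz1, hz2⟩ := common_nbr R.Adj Z o2 a0 (by have := hdeg a0 ha0; omega)
  obtain ⟨W, A, e, hW, hA, hR⟩ := hLev z hz ⟨a0, ha0, hz2⟩
  obtain ⟨w, y, hP, hw0, hm, rfl, rfl, rfl⟩ := hR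
  have haz := Finset.disjoint_left.1 hAZ
  have hym : ∀ i < p - 1, y i ∈ 𝒜 := fun i hi => hA (mem_im.2 ⟨i, hi, rfl⟩)
  have hwm : ∀ i < p - 1, w i ∈ Z := fun i hi => hW (mem_im.2 ⟨i, hi, rfl⟩)
  obtain ⟨u, hu, huW, hur⟩ := nbr_outside R.Adj Z (im (p - 1) w) (y (p - 1 - 1)) (by
    rw [hP.card_w]; have := hdeg _ (hym (p - 1 - 1) (by omega)); omega)
  set α : ℕ → V := fun i => if i = 0 then o2 else if i < p then y (i - 1) else o1 with hα
  set β : ℕ → V := fun i => if i < p - 1 then w i else u with hβ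
  have hα0 : α 0 = o2 := by simp [hα]
  have hαp : α p = o1 := by simp [hα]; omega
  have hαm : ∀ i, 0 < i → i < p → α i = y (i - 1) := by
    intro i h1 h2; simp only [hα]; rw [if_neg (by omega), if_pos h2]
  have hβm : ∀ i < p - 1, β i = w i := by intro i h; simp only [hβ]; rw [if_pos h]
  have hβp : β (p - 1) = u := by simp [hβ]
  have hα3 : ∀ i ≤ p, α i = o2 ∨ α i ∈ 𝒜 ∨ α i = o1 := by
    intro i hi
    simp only [hα]; split_ifs
    · exact Or.inl rfl
    · exact Or.inr (Or.inl (hym _ (by omega)))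
    · exact Or.inr (Or.inr rfl)
  have hβ3 : ∀ i < p, β i ∈ insert u (im (p - 1) w) := by
    intro i hi
    rw [Finset.mem_insert]
    simp only [hβ]; split_ifs with h
    · exact Or.inr (mem_im.2 ⟨i, h, rfl⟩)
    · exact Or.inl rfl
  have hsub : insert u (im (p - 1) w) ⊆ Z := Finset.insert_subset hu hW
  have hαZ : ∀ i ≤ p, α i ∉ Z := by
    intro i hi h
    rcases hα3 i hi with h1 | h1 | h1
    · exact h2Z (h1 ▸ h)
    · exact haz h1 h
    · exact h1Z (h1 ▸ h)
  refine hasCopy_inter' R p n 2 α β ?_ ?_ ?_ ?_ ?_ {x, x'} (Z \ insert u (im (p - 1) w))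
    (Finset.card_pair hxx).ge ?_ ?_ ?_ ?_ ?_ ?_ ?_ ?_
  · intro i hi j hj h
    simp only [hα] at h
    split_ifs at h
    all_goals first
      | omega
      | exact absurd h.symm h12
      | exact absurd h h12
      | (refine absurd ?_ h2A; rw [h]; exact hym _ (by omega))
      | (refine absurd ?_ h2A; rw [← h]; exact hym _ (by omega))
      | (refine absurd ?_ h1A; rw [h]; exact hym _ (by omega))
      | (refine absurd ?_ h1A; rw [← h]; exact hym _ (by omega))
      | (have := hP.yi _ (by omega) _ (by omega) h; omega)
  · intro i hi j hj h
    simp only [hβ] at h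
    split_ifs at h with h3 h4 h4
    · exact hP.wi _ h3 _ h4 h
    · exact absurd (mem_im.2 ⟨i, h3, h⟩) huW
    · exact absurd (mem_im.2 ⟨j, h4, h.symm⟩) huW
    · omega
  · intro i hi j hj h
    exact hαZ i hi (h ▸ hsub (hβ3 j hj))
  · intro i hi
    rcases Nat.eq_zero_or_pos i with h | h
    · rw [h, hα0, hβm 0 (by omega), hw0]; exact hz1.symm
    · rw [hαm i h hi]
      rcases Nat.lt_or_ge i (p - 1) with h' | h'
      · rw [hβm i h']
        have := hP.e2 (i - 1) (by omega)
        rw [show i - 1 + 1 = i by omega] at this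
        exact this.symm
      · rw [show i = p - 1 by omega, hβp]; exact hur.symm
  · intro i hi
    rcases Nat.lt_or_ge i (p - 1) with h' | h'
    · rw [hβm i h', hαm (i + 1) (by omega) (by omega)]
      exact (hP.e1 i h').symm
    · rw [show i = p - 1 by omega, hβp, show p - 1 + 1 = p by omega, hαp]; exact (ho1 u hu).symm
  · rw [Finset.card_sdiff_of_subset hsub, Finset.card_insert_of_notMem huW, hP.card_w]; omega
  · rw [Finset.disjoint_left]
    intro v hv hv'
    have hvZ := (Finset.mem_sdiff.1 hv').1
    rw [Finset.mem_insert, Finset.mem_singleton] at hv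
    rcases hv with rfl | rfl
    · exact hxZ hvZ
    · exact hx'Z hvZ
  · intro i hi h
    rw [Finset.mem_insert, Finset.mem_singleton] at h
    rcases hα3 i hi with h1 | h1 | h1 <;> rcases h with h | h
    · exact ho2x.ne (h1.symm.trans h)
    · exact ho2x'.ne (h1.symm.trans h)
    · exact hxA (h ▸ h1)
    · exact hx'A (h ▸ h1)
    · exact hxo (h.symm.trans h1)
    · exact hxo' (h.symm.trans h1)
  · intro i hi h
    have := hsub (hβ3 i hi)
    rw [Finset.mem_insert, Finset.mem_singleton] at h
    rcases h with h | h
    · exact hxZ (h ▸ this)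
    · exact hx'Z (h ▸ this)
  · intro i hi h
    exact hαZ i hi (Finset.mem_sdiff.1 h).1
  · intro i hi h
    exact (Finset.mem_sdiff.1 h).2 (hβ3 i hi)
  · intro v hv
    rw [Finset.mem_insert, Finset.mem_singleton] at hv
    rw [hα0]
    rcases hv with rfl | rfl
    · exact ho2x
    · exact ho2x'
  · intro v hv
    rw [hαp]
    exact ho1 v (Finset.mem_sdiff.1 hv).1

end LDS

namespace LDS
open scoped Classical
universe u
variable {V : Type u}

theorem zN (p : ℕ) : (2 * (p : ZMod (2 * p + 3)) + 3 = 0) := by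
  have := ZMod.natCast_self (2 * p + 3)
  push_cast at this
  exact this

theorem omega_gt (p : ℕ) (H D : Finset (ZMod (2 * p + 3))) (hHD : H ⊆ D)
    (h3 : ∀ a ∈ H, a + 3 ∉ D ∧ a - 3 ∉ D) (hne : H.Nonempty) : H.card + 1 ≤ Dᶜ.card := by
  by_contra hc
  have e1 : H.image (fun a => a + 3) = Dᶜ := by
    apply Finset.eq_of_subset_of_card_le
    · intro x hx
      rw [Finset.mem_image] at hx
      obtain ⟨a, ha, rfl⟩ := hx
      rw [Finset.mem_compl]; exact (h3 a ha).1
    · rw [Finset.card_image_of_injective _ (add_left_injective 3)]; omega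
  have e2 : H.image (fun a => a - 3) = Dᶜ := by
    apply Finset.eq_of_subset_of_card_le
    · intro x hx
      rw [Finset.mem_image] at hx
      obtain ⟨a, ha, rfl⟩ := hx
      rw [Finset.mem_compl]; exact (h3 a ha).2
    · rw [Finset.card_image_of_injective _ (sub_left_injective)]; omega
  have h6 : ∀ a ∈ H, a + 6 ∈ H := by
    intro a ha
    have h1 : a + 3 ∈ H.image (fun a => a - 3) := by
      rw [e2, ← e1]; exact Finset.mem_image_of_mem _ ha
    rw [Finset.mem_image] at h1
    obtain ⟨b, hb, hab⟩ := h1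
    have : b = a + 6 := by linear_combination hab
    rwa [← this]
  obtain ⟨a, ha⟩ := hne
  have hk : ∀ k : ℕ, a + 6 * k ∈ H := by
    intro k
    induction k with
    | zero => simpa using ha
    | succ k ih =>
      have := h6 _ ih
      have e : a + 6 * ((k + 1 : ℕ) : ZMod (2 * p + 3)) = a + 6 * k + 6 := by push_cast; ring
      rwa [e]
  have h7 := hk (p + 2)
  have e : a + 6 * ((p + 2 : ℕ) : ZMod (2 * p + 3)) = a + 3 := by
    push_cast; linear_combination 3 * zN p
  rw [e] at h7
  exact (h3 a ha).1 (hHD h7)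

theorem exists_typeN (p : ℕ) (H D : Finset (ZMod (2 * p + 3))) (hHD : H ⊆ D)
    (h3 : ∀ a ∈ H, a + 3 ∉ D ∧ a - 3 ∉ D) (hne : H.Nonempty) : ∃ a ∈ H, a - 2 ∉ H := by
  by_contra hc
  push Not at hc
  obtain ⟨a, ha⟩ := hne
  have hk : ∀ k : ℕ, a - 2 * k ∈ H := by
    intro k
    induction k with
    | zero => simpa using ha
    | succ k ih =>
      have := hc _ ih
      have e : a - 2 * ((k + 1 : ℕ) : ZMod (2 * p + 3)) = a - 2 * k - 2 := by push_cast; ring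
      rwa [e]
  have h7 := hk p
  have e : a - 2 * (p : ZMod (2 * p + 3)) = a + 3 := by
    linear_combination - zN p
  rw [e] at h7
  exact (h3 a ha).1 (hHD h7)

theorem small_ne (p k : ℕ) (hk : 0 < k) (hk' : k < 2 * p + 3) : (k : ZMod (2 * p + 3)) ≠ 0 := by
  intro h
  rw [ZMod.natCast_eq_zero_iff] at h
  have := Nat.le_of_dvd hk h
  omega

theorem two_left {α : Type*} [DecidableEq α] (D E : Finset α) (h : E.card + 2 ≤ D.card) :
    ∃ b ∈ D, ∃ b' ∈ D, b ≠ b' ∧ b ∉ E ∧ b' ∉ E := by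
  have h1 := Finset.le_card_sdiff E D
  obtain ⟨b, hb, b', hb', hne⟩ := Finset.one_lt_card.1 (show 1 < (D \ E).card by omega)
  rw [Finset.mem_sdiff] at hb hb'
  exact ⟨b, hb.1, b', hb'.1, hne, hb.2, hb'.2⟩

theorem select (p : ℕ) (hp : 4 ≤ p) (H D : Finset (ZMod (2 * p + 3))) (hHD : H ⊆ D)
    (h3 : ∀ a ∈ H, a + 3 ∉ D ∧ a - 3 ∉ D) (hne : H.Nonempty)
    (hcase : 5 ≤ D.card ∨ (D = H ∧ D.card = 4)) :
    ∃ a b b', a ∈ H ∧ a - 2 ∉ H ∧ b ∈ D ∧ b' ∈ D ∧ b ≠ b' ∧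
      b ∉ ({a - 1, a, a + 1} : Finset _) ∧ b' ∉ ({a - 1, a, a + 1} : Finset _) ∧
      (H.card = p + 1 → b - 2 ∈ H) := by
  have hc3 : ∀ a : ZMod (2 * p + 3), ({a - 1, a, a + 1} : Finset (ZMod (2 * p + 3))).card ≤ 3 :=
    fun a => Finset.card_le_three
  rcases hcase with h5 | ⟨rfl, h4⟩
  · by_cases hH : H.card = p + 1
    · -- find a and b
      have hom := omega_gt p H D hHD h3 hne
      have hDc := Finset.card_compl D
      rw [ZMod.card] at hDc
      have hHDc := Finset.card_le_card hHD
      have hDH : D = H := by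
        symm; apply Finset.eq_of_subset_of_card_le hHD
        have := Finset.card_le_univ D
        rw [ZMod.card] at this
        omega
      subst hDH
      have hE : ∃ b ∈ D, b - 2 ∈ D := by
        by_contra hc
        push Not at hc
        have i1 : D.image (fun a => a + 3) ⊆ Dᶜ := by
          intro x hx
          rw [Finset.mem_image] at hx
          obtain ⟨a, ha, rfl⟩ := hx
          rw [Finset.mem_compl]; exact (h3 a ha).1
        have i2 : D.image (fun a => a + 2) ⊆ Dᶜ := by
          intro x hx
          rw [Finset.mem_image] at hx
          obtain ⟨a, ha, rfl⟩ := hx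
          rw [Finset.mem_compl]
          intro h
          exact hc _ h (by rwa [add_sub_cancel_right])
        have c1 := Finset.card_image_of_injective D (add_left_injective (3 : ZMod (2 * p + 3)))
        have c2 := Finset.card_image_of_injective D (add_left_injective (2 : ZMod (2 * p + 3)))
        have c3 := Finset.card_union_add_card_inter (D.image (fun a => a + 2)) (D.image (fun a => a + 3))
        have c4 := Finset.card_le_card (Finset.union_subset i2 i1)
        set H1 := D.filter (fun c => c - 1 ∈ D) with hH1
        have c5 : (D.image (fun a => a + 2) ∩ D.image (fun a => a + 3)).card ≤ H1.card := by
          have : D.image (fun a => a + 2) ∩ D.image (fun a => a + 3) ⊆ H1.image (fun a => a + 2) := by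
            intro x hx
            rw [Finset.mem_inter, Finset.mem_image, Finset.mem_image] at hx
            obtain ⟨⟨a, ha, rfl⟩, b, hb, hab⟩ := hx
            apply Finset.mem_image_of_mem
            rw [hH1, Finset.mem_filter]
            refine ⟨ha, ?_⟩
            have : a - 1 = b := by linear_combination -hab
            rwa [this]
          exact (Finset.card_le_card this).trans Finset.card_image_le
        have i3 : H1.image (fun a => a - 1) ⊆ D := by
          intro x hx
          rw [Finset.mem_image] at hx
          obtain ⟨a, ha, rfl⟩ := hx
          exact (Finset.mem_filter.1 ha).2
        have c6 := Finset.card_union_add_card_inter H1 (H1.image (fun a => a - 1))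
        have c7 : (H1 ∪ H1.image (fun a => a - 1)).card ≤ D.card := Finset.card_le_card (Finset.union_subset (Finset.filter_subset _ _ : H1 ⊆ D) i3)
        have c8 := Finset.card_image_of_injective H1 (sub_left_injective (b := (1 : ZMod (2 * p + 3))))
        obtain ⟨c, hcc⟩ := Finset.card_pos.1 (show 0 < (H1 ∩ H1.image (fun a => a - 1)).card by
          omega)
        rw [Finset.mem_inter, Finset.mem_image] at hcc
        obtain ⟨hc1, c', hc', rfl⟩ := hcc
        rw [hH1, Finset.mem_filter] at hc1 hc'
        apply hc c' hc'.1
        have : c' - 1 - 1 = c' - 2 := by ring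
        rw [← this]; exact hc1.2
      obtain ⟨a, b, ha, ha2, hb, hb2, hab⟩ : ∃ a b, a ∈ D ∧ a - 2 ∉ D ∧ b ∈ D ∧ b - 2 ∈ D ∧ b ≠ a + 1 := by
        obtain ⟨a0, ha0, ha0'⟩ := exists_typeN p D D hHD h3 hne
        obtain ⟨b0, hb0, hb0'⟩ := hE
        by_cases hab : b0 = a0 + 1
        · obtain ⟨c, hc, hca, hcb⟩ : ∃ c ∈ D, c ≠ a0 ∧ c ≠ b0 := by
            obtain ⟨b, hb, b', hb', hne', hbE, hbE'⟩ := two_left D {a0, b0} (by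
              have := Finset.card_le_two (a := a0) (b := b0); omega)
            simp only [Finset.mem_insert, Finset.mem_singleton, not_or] at hbE
            exact ⟨b, hb, hbE.1, hbE.2⟩
          by_cases hcE : c - 2 ∈ D
          · exact ⟨a0, c, ha0, ha0', hc, hcE, fun h => hcb (h.trans hab.symm)⟩
          · refine ⟨c, b0, hc, hcE, hb0, hb0', fun h => hca ?_⟩
            have : c + 1 = a0 + 1 := h.symm.trans hab
            exact add_right_cancel this
        · exact ⟨a0, b0, ha0, ha0', hb0, hb0', hab⟩
      have hbE : b ∉ ({a - 1, a, a + 1} : Finset (ZMod (2 * p + 3))) := by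
        simp only [Finset.mem_insert, Finset.mem_singleton, not_or]
        refine ⟨?_, ?_, hab⟩
        · rintro rfl
          have : a - 1 - 2 = a - 3 := by ring
          rw [this] at hb2
          exact (h3 a ha).2 hb2
        · rintro rfl; exact ha2 hb2
      obtain ⟨b1, hb1, b2, hb2', hne', hb1E, hb2E⟩ := two_left D {a - 1, a, a + 1} (by
        have := hc3 a; omega)
      by_cases hbb : b1 = b
      · exact ⟨a, b, b2, ha, ha2, hb, hb2', fun h => hne' (hbb.trans h), hbE, hb2E, fun _ => hb2⟩
      · exact ⟨a, b, b1, ha, ha2, hb, hb1, fun h => hbb h.symm, hbE, hb1E, fun _ => hb2⟩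
    · obtain ⟨a, ha, ha'⟩ := exists_typeN p H D hHD h3 hne
      obtain ⟨b1, hb1, b2, hb2', hne', hb1E, hb2E⟩ := two_left D {a - 1, a, a + 1} (by
        have := hc3 a; omega)
      exact ⟨a, b1, b2, ha, ha', hb1, hb2', hne', hb1E, hb2E, fun h => absurd h hH⟩
  · have key : ∀ a ∈ D, a - 2 ∉ D → (a - 1 ∉ D ∨ a + 1 ∉ D) → ∃ a b b', a ∈ D ∧ a - 2 ∉ D ∧
        b ∈ D ∧ b' ∈ D ∧ b ≠ b' ∧ b ∉ ({a - 1, a, a + 1} : Finset _) ∧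
        b' ∉ ({a - 1, a, a + 1} : Finset _) ∧ (D.card = p + 1 → b - 2 ∈ D) := by
      intro a ha ha' hor
      rcases hor with hor | hor
      · obtain ⟨b1, hb1, b2, hb2', hne', hb1E, hb2E⟩ := two_left D {a, a + 1} (by
          have := Finset.card_le_two (a := a) (b := a + 1); omega)
        refine ⟨a, b1, b2, ha, ha', hb1, hb2', hne', ?_, ?_, fun h => by omega⟩
        · rw [Finset.mem_insert]; rintro (h | h)
          · exact hor (h ▸ hb1)
          · exact hb1E h
        · rw [Finset.mem_insert]; rintro (h | h)
          · exact hor (h ▸ hb2')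
          · exact hb2E h
      · obtain ⟨b1, hb1, b2, hb2', hne', hb1E, hb2E⟩ := two_left D {a - 1, a} (by
          have := Finset.card_le_two (a := a - 1) (b := a); omega)
        refine ⟨a, b1, b2, ha, ha', hb1, hb2', hne', ?_, ?_, fun h => by omega⟩
        · simp only [Finset.mem_insert, Finset.mem_singleton, not_or] at hb1E ⊢
          exact ⟨hb1E.1, hb1E.2, fun h => hor (h ▸ hb1)⟩
        · simp only [Finset.mem_insert, Finset.mem_singleton, not_or] at hb2E ⊢
          exact ⟨hb2E.1, hb2E.2, fun h => hor (h ▸ hb2')⟩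
    obtain ⟨a, ha, ha'⟩ := exists_typeN p D D hHD h3 hne
    by_cases h1 : a - 1 ∈ D
    · by_cases h2 : a + 1 ∈ D
      · refine key (a - 1) h1 ?_ (Or.inl ?_)
        · rw [show a - 1 - 2 = a - 3 by ring]; exact (h3 a ha).2
        · rw [show a - 1 - 1 = a - 2 by ring]; exact ha'
      · exact key a ha ha' (Or.inr h2)
    · exact key a ha ha' (Or.inl h1)

theorem cyc_shift (H : SimpleGraph V) (p : ℕ) (g : ZMod (2 * p + 3) → V) (hg : IsCycleMap H g)
    (a : ZMod (2 * p + 3)) :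
    (∀ i < 2 * p + 3, ∀ j < 2 * p + 3, g (a + (i : ℕ)) = g (a + (j : ℕ)) → i = j) ∧
    (∀ i : ℕ, H.Adj (g (a + i)) (g (a + (i + 1 : ℕ)))) ∧
    H.Adj (g (a + (2 * p + 2 : ℕ))) (g (a + (0 : ℕ))) := by
  refine ⟨?_, ?_, ?_⟩
  · intro i hi j hj h
    have h1 := add_left_cancel (hg.1 h)
    rw [ZMod.natCast_eq_natCast_iff'] at h1
    rwa [Nat.mod_eq_of_lt hi, Nat.mod_eq_of_lt hj] at h1
  · intro i
    have := hg.2 (a + i)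
    push_cast
    rwa [add_assoc] at this
  · have := hg.2 (a + (2 * p + 2 : ℕ))
    have e : a + (2 * p + 2 : ℕ) + 1 = a + (0 : ℕ) := by
      push_cast; linear_combination zN p
    rwa [e] at this

theorem cyc_neg (H : SimpleGraph V) (p : ℕ) (g : ZMod (2 * p + 3) → V) (hg : IsCycleMap H g) :
    IsCycleMap H (fun i => g (-i)) := by
  refine ⟨hg.1.comp neg_injective, fun i => ?_⟩
  have := (hg.2 (-(i + 1))).symm
  have e : -(i + 1) + 1 = -i := by ring
  rwa [e] at this

theorem mem_dgf (r : V → V → Prop) (Z : Finset V) (x z : V) :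
    z ∈ Z.filter (r x) ↔ z ∈ Z ∧ r x z := Finset.mem_filter

theorem dg_compl (H : SimpleGraph V) (Z : Finset V) (x : V) (hx : x ∉ Z) :
    dg H.Adj Z x + dg Hᶜ.Adj Z x = Z.card := by
  unfold dg
  rw [← Finset.card_filter_add_card_filter_not (s := Z) (fun z => H.Adj x z)]
  congr 1
  refine congrArg Finset.card (Finset.ext fun z => ?_)
  refine (mem_dgf Hᶜ.Adj Z x z).trans (Iff.trans ?_ (@Finset.mem_filter _ _ _ _ _).symm)
  rw [SimpleGraph.compl_adj]
  constructor
  · exact fun h => ⟨h.1, h.2.2⟩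
  · exact fun h => ⟨h.1, fun e => hx (e ▸ h.1), h.2⟩

theorem thmA [Fintype V] (B : SimpleGraph V) (p n : ℕ) (hp : 4 ≤ p) (hn2 : 2 ≤ n)
    (hnp : n + 2 ≤ p) (hV : Fintype.card V = n + 3 * p + 3)
    (g : ZMod (2 * p + 3) → V) (hg : IsCycleMap B g) :
    HasCopy (LinkedDoubleStar (2 * p + 1) n 2) B ∨ HasCopy (LinkedDoubleStar (2 * p + 1) n 2) Bᶜ := by
  by_contra hno
  rw [not_or] at hno
  obtain ⟨hnB, hnR⟩ := hno
  set C : Finset V := Finset.univ.image g with hC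
  have hCc : C.card = 2 * p + 3 := by
    rw [hC, Finset.card_image_of_injective _ hg.1, Finset.card_univ, ZMod.card]
  set Z : Finset V := Cᶜ with hZ
  have hZc : Z.card = n + p := by rw [hZ, Finset.card_compl, hCc, hV]; omega
  have hgC : ∀ i, g i ∈ C := fun i => Finset.mem_image_of_mem _ (Finset.mem_univ i)
  have hgZ : ∀ i, g i ∉ Z := fun i h => (Finset.mem_compl.1 h) (hgC i)
  have hCZ : Disjoint C Z := disjoint_compl_right
  have hdd : ∀ i, dg B.Adj Z (g i) + dg Bᶜ.Adj Z (g i) = n + p := by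
    intro i; rw [dg_compl B Z _ (hgZ i), hZc]
  set H : Finset (ZMod (2 * p + 3)) := Finset.univ.filter (fun i => n ≤ dg B.Adj Z (g i)) with hH
  set D : Finset (ZMod (2 * p + 3)) := Finset.univ.filter (fun i => 1 ≤ dg B.Adj Z (g i)) with hD
  have hmH : ∀ i, i ∈ H ↔ n ≤ dg B.Adj Z (g i) := by intro i; simp [hH]
  have hmD : ∀ i, i ∈ D ↔ 1 ≤ dg B.Adj Z (g i) := by intro i; simp [hD]
  have hHD : H ⊆ D := by intro i hi; rw [hmH] at hi; rw [hmD]; omega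
  have hOfull : ∀ i, i ∉ D → ∀ z ∈ Z, Bᶜ.Adj (g i) z := by
    intro i hi z hz
    rw [SimpleGraph.compl_adj]
    refine ⟨fun h => hgZ i (h ▸ hz), fun h => hi ?_⟩
    rw [hmD]
    exact Finset.card_pos.2 ⟨z, by simp [hz, h]⟩
  by_cases hne : H.Nonempty
  swap
  · rw [Finset.not_nonempty_iff_eq_empty] at hne
    apply hnR
    refine caseA0 Bᶜ p n hp hn2 hnp C Z hCZ hCc hZc ?_
    intro x hx
    rw [hC, Finset.mem_image] at hx
    obtain ⟨i, -, rfl⟩ := hx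
    have h1 : i ∉ H := by rw [hne]; simp
    rw [hmH] at h1
    have := hdd i
    omega
  have h3 : ∀ a ∈ H, a + 3 ∉ D ∧ a - 3 ∉ D := by
    intro a ha
    rw [hmH] at ha
    constructor
    · intro hd
      rw [hmD] at hd
      obtain ⟨c1, c2, c3⟩ := cyc_shift B p g hg a
      exact hnB (cycA1 B p n (by omega) (fun k => g (a + (k : ℕ))) c1 (fun i _ => c2 i) c3 Z
        (fun i _ => hgZ _) (by simpa using ha) (by simpa using hd))
    · intro hd
      rw [hmD] at hd
      obtain ⟨c1, c2, c3⟩ := cyc_shift B p _ (cyc_neg B p g hg) (-a)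
      refine hnB (cycA1 B p n (by omega) (fun k => g (-(-a + (k : ℕ)))) c1 (fun i _ => c2 i) c3 Z
        (fun i _ => hgZ _) (by simpa using ha) ?_)
      have e : -(-a + ((3 : ℕ) : ZMod (2 * p + 3))) = a - 3 := by push_cast; ring
      rw [e]; exact hd
  have hA2 : ∀ a ∈ H, ∀ b ∈ D, b ∉ ({a - 1, a, a + 1} : Finset (ZMod (2 * p + 3))) →
      ¬ B.Adj (g (a - 2)) (g (b - 2)) := by
    intro a ha b hb hbE hadj
    rw [hmH] at ha
    rw [hmD] at hb
    simp only [Finset.mem_insert, Finset.mem_singleton, not_or] at hbE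
    obtain ⟨c1, c2, c3⟩ := cyc_shift B p g hg a
    set j := (b - a).val with hj
    have hjlt : j < 2 * p + 3 := ZMod.val_lt _
    have hjc : ((j : ℕ) : ZMod (2 * p + 3)) = b - a := ZMod.natCast_zmod_val _
    have hj0 : j ≠ 0 := by
      intro h; rw [h] at hjc; push_cast at hjc
      exact hbE.2.1 (by linear_combination -hjc)
    have hj1 : j ≠ 1 := by
      intro h; rw [h] at hjc; push_cast at hjc
      exact hbE.2.2 (by linear_combination -hjc)
    have hj2 : j ≠ 2 * p + 2 := by
      intro h; rw [h] at hjc; push_cast at hjc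
      exact hbE.1 (by linear_combination -hjc + zN p)
    refine hnB (cycA2 B p n (by omega) (fun k => g (a + (k : ℕ))) c1 (fun i _ => c2 i) c3 Z
        (fun i _ => hgZ _) (by simpa using ha) j (by omega) (by omega) ?_ ?_)
    · try simp only
      rw [hjc, add_sub_cancel]; exact hb
    · try simp only
      have e1 : a + ((j - 2 : ℕ) : ZMod (2 * p + 3)) = b - 2 := by
        rw [Nat.cast_sub (by omega), hjc]; push_cast; ring
      have e2 : a + ((2 * p + 1 : ℕ) : ZMod (2 * p + 3)) = a - 2 := by
        push_cast; linear_combination zN p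
      rw [e1, e2]; exact hadj.symm
  have hom := omega_gt p H D hHD h3 hne
  have hDc := Finset.card_compl D
  have hDle := Finset.card_le_univ D
  rw [ZMod.card] at hDc hDle
  have hHDc := Finset.card_le_card hHD
  have hcase : 5 ≤ D.card ∨ (D = H ∧ D.card = 4) := by
    by_contra hc
    rw [not_or] at hc
    have hOc : (Dᶜ.image g).card = Dᶜ.card := Finset.card_image_of_injective _ hg.1
    have hOZ : ∀ o ∈ Dᶜ.image g, ∀ z ∈ Z, Bᶜ.Adj o z := by
      intro o ho z hz
      rw [Finset.mem_image] at ho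
      obtain ⟨i, hi, rfl⟩ := ho
      exact hOfull i (Finset.mem_compl.1 hi) z hz
    have hOd : Disjoint (Dᶜ.image g) Z := by
      rw [Finset.disjoint_left]
      intro v hv
      rw [Finset.mem_image] at hv
      obtain ⟨i, hi, rfl⟩ := hv
      exact hgZ i
    obtain ⟨z0, hz0⟩ := Finset.card_pos.1 (show 0 < Z.card by omega)
    by_cases hw : p + n + 2 ≤ Dᶜ.card
    · exact hnR (bipFull Bᶜ p n _ Z ∅ hOZ hOd (by simp) (by simp) z0 hz0 (by simp) (by omega)
        (by omega) (by simp; omega))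
    · by_cases hall : ∃ i ∈ D, ∃ z ∈ Z, Bᶜ.Adj (g i) z
      · obtain ⟨i, hi, z, hz, hiz⟩ := hall
        refine hnR (bipFull Bᶜ p n _ Z {g i} hOZ hOd ?_ ?_ z hz ?_ (by omega)
          (by omega) (by simp; omega))
        · rw [Finset.disjoint_singleton_left]; exact hgZ i
        · rw [Finset.disjoint_singleton_left, Finset.mem_image]
          rintro ⟨j, hj, hij⟩
          have := hg.1 hij
          rw [this, Finset.mem_compl] at hj
          exact hj hi
        · intro x hx
          rw [Finset.mem_singleton] at hx
          rw [hx]; exact hiz.symm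
      · push Not at hall
        apply hc.2
        constructor
        · apply Finset.Subset.antisymm _ hHD
          intro i hi
          rw [hmH]
          have h0 : dg Bᶜ.Adj Z (g i) = 0 := by
            unfold dg
            refine Finset.card_eq_zero.2 (Finset.eq_empty_of_forall_notMem fun z hz => ?_)
            have hz' := (mem_dgf Bᶜ.Adj Z (g i) z).1 hz
            exact hall i hi z hz'.1 hz'.2
          have := hdd i
          omega
        · omega
  obtain ⟨a, b, b', ha, ha2, hb, hb', hbb, hbE, hbE', hH1⟩ := select p hp H D hHD h3 hne hcase
  have hb1 := hA2 a ha b hb hbE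
  have hb1' := hA2 a ha b' hb' hbE'
  simp only [Finset.mem_insert, Finset.mem_singleton, not_or] at hbE hbE'
  set I : Finset (ZMod (2 * p + 3)) := Hᶜ \ {a - 3, a - 2, b - 2, b' - 2} with hI
  have hHc := Finset.card_compl H
  rw [ZMod.card] at hHc
  have hIc4 : 2 * p - 1 ≤ I.card + H.card := by
    have h1 : Hᶜ.card - 4 ≤ I.card := by
      have h2 := Finset.card_le_four (a := a - 3) (b := a - 2) (c := b - 2) (d := b' - 2)
      refine le_trans (Nat.sub_le_sub_left ?_ _) (Finset.le_card_sdiff _ _)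
      convert h2
    omega
  have hIc3 : H.card = p + 1 → p - 1 ≤ I.card := by
    intro h
    have h0 := hH1 h
    have h1 := Finset.le_card_sdiff {a - 3, a - 2, b' - 2} Hᶜ
    have h2 := Finset.card_le_three (a := a - 3) (b := a - 2) (c := b' - 2)
    have h3 : Hᶜ \ {a - 3, a - 2, b' - 2} ⊆ I := by
      intro i hi
      simp only [hI, Finset.mem_sdiff, Finset.mem_insert, Finset.mem_singleton, not_or,
        Finset.mem_compl] at hi ⊢
      exact ⟨hi.1, hi.2.1, hi.2.2.1, fun e => hi.1 (e ▸ h0), hi.2.2.2⟩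
    have h4 := Finset.card_le_card h3
    omega
  have hIm : ∀ i, i ∈ I → i ∉ H ∧ i ≠ a - 3 ∧ i ≠ a - 2 ∧ i ≠ b - 2 ∧ i ≠ b' - 2 := by
    intro i hi
    simpa only [hI, Finset.mem_sdiff, Finset.mem_insert, Finset.mem_singleton, not_or,
        Finset.mem_compl] using hi
  have hLdeg : ∀ i, i ∉ H → p + 1 ≤ dg Bᶜ.Adj Z (g i) := by
    intro i hi
    rw [hmH] at hi
    have := hdd i
    omega
  have hAc : (I.image g).card = I.card := Finset.card_image_of_injective _ hg.1
  have hAdeg : ∀ v ∈ I.image g, p + 1 ≤ dg Bᶜ.Adj Z v := by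
    intro v hv
    rw [Finset.mem_image] at hv
    obtain ⟨i, hi, rfl⟩ := hv
    exact hLdeg i (hIm i hi).1
  have hAnot : ∀ i, i ∉ I → g i ∉ I.image g := by
    intro i hi h
    rw [Finset.mem_image] at h
    obtain ⟨j, hj, hij⟩ := h
    exact hi (hg.1 hij ▸ hj)
  have hgne : ∀ i j, i ≠ j → g i ≠ g j := fun i j h h' => h (hg.1 h')
  have hone : (1 : ZMod (2 * p + 3)) ≠ 0 := by
    have := small_ne p 1 (by omega) (by omega)
    simpa using this
  apply hnR
  refine caseA1end Bᶜ p n hp hnp Z hZc (I.image g) ?_ ?_ hAdeg (g (a - 3)) (g (a - 2)) (g (b - 2))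
    (g (b' - 2)) (hgZ _) (hgZ _) (hgZ _) (hgZ _)
    (hAnot _ fun h => (hIm _ h).2.1 rfl) (hAnot _ fun h => (hIm _ h).2.2.1 rfl)
    (hAnot _ fun h => (hIm _ h).2.2.2.1 rfl) (hAnot _ fun h => (hIm _ h).2.2.2.2 rfl)
    (hgne _ _ ?_) (hgne _ _ ?_) (hgne _ _ ?_) (hgne _ _ ?_) ?_ ?_ (hOfull _ (h3 a ha).2)
    (hLdeg _ ha2) ?_
  · rw [Finset.disjoint_left]
    intro v hv
    rw [Finset.mem_image] at hv
    obtain ⟨i, hi, rfl⟩ := hv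
    exact hgZ i
  · rw [← Finset.card_pos, hAc]
    by_cases h : H.card = p + 1
    · have := hIc3 h; omega
    · omega
  · intro h; exact hone (by linear_combination -h)
  · intro h; exact hbb (by linear_combination h)
  · intro h; exact hbE.1 (by linear_combination h)
  · intro h; exact hbE'.1 (by linear_combination h)
  · rw [SimpleGraph.compl_adj]
    exact ⟨hgne _ _ fun h => hbE.2.1 (by linear_combination -h), hb1⟩
  · rw [SimpleGraph.compl_adj]
    exact ⟨hgne _ _ fun h => hbE'.2.1 (by linear_combination -h), hb1'⟩
  · intro z hz hza
    by_cases hh : H.card + 2 ≤ p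
    · exact lemJ (k := p + 1) hAdeg (by omega) hz hza (by omega) (by omega) (by omega)
    · refine lemJO (k := p + 1) hAdeg (by omega) hz hza (by omega) (by omega) ?_ ?_
      · rw [hAc]
        by_cases h : H.card = p + 1
        · exact hIc3 h
        · omega
      · have h1 : (I.image g).filter (fun v => ¬ ∀ b ∈ Z, Bᶜ.Adj v b) ⊆ (D \ H).image g := by
          intro v hv
          rw [Finset.mem_filter, Finset.mem_image] at hv
          obtain ⟨⟨i, hi, rfl⟩, h2⟩ := hv
          apply Finset.mem_image_of_mem
          rw [Finset.mem_sdiff]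
          refine ⟨?_, (hIm i hi).1⟩
          by_contra h4
          exact h2 (hOfull i h4)
        have h2 := (Finset.card_le_card h1).trans Finset.card_image_le
        rw [Finset.card_sdiff_of_subset hHD] at h2
        refine le_trans (le_of_eq ?_) (h2.trans ?_)
        · congr!
        · omega

end LDS

namespace LDS
open scoped Classical
universe u
variable {V : Type u}

theorem mkCyc (H : SimpleGraph V) (p : ℕ) (t : ℕ → V)
    (hinj : ∀ i < 2 * p + 3, ∀ j < 2 * p + 3, t i = t j → i = j)
    (hadj : ∀ i < 2 * p + 2, H.Adj (t i) (t (i + 1))) (hcl : H.Adj (t (2 * p + 2)) (t 0)) :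
    ∃ g : ZMod (2 * p + 3) → V, IsCycleMap H g := by
  refine ⟨fun i => t i.val, ?_, ?_⟩
  · intro i j h
    exact ZMod.val_injective _ (hinj _ (ZMod.val_lt i) _ (ZMod.val_lt j) h)
  · intro i
    have hi := ZMod.val_lt i
    have h1 : (i + 1).val = (i.val + 1) % (2 * p + 3) := by
      rw [ZMod.val_add]
      congr 2
    show H.Adj (t i.val) (t (i + 1).val)
    rw [h1]
    by_cases h : i.val + 1 < 2 * p + 3
    · rw [Nat.mod_eq_of_lt h]; exact hadj _ (by omega)
    · have e : i.val = 2 * p + 2 := by omega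
      rw [e, Nat.mod_self]; exact hcl

/-- Even cycle `F` together with a vertex `u` adjacent to all its even vertices. -/
structure St (B : SimpleGraph V) (p : ℕ) (F : ℕ → V) (w : V) : Prop where
  inj : ∀ i j, i < j + (2 * p + 2) → j < i + (2 * p + 2) → F i = F j → i = j
  per : ∀ i, F (i + (2 * p + 2)) = F i
  adj : ∀ i, B.Adj (F i) (F (i + 1))
  nu : ∀ i, F i ≠ w
  ux : ∀ i, i % 2 = 0 → B.Adj w (F i)

theorem St.shift {B : SimpleGraph V} {p : ℕ} {F : ℕ → V} {w : V} (h : St B p F w) (m : ℕ) :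
    St B p (fun k => F (k + 2 * m)) w := by
  refine ⟨?_, ?_, ?_, fun i => h.nu _, fun i hi => h.ux _ (by omega)⟩
  · intro i j h1 h2 h3
    have := h.inj _ _ (by omega) (by omega) h3
    omega
  · intro i
    have := h.per (i + 2 * m)
    (try simp only)
    rw [← this]; congr 1; omega
  · intro i
    have := h.adj (i + 2 * m)
    (try simp only)
    rwa [show i + 1 + 2 * m = i + 2 * m + 1 by omega]

theorem St.rel {B : SimpleGraph V} {p : ℕ} {F : ℕ → V} {w : V} (h : St B p F w) {i i' : ℕ}
    (hi : i ≤ p) (hi' : i' ≤ p) :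
    ∃ k ≤ p, F (2 * i' + 1) = F (2 * k + 1 + 2 * i) ∧ (k = 0 → i = i') := by
  by_cases hle : i ≤ i'
  · exact ⟨i' - i, by omega, by congr 1; omega, by omega⟩
  · refine ⟨i' + p + 1 - i, by omega, ?_, by omega⟩
    rw [← h.per]; congr 1; omega

/-- A vertex outside adjacent to two consecutive cycle vertices extends the cycle. -/
theorem St.noU1 {B : SimpleGraph V} {p : ℕ} {F : ℕ → V} {w : V} (h : St B p F w)
    (hB : ∀ g : ZMod (2 * p + 3) → V, ¬ IsCycleMap B g) {z : V} (hz : ∀ i, F i ≠ z)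
    (hz0 : B.Adj z (F (2 * p + 2))) : ¬ B.Adj z (F 1) := by
  intro hz1
  obtain ⟨g, hg⟩ := mkCyc B p (fun k => if k = 0 then z else F k) (by
    intro i hi j hj hij
    (try simp only at hij)
    split_ifs at hij
    · omega
    · exact absurd hij.symm (hz _)
    · exact absurd hij (hz _)
    · exact h.inj _ _ (by omega) (by omega) hij) (by
    intro i hi
    (try simp only)
    rw [if_neg (by omega : ¬ i + 1 = 0)]
    split_ifs with h1
    · rw [h1]; exact hz1
    · exact h.adj i) (by
    (try simp only)
    rw [if_neg (by omega), if_pos (by simp)]; exact hz0.symm)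
  exact hB g hg

theorem St.noFF {B : SimpleGraph V} {p : ℕ} {F : ℕ → V} {w : V} (h : St B p F w)
    (hB : ∀ g : ZMod (2 * p + 3) → V, ¬ IsCycleMap B g) {k : ℕ} (hk : 0 < k) (hkp : k ≤ p) :
    ¬ B.Adj (F (2 * k + 1)) (F 1) := by
  intro hz1
  obtain ⟨g, hg⟩ := mkCyc B p (fun i => if i < 2 * k then F (i + 1) else if i = 2 * k then w else
      F (2 * p + 2 + (2 * k + 1) - i)) (by
    intro i hi j hj hij
    (try simp only at hij)
    split_ifs at hij <;> first
      | omega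
      | exact absurd hij.symm (h.nu _)
      | exact absurd hij (h.nu _)
      | (have := h.inj _ _ (by omega) (by omega) hij; omega)) (by
    intro i hi
    (try simp only)
    by_cases h1 : i + 1 < 2 * k
    · rw [if_pos h1, if_pos (by omega)]; exact h.adj _
    · by_cases h2 : i + 1 = 2 * k
      · rw [if_pos (by omega), if_neg (by omega), if_pos h2, h2]; exact (h.ux _ (by omega)).symm
      · rw [if_neg (by omega : ¬ i < 2 * k), if_neg h1, if_neg h2]
        split_ifs with h3
        · exact h.ux _ (by omega)
        · have := (h.adj (2 * p + 2 + (2 * k + 1) - (i + 1))).symm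
          rwa [show 2 * p + 2 + (2 * k + 1) - (i + 1) + 1 = 2 * p + 2 + (2 * k + 1) - i by omega] at this) (by
    (try simp only)
    rw [if_neg (by omega), if_neg (by omega), if_pos (by omega),
      show 2 * p + 2 + (2 * k + 1) - (2 * p + 2) = 2 * k + 1 by omega]
    exact hz1)
  exact hB g hg

theorem St.noZk {B : SimpleGraph V} {p : ℕ} {F : ℕ → V} {w : V} (h : St B p F w)
    (hB : ∀ g : ZMod (2 * p + 3) → V, ¬ IsCycleMap B g) {z : V} (hz : ∀ i, F i ≠ z) (hzw : z ≠ w)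
    (hz0 : B.Adj z (F (2 * p + 2))) {k : ℕ} (hk : 0 < k) (hkp : k ≤ p) :
    ¬ B.Adj z (F (2 * k + 1)) := by
  intro hz1
  -- go around the cycle, inserting w before the second half
  obtain ⟨g, hg⟩ := mkCyc B p (fun i => if i = 0 then z else if i < 2 * p + 2 - 2 * k then
      F (2 * p + 3 - i) else if i = 2 * p + 2 - 2 * k then w else
      F (i + 2 * k - 2 * p - 1)) (by
    intro i hi j hj hij
    (try simp only at hij)
    split_ifs at hij <;> first
      | omega
      | exact absurd hij.symm (h.nu _)
      | exact absurd hij (h.nu _)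
      | exact absurd hij.symm (hz _)
      | exact absurd hij (hz _)
      | exact absurd hij hzw
      | exact absurd hij.symm hzw
      | (have := h.inj _ _ (by omega) (by omega) hij; omega)) (by
    intro i hi
    (try simp only)
    rw [if_neg (by omega : ¬ i + 1 = 0)]
    by_cases h0 : i = 0
    · rw [if_pos h0, if_pos (by omega), h0]; exact hz0
    rw [if_neg h0]
    by_cases h1 : i + 1 < 2 * p + 2 - 2 * k
    · rw [if_pos h1, if_pos (by omega)]
      have := (h.adj (2 * p + 3 - (i + 1))).symm
      rwa [show 2 * p + 3 - (i + 1) + 1 = 2 * p + 3 - i by omega] at this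
    · by_cases h2 : i + 1 = 2 * p + 2 - 2 * k
      · rw [if_pos (by omega), if_neg (by omega), if_pos h2]; exact (h.ux _ (by omega)).symm
      · rw [if_neg (by omega : ¬ i < 2 * p + 2 - 2 * k), if_neg h1, if_neg h2]
        split_ifs with h3
        · exact h.ux _ (by omega)
        · have := (h.adj (i + 2 * k - 2 * p - 1))
          rwa [show i + 2 * k - 2 * p - 1 + 1 = i + 1 + 2 * k - 2 * p - 1 by omega] at this) (by
    (try simp only)
    rw [if_neg (by omega), if_neg (by omega), if_neg (by omega), if_pos (by simp),
      show 2 * p + 2 + 2 * k - 2 * p - 1 = 2 * k + 1 by omega]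
    exact hz1.symm)
  exact hB g hg

theorem St.noZu {B : SimpleGraph V} {p : ℕ} {F : ℕ → V} {w : V} (h : St B p F w)
    (hB : ∀ g : ZMod (2 * p + 3) → V, ¬ IsCycleMap B g) {z : V} (hz : ∀ i, F i ≠ z) (hzw : z ≠ w)
    (hz0 : B.Adj z (F (2 * p + 2))) : ¬ B.Adj z w := by
  intro hz1
  obtain ⟨g, hg⟩ := mkCyc B p (fun i => if i = 0 then z else if i = 1 then w else F i) (by
    intro i hi j hj hij
    (try simp only at hij)
    split_ifs at hij <;> first
      | omega
      | exact absurd hij.symm (h.nu _)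
      | exact absurd hij (h.nu _)
      | exact absurd hij.symm (hz _)
      | exact absurd hij (hz _)
      | exact absurd hij hzw
      | exact absurd hij.symm hzw
      | (have := h.inj _ _ (by omega) (by omega) hij; omega)) (by
    intro i hi
    (try simp only)
    rw [if_neg (by omega : ¬ i + 1 = 0)]
    by_cases h0 : i = 0
    · rw [if_pos h0, if_pos (by omega)]; exact hz1
    rw [if_neg h0, if_neg (by omega : ¬ i + 1 = 1)]
    split_ifs with h3
    · exact h.ux _ (by omega)
    · exact h.adj i) (by
    (try simp only)
    rw [if_neg (by omega), if_neg (by omega), if_pos (by simp)]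
    exact hz0.symm)
  exact hB g hg

/-- The even class. -/
noncomputable def XF (p : ℕ) (F : ℕ → V) : Finset V := (Finset.range (p + 1)).image fun i => F (2 * i)

/-- The odd class together with the extra vertex. -/
noncomputable def YF (p : ℕ) (F : ℕ → V) (w : V) : Finset V :=
  insert w ((Finset.range (p + 1)).image fun i => F (2 * i + 1))

theorem mem_XF {p : ℕ} {F : ℕ → V} {v : V} : v ∈ XF p F ↔ ∃ i ≤ p, F (2 * i) = v := by
  simp [XF, Nat.lt_succ_iff]

theorem mem_YF {p : ℕ} {F : ℕ → V} {w v : V} :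
    v ∈ YF p F w ↔ v = w ∨ ∃ i ≤ p, F (2 * i + 1) = v := by
  simp [YF, Nat.lt_succ_iff]

theorem St.card_XF {B : SimpleGraph V} {p : ℕ} {F : ℕ → V} {w : V} (h : St B p F w) :
    (XF p F).card = p + 1 := by
  rw [XF, Finset.card_image_of_injOn, Finset.card_range]
  intro a ha b hb hab
  simp only [Finset.coe_range, Set.mem_Iio] at ha hb
  have := h.inj _ _ (by omega) (by omega) hab
  omega

theorem St.card_YF {B : SimpleGraph V} {p : ℕ} {F : ℕ → V} {w : V} (h : St B p F w) :
    (YF p F w).card = p + 2 := by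
  rw [YF, Finset.card_insert_of_notMem, Finset.card_image_of_injOn, Finset.card_range]
  · intro a ha b hb hab
    simp only [Finset.coe_range, Set.mem_Iio] at ha hb
    have := h.inj _ _ (by omega) (by omega) hab
    omega
  · rw [Finset.mem_image]
    rintro ⟨i, -, hi⟩
    exact h.nu _ hi

theorem St.disjXY {B : SimpleGraph V} {p : ℕ} {F : ℕ → V} {w : V} (h : St B p F w) :
    Disjoint (XF p F) (YF p F w) := by
  rw [Finset.disjoint_left]
  intro v hv hv'
  obtain ⟨i, hi, rfl⟩ := mem_XF.1 hv
  rcases mem_YF.1 hv' with h1 | ⟨j, hj, h1⟩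
  · exact h.nu _ h1
  · have := h.inj _ _ (by omega) (by omega) h1
    omega

theorem St.mem_of {B : SimpleGraph V} {p : ℕ} {F : ℕ → V} {w : V} (h : St B p F w) (i : ℕ) :
    F i ∈ XF p F ∪ YF p F w := by
  have h1 : ∀ m i, i < 2 * p + 2 → F (i + (2 * p + 2) * m) = F i := by
    intro m i hi
    induction m with
    | zero => simp
    | succ m ih => rw [← ih, ← h.per (i + (2 * p + 2) * m)]; congr 1; ring
  have h2 := Nat.mod_add_div i (2 * p + 2)
  have h3 := Nat.mod_lt i (show 2 * p + 2 > 0 by omega)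
  rw [← h2, h1 _ _ h3]
  generalize i % (2 * p + 2) = j at h3
  rw [Finset.mem_union]
  rcases Nat.mod_two_eq_zero_or_one j with h4 | h4
  · left; exact mem_XF.2 ⟨j / 2, by omega, by congr 1; omega⟩
  · right; exact mem_YF.2 (Or.inr ⟨j / 2, by omega, by congr 1; omega⟩)

theorem St.noU {B : SimpleGraph V} {p : ℕ} {F : ℕ → V} {w : V} (h : St B p F w)
    (hB : ∀ g : ZMod (2 * p + 3) → V, ¬ IsCycleMap B g) (i : ℕ) : ¬ B.Adj w (F (2 * i + 1)) := by
  have := (h.shift i).noU1 hB (z := w) (fun j => h.nu _) (h.ux _ (by omega))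
  rwa [show 1 + 2 * i = 2 * i + 1 by omega] at this

theorem St.clique {B : SimpleGraph V} {p : ℕ} {F : ℕ → V} {w : V} (h : St B p F w)
    (hB : ∀ g : ZMod (2 * p + 3) → V, ¬ IsCycleMap B g) {y y' : V} (hy : y ∈ YF p F w)
    (hy' : y' ∈ YF p F w) (hne : y ≠ y') : ¬ B.Adj y y' := by
  rcases mem_YF.1 hy with rfl | ⟨i, hi, rfl⟩ <;> rcases mem_YF.1 hy' with rfl | ⟨i', hi', rfl⟩
  · exact absurd rfl hne
  · exact h.noU hB _
  · exact fun h1 => h.noU hB _ h1.symm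
  · obtain ⟨k, hk, he, hk0⟩ := h.rel hi hi'
    have hk1 : 0 < k := by
      rcases Nat.eq_zero_or_pos k with h1 | h1
      · exact absurd (by rw [hk0 h1]) hne
      · exact h1
    have := (h.shift i).noFF hB hk1 hk
    rw [he]
    intro h2
    rw [show 2 * i + 1 = 1 + 2 * i by omega] at h2
    exact this h2.symm

theorem St.noboth {B : SimpleGraph V} {p : ℕ} {F : ℕ → V} {w : V} (h : St B p F w)
    (hB : ∀ g : ZMod (2 * p + 3) → V, ¬ IsCycleMap B g) {z : V} (hz : ∀ i, F i ≠ z) (hzw : z ≠ w)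
    {x y : V} (hx : x ∈ XF p F) (hy : y ∈ YF p F w) (hzx : B.Adj z x) : ¬ B.Adj z y := by
  obtain ⟨i, hi, rfl⟩ := mem_XF.1 hx
  have h0 : B.Adj z (F (2 * p + 2 + 2 * i)) := by
    rw [show 2 * p + 2 + 2 * i = 2 * i + (2 * p + 2) by omega, h.per]; exact hzx
  have hs := h.shift i
  rcases mem_YF.1 hy with rfl | ⟨i', hi', rfl⟩
  · exact hs.noZu hB (fun j => hz _) hzw h0
  · obtain ⟨k, hk, he, hk0⟩ := h.rel hi hi'
    rw [he]
    rcases Nat.eq_zero_or_pos k with h1 | h1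
    · have := hs.noU1 hB (fun j => hz _) h0
      rw [h1]; exact this
    · exact hs.noZk hB (fun j => hz _) hzw h0 h1 hk

/-- Spine with an extra vertex `x` adjacent to its beginning. -/
theorem leafB (H : SimpleGraph V) (p n : ℕ) (hn : 2 ≤ n) (s : ℕ → V)
    (hinj : ∀ i ≤ 2 * p, ∀ j ≤ 2 * p, s i = s j → i = j)
    (hadj : ∀ i < 2 * p, H.Adj (s i) (s (i + 1))) (Z : Finset V) (x : V)
    (hsZ : ∀ i ≤ 2 * p, s i ∉ Z) (hx : ∀ i ≤ 2 * p, s i ≠ x) (hxZ : x ∉ Z) (ha : H.Adj (s 0) x)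
    (hd : (n + 1 ≤ dg H.Adj Z (s 0) ∧ 2 ≤ dg H.Adj Z (s (2 * p))) ∨
      (n + 1 ≤ dg H.Adj Z (s (2 * p)) ∧ 2 ≤ dg H.Adj Z (s 0))) :
    HasCopy (LinkedDoubleStar (2 * p + 1) n 2) H := by
  have key : ∀ a b, a + b = n + 2 → 1 ≤ a → b ≤ dg H.Adj Z (s (2 * p)) →
      a + b ≤ dg H.Adj Z (s 0) + 1 ∨ (a = 2 ∧ n + 1 ≤ dg H.Adj Z (s (2 * p))) → 
      1 ≤ dg H.Adj Z (s 0) →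
      ∃ L1 L2 : Finset V, a ≤ L1.card ∧ b ≤ L2.card ∧ Disjoint L1 L2 ∧ 
      (∀ v ∈ L1, (v ∈ Z ∨ v = x) ∧ H.Adj (s 0) v) ∧ (∀ v ∈ L2, v ∈ Z ∧ H.Adj (s (2 * p)) v) := by
    intro a b hab ha1 hb hor h1
    rcases hor with hor | ⟨ha2, hor⟩
    · obtain ⟨L2, hL2, hL2c⟩ := Finset.exists_subset_card_eq
        (show b ≤ (Z.filter (H.Adj (s (2 * p)))).card from hb)
      refine ⟨insert x (Z.filter (H.Adj (s 0)) \ L2), L2, ?_, hL2c.ge, ?_, ?_, ?_⟩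
      · rw [Finset.card_insert_of_notMem (by simp [hxZ])]
        have := Finset.le_card_sdiff L2 (Z.filter (H.Adj (s 0)))
        unfold dg at hor
        omega
      · rw [Finset.disjoint_left]
        intro v hv hv'
        rw [Finset.mem_insert, Finset.mem_sdiff] at hv
        rcases hv with rfl | hv
        · exact hxZ (Finset.mem_filter.1 (hL2 hv')).1
        · exact hv.2 hv'
      · intro v hv
        rw [Finset.mem_insert, Finset.mem_sdiff, Finset.mem_filter] at hv
        rcases hv with rfl | hv
        · exact ⟨Or.inr rfl, ha⟩
        · exact ⟨Or.inl hv.1.1, hv.1.2⟩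
      · intro v hv
        exact Finset.mem_filter.1 (hL2 hv)
    · obtain ⟨z, hz⟩ := Finset.card_pos.1 (show 0 < (Z.filter (H.Adj (s 0))).card from h1)
      rw [Finset.mem_filter] at hz
      refine ⟨{x, z}, (Z.filter (H.Adj (s (2 * p)))).erase z, ?_, ?_, ?_, ?_, ?_⟩
      · rw [Finset.card_pair (by rintro rfl; exact hxZ hz.1)]; omega
      · have := Finset.pred_card_le_card_erase (s := Z.filter (H.Adj (s (2 * p)))) (a := z)
        unfold dg at hor
        omega
      · rw [Finset.disjoint_left]
        intro v hv hv'
        rw [Finset.mem_erase, Finset.mem_filter] at hv'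
        simp only [Finset.mem_insert, Finset.mem_singleton] at hv
        rcases hv with rfl | rfl
        · exact hxZ hv'.2.1
        · exact hv'.1 rfl
      · intro v hv
        simp only [Finset.mem_insert, Finset.mem_singleton] at hv
        rcases hv with rfl | rfl
        · exact ⟨Or.inr rfl, ha⟩
        · exact ⟨Or.inl hz.1, hz.2⟩
      · intro v hv
        rw [Finset.mem_erase, Finset.mem_filter] at hv
        exact hv.2
  have hs1 : ∀ L1 : Finset V, (∀ v ∈ L1, (v ∈ Z ∨ v = x) ∧ H.Adj (s 0) v) → ∀ i ≤ 2 * p, s i ∉ L1 := by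
    intro L1 h i hi hm
    rcases (h _ hm).1 with h1 | h1
    · exact hsZ i hi h1
    · exact hx i hi h1
  rcases hd with ⟨h0, h1⟩ | ⟨h0, h1⟩
  · obtain ⟨L1, L2, c1, c2, hd, hL1, hL2⟩ := key n 2 (by omega) (by omega) h1 (Or.inl (by omega)) (by omega)
    exact hasCopy_of_spine H p n 2 s hinj hadj L1 L2 c1 c2 hd (hs1 L1 hL1)
      (fun i hi h => hsZ i hi (hL2 _ h).1) (fun v hv => (hL1 v hv).2) (fun v hv => (hL2 v hv).2)
  · obtain ⟨L1, L2, c1, c2, hd, hL1, hL2⟩ := key 2 n (by omega) (by omega) (by omega)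
      (Or.inr ⟨rfl, h0⟩) (by omega)
    exact hasCopy_of_spine' H p n 2 s hinj hadj L1 L2 c1 c2 hd (hs1 L1 hL1)
      (fun i hi h => hsZ i hi (hL2 _ h).1) (fun v hv => (hL1 v hv).2) (fun v hv => (hL2 v hv).2)

/-- Case of a pair `F 1`, `w`. -/
theorem St.b1u {B : SimpleGraph V} {p n : ℕ} {F : ℕ → V} {w : V} (h : St B p F w) (hn : 2 ≤ n)
    (hp : 1 ≤ p) (Z : Finset V) (hFZ : ∀ i, F i ∉ Z) (hwZ : w ∉ Z)
    (hd : (n + 1 ≤ dg B.Adj Z (F 1) ∧ 2 ≤ dg B.Adj Z w) ∨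
      (n + 1 ≤ dg B.Adj Z w ∧ 2 ≤ dg B.Adj Z (F 1))) :
    HasCopy (LinkedDoubleStar (2 * p + 1) n 2) B := by
  refine leafB B p n hn (fun i => if i < 2 * p then F (i + 1) else w) ?_ ?_ Z (F 0) ?_ ?_ (hFZ 0) ?_ ?_
  · intro i hi j hj hij
    (try simp only at hij)
    split_ifs at hij <;> first
      | omega
      | exact absurd hij.symm (h.nu _)
      | exact absurd hij (h.nu _)
      | (have := h.inj _ _ (by omega) (by omega) hij; omega)
  · intro i hi
    (try simp only)
    rw [if_pos hi]
    split_ifs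
    · exact h.adj _
    · exact (h.ux _ (by omega)).symm
  · intro i hi
    (try simp only)
    split_ifs
    · exact hFZ _
    · exact hwZ
  · intro i hi hij
    (try simp only at hij)
    split_ifs at hij
    · have := h.inj _ _ (by omega) (by omega) hij; omega
    · exact h.nu _ hij.symm
  · (try simp only)
    rw [if_pos (by omega)]; exact (h.adj 0).symm
  · (try simp only)
    rw [if_pos (by omega), if_neg (by omega)]; exact hd

theorem St.b1k {B : SimpleGraph V} {p n : ℕ} {F : ℕ → V} {w : V} (h : St B p F w) (hn : 2 ≤ n)
    (Z : Finset V) (hFZ : ∀ i, F i ∉ Z) (hwZ : w ∉ Z) {k : ℕ} (hk : 0 < k) (hkp : k ≤ p)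
    (hd : (n + 1 ≤ dg B.Adj Z (F 1) ∧ 2 ≤ dg B.Adj Z (F (2 * k + 1))) ∨
      (n + 1 ≤ dg B.Adj Z (F (2 * k + 1)) ∧ 2 ≤ dg B.Adj Z (F 1))) :
    HasCopy (LinkedDoubleStar (2 * p + 1) n 2) B := by
  by_cases hkk : k = p
  · rw [hkk] at hd
    refine leafB B p n hn (fun i => F (i + 1)) ?_ (fun i _ => h.adj _) Z (F 0) (fun i _ => hFZ _) ?_ (hFZ 0)
      (h.adj 0).symm hd
    · intro i hi j hj hij
      have := h.inj _ _ (by omega) (by omega) hij; omega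
    · intro i hi hij
      have := h.inj _ _ (by omega) (by omega) hij; omega
  -- first half, then w, then the second half reversed
  refine leafB B p n hn (fun i => if i < 2 * k then F (i + 1) else if i = 2 * k then w else
    F (2 * p + 2 * k + 1 - i)) ?_ ?_ Z (F 0) ?_ ?_ (hFZ 0) ?_ ?_
  · intro i hi j hj hij
    (try simp only at hij)
    split_ifs at hij <;> first
      | omega
      | exact absurd hij.symm (h.nu _)
      | exact absurd hij (h.nu _)
      | (have := h.inj _ _ (by omega) (by omega) hij; omega)
  · intro i hi
    (try simp only)
    by_cases h1 : i + 1 < 2 * k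
    · rw [if_pos h1, if_pos (by omega)]; exact h.adj _
    · by_cases h2 : i + 1 = 2 * k
      · rw [if_pos (by omega), if_neg (by omega), if_pos h2, h2]; exact (h.ux _ (by omega)).symm
      · rw [if_neg (by omega : ¬ i < 2 * k), if_neg h1, if_neg h2]
        split_ifs with h3
        · exact h.ux _ (by omega)
        · have := (h.adj (2 * p + 2 * k + 1 - (i + 1))).symm
          rwa [show 2 * p + 2 * k + 1 - (i + 1) + 1 = 2 * p + 2 * k + 1 - i by omega] at this
  · intro i hi
    (try simp only)
    split_ifs
    · exact hFZ _
    · exact hwZ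
    · exact hFZ _
  · intro i hi hij
    (try simp only at hij)
    split_ifs at hij
    · have := h.inj _ _ (by omega) (by omega) hij; omega
    · exact h.nu _ hij.symm
    · have := h.inj _ _ (by omega) (by omega) hij; omega
  · (try simp only)
    rw [if_pos (by omega)]; exact (h.adj 0).symm
  · (try simp only)
    rw [if_pos (by omega), if_neg (by omega), if_neg (by omega),
      show 2 * p + 2 * k + 1 - 2 * p = 2 * k + 1 by omega]; exact hd

theorem St.b1 {B : SimpleGraph V} {p n : ℕ} {F : ℕ → V} {w : V} (h : St B p F w) (hn : 2 ≤ n)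
    (hp : 1 ≤ p) (Z : Finset V) (hFZ : ∀ i, F i ∉ Z) (hwZ : w ∉ Z) {y y' : V} (hy : y ∈ YF p F w)
    (hy' : y' ∈ YF p F w) (hne : y ≠ y') (hd : n + 1 ≤ dg B.Adj Z y) (hd' : 2 ≤ dg B.Adj Z y') :
    HasCopy (LinkedDoubleStar (2 * p + 1) n 2) B := by
  have hsh : ∀ i, F (1 + 2 * i) = F (2 * i + 1) := fun i => by congr 1; omega
  rcases mem_YF.1 hy with rfl | ⟨i, hi, rfl⟩ <;> rcases mem_YF.1 hy' with rfl | ⟨i', hi', rfl⟩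
  · exact absurd rfl hne
  · refine (h.shift i').b1u hn hp Z (fun i => hFZ _) hwZ (Or.inr ⟨hd, ?_⟩)
    rw [hsh]; exact hd'
  · refine (h.shift i).b1u hn hp Z (fun i => hFZ _) hwZ (Or.inl ⟨?_, hd'⟩)
    rw [hsh]; exact hd
  · obtain ⟨k, hk, he, hk0⟩ := h.rel hi hi'
    have hk1 : 0 < k := by
      rcases Nat.eq_zero_or_pos k with h1 | h1
      · exact absurd (by rw [hk0 h1]) hne
      · exact h1
    refine (h.shift i).b1k hn Z (fun i => hFZ _) hwZ hk1 hk (Or.inl ⟨?_, ?_⟩)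
    · rw [hsh]; exact hd
    · rw [← he]; exact hd'

end LDS

namespace LDS
open scoped Classical
universe u
variable {V : Type u}

theorem enum (d : V) (S : Finset V) (k : ℕ) (h : k ≤ S.card) :
    ∃ e : ℕ → V, (∀ i < k, e i ∈ S) ∧ ∀ i < k, ∀ j < k, e i = e j → i = j := by
  obtain ⟨T, hT, hTc⟩ := Finset.exists_subset_card_eq h
  set b := (T.equivFinOfCardEq hTc).symm with hb
  refine ⟨fun i => if h : i < k then (b ⟨i, h⟩ : V) else d, ?_, ?_⟩
  · intro i hi
    simp only [dif_pos hi]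
    exact hT (b _).2
  · intro i hi j hj h
    simp only [dif_pos hi, dif_pos hj] at h
    have := b.injective (Subtype.ext h)
    simpa using this

theorem enum0 (S : Finset V) (t : V) (ht : t ∈ S) (k : ℕ) (h : k ≤ S.card) :
    ∃ e : ℕ → V, e 0 = t ∧ (∀ i < k, e i ∈ S) ∧ ∀ i < k, ∀ j < k, e i = e j → i = j := by
  obtain ⟨e, he, hei⟩ := enum t (S.erase t) (k - 1) (by rw [Finset.card_erase_of_mem ht]; omega)
  have hne : ∀ i < k - 1, e i ≠ t := fun i hi => (Finset.mem_erase.1 (he i hi)).1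
  refine ⟨fun i => if i = 0 then t else e (i - 1), by simp, ?_, ?_⟩
  · intro i hi
    (try simp only)
    split_ifs
    · exact ht
    · exact (Finset.mem_erase.1 (he _ (by omega))).2
  · intro i hi j hj hij
    (try simp only at hij)
    split_ifs at hij
    · omega
    · exact absurd hij.symm (hne _ (by omega))
    · exact absurd hij (hne _ (by omega))
    · have := hei _ (by omega) _ (by omega) hij
      omega

theorem redCyc (R : SimpleGraph V) (p : ℕ) (Y Z : Finset V) (hY : p + 2 ≤ Y.card) (hZ : p + 1 ≤ Z.card)
    (hd : Disjoint Y Z) (hcl : ∀ y ∈ Y, ∀ y' ∈ Y, y ≠ y' → R.Adj y y')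
    (hYZ : ∀ y ∈ Y, ∀ z ∈ Z, R.Adj y z) : ∃ g : ZMod (2 * p + 3) → V, IsCycleMap R g := by
  obtain ⟨d, -⟩ := Finset.card_pos.1 (show 0 < Y.card by omega)
  obtain ⟨a, ha, hai⟩ := enum d Y _ hY
  obtain ⟨b, hb, hbi⟩ := enum d Z _ hZ
  have h1 := inter_inj a b (p + 1) (fun i hi j hj => hai i (by omega) j (by omega))
    hbi (by
      intro i hi j hj h
      exact Finset.disjoint_left.1 hd (ha i (by omega)) (h ▸ hb j hj))
  have h2 := inter_adj R a b (p + 1) (fun i hi => (hYZ _ (ha i (by omega)) _ (hb i hi)).symm)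
    (fun i hi => (hYZ _ (ha (i + 1) (by omega)) _ (hb i hi)).symm)
  refine mkCyc R p (inter a b) (fun i hi j hj => h1 i (by omega) j (by omega))
    (fun i hi => h2 i (by omega)) ?_
  have e1 : inter a b (2 * p + 2) = a (p + 1) := by
    unfold inter; rw [if_pos (by omega)]; congr 1; omega
  have e2 : inter a b 0 = a 0 := by simp [inter]
  rw [e1, e2]
  apply hcl _ (ha _ (by omega)) _ (ha _ (by omega))
  intro h
  have := hai _ (by omega) _ (by omega) h
  omega

theorem jpGen (R : SimpleGraph V) (p n : ℕ) (hp : 1 ≤ p) (P Q L1 L2 : Finset V) (v t : V) (ht : t ∈ P)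
    (hP : P.card = p) (hQ : Q.card = p) (hPQ : ∀ x ∈ P, ∀ y ∈ Q, R.Adj x y) (hdPQ : Disjoint P Q)
    (htv : R.Adj t v) (hvP : v ∉ P) (hvQ : v ∉ Q) (hL1 : n ≤ L1.card) (hL2 : 2 ≤ L2.card)
    (hd : Disjoint L1 L2) (hP1 : Disjoint P L1) (hP2 : Disjoint P L2) (hQ1 : Disjoint Q L1)
    (hQ2 : Disjoint Q L2) (hv1 : v ∉ L1) (hv2 : v ∉ L2) (ha1 : ∀ x ∈ L1, R.Adj v x)
    (ha2 : ∀ y ∈ Q, ∀ x ∈ L2, R.Adj y x) : HasCopy (LinkedDoubleStar (2 * p + 1) n 2) R := by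
  obtain ⟨b, hb0, hb, hbi⟩ := enum0 P t ht p hP.ge
  obtain ⟨a, ha, hai⟩ := enum t Q p hQ.ge
  have hm : ∀ i ≤ p, i ≠ 0 → a (i - 1) ∈ Q := fun i hi h0 => ha _ (by omega)
  refine hasCopy_inter R p n 2 (fun i => if i = 0 then v else a (i - 1)) b ?_ hbi ?_ ?_ ?_ L1 L2 hL1 hL2
    hd ?_ ?_ ?_ ?_ ?_ ?_
  · intro i hi j hj hij
    (try simp only at hij)
    split_ifs at hij with h1 h2 h2
    · omega
    · exact absurd (hij ▸ hm j hj h2) hvQ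
    · exact absurd (hij ▸ hm i hi h1) hvQ
    · have := hai _ (by omega) _ (by omega) hij
      omega
  · intro i hi j hj hij
    (try simp only at hij)
    split_ifs at hij with h1
    · exact hvP (hij ▸ hb j hj)
    · exact Finset.disjoint_left.1 hdPQ (hb j hj) (hij ▸ hm i hi h1)
  · intro i hi
    (try simp only)
    split_ifs with h1
    · rw [h1, hb0]; exact htv
    · exact hPQ _ (hb i hi) _ (hm i (by omega) h1)
  · intro i hi
    (try simp only)
    rw [if_neg (by omega)]
    exact hPQ _ (hb i hi) _ (hm (i + 1) (by omega) (by omega))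
  · intro i hi
    (try simp only)
    split_ifs with h1
    · exact hv1
    · exact Finset.disjoint_left.1 hQ1 (hm i hi h1)
  · intro i hi
    exact Finset.disjoint_left.1 hP1 (hb i hi)
  · intro i hi
    (try simp only)
    split_ifs with h1
    · exact hv2
    · exact Finset.disjoint_left.1 hQ2 (hm i hi h1)
  · intro i hi
    exact Finset.disjoint_left.1 hP2 (hb i hi)
  · simpa using ha1
  · (try simp only)
    rw [if_neg (by omega)]
    exact ha2 _ (hm p le_rfl (by omega))

theorem jpEdge (R : SimpleGraph V) (p n : ℕ) (hp : 1 ≤ p) (Y Z L : Finset V) (v t : V)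
    (ht : t ∈ Y ∪ Z) (hY : Y.card = p + 2) (hZ : Z.card = p) (hd : Disjoint Y Z)
    (hcl : ∀ y ∈ Y, ∀ y' ∈ Y, y ≠ y' → R.Adj y y') (hYZ : ∀ y ∈ Y, ∀ z ∈ Z, R.Adj y z)
    (htv : R.Adj t v) (hvY : v ∉ Y) (hvZ : v ∉ Z) (hL : n ≤ L.card) (hLY : Disjoint L Y)
    (hLZ : Disjoint L Z) (hvL : v ∉ L) (hvL' : ∀ x ∈ L, R.Adj v x) :
    HasCopy (LinkedDoubleStar (2 * p + 1) n 2) R := by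
  by_cases htY : t ∈ Y
  · obtain ⟨P, hP1, hP2, hPc⟩ := Finset.exists_subsuperset_card_eq
      (Finset.singleton_subset_iff.2 htY) (show ({t} : Finset V).card ≤ p by simpa using hp)
      (show p ≤ Y.card by omega)
    refine jpGen R p n hp P Z L (Y \ P) v t (hP1 (by simp)) hPc hZ
      (fun x hx y hy => hYZ x (hP2 hx) y hy) (hd.mono_left hP2) htv (fun h => hvY (hP2 h)) hvZ hL ?_
      (hLY.mono_right Finset.sdiff_subset) (hLY.symm.mono_left hP2) Finset.disjoint_sdiff hLZ.symm
      (hd.symm.mono_right Finset.sdiff_subset) hvL (fun h => hvY (Finset.mem_sdiff.1 h).1) hvL' ?_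
    · rw [Finset.card_sdiff_of_subset hP2]; omega
    · intro y hy x hx
      exact (hYZ x (Finset.mem_sdiff.1 hx).1 y hy).symm
  · have htZ : t ∈ Z := (Finset.mem_union.1 ht).resolve_left htY
    obtain ⟨Q, hQ, hQc⟩ := Finset.exists_subset_card_eq (show p ≤ Y.card by omega)
    refine jpGen R p n hp Z Q L (Y \ Q) v t htZ hZ hQc
      (fun x hx y hy => (hYZ y (hQ hy) x hx).symm) (hd.symm.mono_right hQ) htv hvZ
      (fun h => hvY (hQ h)) hL ?_
      (hLY.mono_right Finset.sdiff_subset) hLZ.symm (hd.symm.mono_right Finset.sdiff_subset)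
      (hLY.symm.mono_left hQ) Finset.disjoint_sdiff
      hvL (fun h => hvY (Finset.mem_sdiff.1 h).1) hvL' ?_
    · rw [Finset.card_sdiff_of_subset hQ]; omega
    · intro y hy x hx
      rw [Finset.mem_sdiff] at hx
      exact hcl y (hQ hy) x hx.1 (fun e => hx.2 (e ▸ hy))

theorem endSpine (R : SimpleGraph V) (p n : ℕ) (hp : 2 ≤ p) (hnp : n + 2 ≤ p) (X Y Z Z1 : Finset V)
    (hXc : p + 1 ≤ X.card) (hXY : Disjoint X Y) (hXZ : Disjoint X Z) (hYZ : Disjoint Y Z)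
    (hX : ∀ x ∈ X, ∀ z ∈ Z, z ∉ Z1 → R.Adj x z) (w y : ℕ → V) (hAP : AP R.Adj (p - 1) w y)
    (hw : ∀ i < p - 1, w i ∈ Z) (hy : ∀ i < p - 1, y i ∈ Y) (hw0 : w 0 ∉ Z1)
    (a z : V) (ha : a ∈ Z) (ha1 : a ∉ Z1) (hz : z ∈ Z) (hz1 : z ∉ Z1) (haz : a ≠ z)
    (haw : ∀ i < p - 1, w i ≠ a) (hzw : ∀ i < p - 1, w i ≠ z) (hya : R.Adj (y (p - 2)) a) :
    HasCopy (LinkedDoubleStar (2 * p + 1) n 2) R := by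
  obtain ⟨x, hx⟩ := Finset.card_pos.1 (show 0 < X.card by omega)
  have hXe := Finset.card_erase_of_mem hx
  obtain ⟨L2, hL2, hL2c⟩ := Finset.exists_subset_card_eq (show 2 ≤ (X.erase x).card by omega)
  set α : ℕ → V := fun i => if i < p - 1 then w i else if i = p - 1 then a else z with hα
  set β : ℕ → V := fun i => if i < p - 1 then y i else x with hβ
  have hαZ : ∀ i, α i ∈ Z := by
    intro i; rw [hα]; (try simp only)
    split_ifs with h1 h2
    · exact hw i h1
    · exact ha
    · exact hz
  have hβXY : ∀ i, β i ∈ X ∪ Y := by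
    intro i; rw [hβ]; (try simp only)
    rw [Finset.mem_union]
    split_ifs with h1
    · exact Or.inr (hy i h1)
    · exact Or.inl hx
  have hyx : ∀ i < p - 1, y i ≠ x := fun i hi e => Finset.disjoint_left.1 hXY hx (e ▸ hy i hi)
  have hβX : ∀ i, β i ∉ X.erase x := by
    intro i; rw [hβ]; (try simp only)
    split_ifs with h1
    · exact fun h => Finset.disjoint_left.1 hXY (Finset.mem_of_mem_erase h) (hy i h1)
    · simp
  have hαX : ∀ i, α i ∉ X.erase x := fun i h =>
    Finset.disjoint_left.1 hXZ (Finset.mem_of_mem_erase h) (hαZ i)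
  refine hasCopy_inter R p n 2 α β ?_ ?_ ?_ ?_ ?_ (X.erase x \ L2) L2 ?_ hL2c.ge
    Finset.sdiff_disjoint ?_ ?_ ?_ ?_ ?_ ?_
  · intro i hi j hj hij
    rw [hα] at hij
    (try simp only at hij)
    split_ifs at hij with h1 h2 h3 h4 h5 h6 h7 h8 h9 <;> first
      | omega
      | exact hAP.wi _ h1 _ h2 hij
      | exact absurd hij (haw _ (by omega))
      | exact absurd hij.symm (haw _ (by omega))
      | exact absurd hij (hzw _ (by omega))
      | exact absurd hij.symm (hzw _ (by omega))
      | exact absurd hij haz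
      | exact absurd hij.symm haz
  · intro i hi j hj hij
    rw [hβ] at hij
    (try simp only at hij)
    split_ifs at hij with h1 h2 h3 <;> first
      | omega
      | exact hAP.yi _ h1 _ h2 hij
      | exact absurd hij (hyx _ (by omega))
      | exact absurd hij.symm (hyx _ (by omega))
  · intro i hi j hj hij
    rcases Finset.mem_union.1 (hβXY j) with h | h
    · exact Finset.disjoint_left.1 hXZ h (hij ▸ hαZ i)
    · exact Finset.disjoint_left.1 hYZ h (hij ▸ hαZ i)
  · intro i hi
    by_cases h1 : i < p - 1
    · simp only [hα, hβ, if_pos h1]; exact hAP.e1 i h1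
    · have h2 : i = p - 1 := by omega
      simp only [hα, hβ, if_neg h1, if_pos h2]
      exact hX x hx a ha ha1
  · intro i hi
    by_cases h1 : i + 1 < p - 1
    · simp only [hα, hβ, if_pos h1, if_pos (show i < p - 1 by omega)]; exact hAP.e2 i h1
    · by_cases h2 : i + 1 = p - 1
      · simp only [hα, hβ, if_neg h1, if_pos h2, if_pos (show i < p - 1 by omega)]
        rw [show i = p - 2 by omega]; exact hya
      · simp only [hα, hβ, if_neg h1, if_neg h2, if_neg (show ¬ i < p - 1 by omega)]
        exact hX x hx z hz hz1
  · rw [Finset.card_sdiff_of_subset hL2]; omega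
  · intro i _ h; exact hαX i (Finset.mem_sdiff.1 h).1
  · intro i _ h; exact hβX i (Finset.mem_sdiff.1 h).1
  · intro i _ h; exact hαX i (hL2 h)
  · intro i _ h; exact hβX i (hL2 h)
  · intro v hv
    have e : α 0 = w 0 := by simp only [hα, if_pos (show 0 < p - 1 by omega)]
    rw [e]
    exact (hX v (Finset.mem_of_mem_erase (Finset.mem_sdiff.1 hv).1) _ (hw 0 (by omega)) hw0).symm
  · intro v hv
    have e : α p = z := by
      simp only [hα, if_neg (show ¬ p < p - 1 by omega), if_neg (show ¬ p = p - 1 by omega)]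
    rw [e]
    exact (hX v (Finset.mem_of_mem_erase (hL2 hv)) _ hz hz1).symm

theorem redMid (R : SimpleGraph V) (p n : ℕ) (hp : 4 ≤ p) (hn : 2 ≤ n) (hnp : n + 2 ≤ p)
    (X Y Z Z1 : Finset V) (hXc : p + 1 ≤ X.card) (hYc : p + 1 ≤ Y.card) (hZc : Z.card = n + p)
    (hXY : Disjoint X Y) (hXZ : Disjoint X Z) (hYZ : Disjoint Y Z) (hZ1 : Z1 ⊆ Z) (hZ1c : Z1.card + 1 = p)
    (hX : ∀ x ∈ X, ∀ z ∈ Z, z ∉ Z1 → R.Adj x z) (hY : ∀ y ∈ Y, ∀ z ∈ Z1, R.Adj y z)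
    (z1 a y1 y2 : V) (hz1 : z1 ∈ Z) (hz1' : z1 ∉ Z1) (ha : a ∈ Z) (ha' : a ∉ Z1) (hza : z1 ≠ a)
    (hy1 : y1 ∈ Y) (hy2 : y2 ∈ Y) (hy12 : y1 ≠ y2) (h1 : R.Adj y1 z1) (h2 : R.Adj y2 a) :
    HasCopy (LinkedDoubleStar (2 * p + 1) n 2) R := by
  obtain ⟨z, hz, hzn⟩ : ∃ z ∈ Z \ Z1, z ∉ ({z1, a} : Finset V) := by
    obtain ⟨z, hz⟩ := Finset.card_pos.1 (show 0 < ((Z \ Z1) \ {z1, a}).card by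
      have h1 := Finset.le_card_sdiff ({z1, a} : Finset V) (Z \ Z1)
      have h2 := Finset.card_le_two (a := z1) (b := a)
      rw [Finset.card_sdiff_of_subset hZ1] at h1
      omega)
    rw [Finset.mem_sdiff] at hz
    exact ⟨z, hz.1, hz.2⟩
  simp only [Finset.mem_insert, Finset.mem_singleton, not_or] at hzn
  rw [Finset.mem_sdiff] at hz
  obtain ⟨e, he, hei⟩ := enum z Z1 (p - 1) (by omega)
  obtain ⟨c, hc, hci⟩ := enum z ((Y.erase y1).erase y2) (p - 1) (by
    have := Finset.pred_card_le_card_erase (s := Y) (a := y1)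
    have := Finset.pred_card_le_card_erase (s := Y.erase y1) (a := y2)
    omega)
  have hcY : ∀ i < p - 1, c i ∈ Y := fun i hi =>
    Finset.mem_of_mem_erase (Finset.mem_of_mem_erase (hc i hi))
  have hc2 : ∀ i < p - 1, c i ≠ y2 := fun i hi => (Finset.mem_erase.1 (hc i hi)).1
  have hc1 : ∀ i < p - 1, c i ≠ y1 := fun i hi =>
    (Finset.mem_erase.1 (Finset.mem_erase.1 (hc i hi)).2).1
  have hne : ∀ v, v ∉ Z1 → ∀ i < p - 1, e i ≠ v := fun v hv i hi h => hv (h ▸ he i hi)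
  have hyY : ∀ i < p - 1, (if i = 0 then y1 else if i = p - 2 then y2 else c i) ∈ Y := by
    intro i hi
    split_ifs
    · exact hy1
    · exact hy2
    · exact hcY i hi
  refine endSpine R p n (by omega) hnp X Y Z Z1 hXc hXY hXZ hYZ hX
    (fun i => if i = 0 then z1 else e i) (fun i => if i = 0 then y1 else if i = p - 2 then y2 else c i)
    ⟨?_, ?_, ?_, ?_⟩ ?_ hyY (by simpa using hz1') a z ha ha' hz.1 hz.2 (fun h => hzn.2 h.symm) ?_ ?_ ?_
  · intro i hi j hj hij
    (try simp only at hij)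
    split_ifs at hij
    · omega
    · exact absurd hij.symm (hne _ hz1' _ hj)
    · exact absurd hij (hne _ hz1' _ hi)
    · exact hei _ hi _ hj hij
  · intro i hi j hj hij
    (try simp only at hij)
    split_ifs at hij <;> first
      | omega
      | exact absurd hij hy12
      | exact absurd hij.symm hy12
      | exact absurd hij (hc1 _ hi)
      | exact absurd hij.symm (hc1 _ hj)
      | exact absurd hij (hc2 _ hi)
      | exact absurd hij.symm (hc2 _ hj)
      | exact hci _ hi _ hj hij
  · intro i hi
    by_cases h0 : i = 0
    · simp only [if_pos h0]; exact h1
    · have := hyY i hi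
      (try simp only)
      rw [if_neg h0]
      rw [if_neg h0] at this ⊢
      exact hY _ this _ (he i hi)
  · intro i hi
    (try simp only)
    rw [if_neg (show ¬ i + 1 = 0 by omega)]
    exact hY _ (hyY i (by omega)) _ (he _ hi)
  · intro i hi
    (try simp only)
    split_ifs
    · exact hz1
    · exact hZ1 (he i hi)
  · intro i hi
    (try simp only)
    split_ifs
    · exact hza
    · exact hne _ ha' _ hi
  · intro i hi
    (try simp only)
    split_ifs
    · exact fun h => hzn.1 h.symm
    · exact hne _ hz.2 _ hi
  · (try simp only)
    rw [if_neg (by omega), if_pos (by simp)]; exact h2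

theorem redFinal (R : SimpleGraph V) (p n : ℕ) (hp : 4 ≤ p) (hn : 2 ≤ n) (hnp : n + 2 ≤ p)
    (X Y 𝒜 Z Z1 : Finset V) (hXc : p + 1 ≤ X.card) (hZc : Z.card = n + p) (hA : 𝒜 ⊆ Y)
    (hAc : p + 1 ≤ 𝒜.card) (hdeg : ∀ y ∈ 𝒜, p ≤ dg R.Adj Z y)
    (hXY : Disjoint X Y) (hXZ : Disjoint X Z) (hYZ : Disjoint Y Z) (hZ1 : Z1 ⊆ Z) (hZ1c : Z1.card + 2 ≤ p)
    (hX : ∀ x ∈ X, ∀ z ∈ Z, z ∉ Z1 → R.Adj x z) (hY : ∀ y ∈ Y, ∀ z ∈ Z1, R.Adj y z) :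
    HasCopy (LinkedDoubleStar (2 * p + 1) n 2) R := by
  obtain ⟨y0, hy0⟩ := Finset.card_pos.1 (show 0 < 𝒜.card by omega)
  obtain ⟨z1, hz1, hz1', hyz⟩ := nbr_outside R.Adj Z Z1 y0 (by have := hdeg y0 hy0; omega)
  obtain ⟨W0, A0, e0, hW0, hA0, hR0⟩ := lemJ (r := R.Adj) (z := z1) (𝒜 := 𝒜) (ℬ := Z) (k := p) (T := p - 1)
    hdeg (by omega) hz1 ⟨y0, hy0, hyz⟩ (by omega) (by omega) (by omega)
  obtain ⟨w0, yy0, hAP0, hw00, -, hiw0, hiy0, -⟩ := hR0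
  obtain ⟨⟨w, y⟩, ⟨hAP, hw0, hwZ, hyA⟩, hmax⟩ := exists_max
    (fun q : (ℕ → V) × (ℕ → V) => AP R.Adj (p - 1) q.1 q.2 ∧ q.1 0 = z1 ∧ im (p - 1) q.1 ⊆ Z ∧
      im (p - 1) q.2 ⊆ 𝒜) (fun q => ((im (p - 1) q.1) ∩ Z1).card) Z1.card
    (fun q _ => Finset.card_le_card Finset.inter_subset_right)
    ⟨(w0, yy0), hAP0, hw00, by rw [hiw0]; exact hW0, by rw [hiy0]; exact hA0⟩
  simp only at hAP hw0 hwZ hyA hmax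
  have hWc := hAP.card_w
  have hwm : ∀ i < p - 1, w i ∈ im (p - 1) w := fun i hi => mem_im.2 ⟨i, hi, rfl⟩
  have hym : ∀ i < p - 1, y i ∈ 𝒜 := fun i hi => hyA (mem_im.2 ⟨i, hi, rfl⟩)
  have hsub : Z1 ⊆ im (p - 1) w := by
    intro ζ hζ
    by_contra hζW
    obtain ⟨i, hi0, hi, hiZ⟩ : ∃ i, 0 < i ∧ i < p - 1 ∧ w i ∉ Z1 := by
      by_contra hno
      push Not at hno
      have h1 : insert ζ ((im (p - 1) w).erase z1) ⊆ Z1 := by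
        intro v hv
        rw [Finset.mem_insert, Finset.mem_erase, mem_im] at hv
        rcases hv with rfl | ⟨hv, i, hi, rfl⟩
        · exact hζ
        · refine hno i (Nat.pos_of_ne_zero ?_) hi
          rintro rfl
          exact hv hw0
      have h2 := Finset.card_le_card h1
      rw [Finset.card_insert_of_notMem (fun h => hζW (Finset.mem_of_mem_erase h))] at h2
      have h3 := Finset.pred_card_le_card_erase (s := im (p - 1) w) (a := z1)
      omega
    have hζn : ∀ k < p - 1, w k ≠ ζ := fun k hk h => hζW (h ▸ hwm k hk)
    have him : im (p - 1) (Function.update w i ζ) = insert ζ ((im (p - 1) w).erase (w i)) := by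
      ext v
      simp only [mem_im, Finset.mem_insert, Finset.mem_erase, Function.update_apply]
      constructor
      · rintro ⟨k, hk, h1⟩
        split_ifs at h1 with h2
        · exact Or.inl h1.symm
        · refine Or.inr ⟨?_, k, hk, h1⟩
          rintro rfl
          exact h2 (hAP.wi _ hk _ hi h1)
      · rintro (rfl | ⟨h1, k, hk, rfl⟩)
        · exact ⟨i, hi, by simp⟩
        · refine ⟨k, hk, ?_⟩
          rw [if_neg]
          rintro rfl
          exact h1 rfl
    have h5 := hmax (Function.update w i ζ, y) ⟨⟨?_, hAP.yi, ?_, ?_⟩, ?_, ?_, hyA⟩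
    · simp only [him] at h5
      rw [Finset.insert_inter_of_mem hζ, Finset.card_insert_of_notMem (by
        simp only [Finset.mem_inter, Finset.mem_erase]
        exact fun h => hζW h.1.2), Finset.erase_inter, Finset.erase_eq_of_notMem (by
        simp only [Finset.mem_inter]
        exact fun h => hiZ h.2)] at h5
      omega
    · intro a ha b hb hab
      simp only [Function.update_apply] at hab
      split_ifs at hab
      · omega
      · exact absurd hab.symm (hζn b hb)
      · exact absurd hab (hζn a ha)
      · exact hAP.wi a ha b hb hab
    · intro k hk
      simp only [Function.update_apply]
      split_ifs
      · exact hY _ (hA (hym k hk)) _ hζ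
      · exact hAP.e1 k hk
    · intro k hk
      simp only [Function.update_apply]
      split_ifs
      · exact hY _ (hA (hym k (by omega))) _ hζ
      · exact hAP.e2 k hk
    · simp only [Function.update_apply]
      rw [if_neg (by omega)]; exact hw0
    · simp only [him]
      exact Finset.insert_subset (hZ1 hζ) ((Finset.erase_subset _ _).trans hwZ)
  obtain ⟨a, ha, haW, hya⟩ := nbr_outside R.Adj Z (im (p - 1) w) (y (p - 2)) (by
    have := hdeg _ (hym (p - 2) (by omega)); omega)
  obtain ⟨z, hz⟩ := Finset.card_pos.1 (show 0 < ((Z \ im (p - 1) w).erase a).card by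
    have := Finset.pred_card_le_card_erase (s := Z \ im (p - 1) w) (a := a)
    rw [Finset.card_sdiff_of_subset hwZ] at this
    omega)
  rw [Finset.mem_erase, Finset.mem_sdiff] at hz
  refine endSpine R p n (by omega) hnp X Y Z Z1 hXc hXY hXZ hYZ hX w y hAP (fun i hi => hwZ (hwm i hi))
    (fun i hi => hA (hym i hi)) (by rw [hw0]; exact hz1') a z ha (fun h => haW (hsub h)) hz.2.1
    (fun h => hz.2.2 (hsub h)) (fun h => hz.1 h.symm) (fun i hi h => haW (h ▸ hwm i hi))
    (fun i hi h => hz.2.2 (h ▸ hwm i hi)) hya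

end LDS

namespace LDS
open scoped Classical
universe u
variable {V : Type u}

theorem caseB [Fintype V] (B : SimpleGraph V) (p n : ℕ) (hp : 4 ≤ p) (hn2 : 2 ≤ n)
    (hnp : n + 2 ≤ p) (hV : Fintype.card V = n + 3 * p + 3) (F : ℕ → V) (w : V) (h : St B p F w)
    (hB : ∀ g : ZMod (2 * p + 3) → V, ¬ IsCycleMap B g)
    (hR : ∀ g : ZMod (2 * p + 3) → V, ¬ IsCycleMap Bᶜ g) :
    HasCopy (LinkedDoubleStar (2 * p + 1) n 2) B ∨ HasCopy (LinkedDoubleStar (2 * p + 1) n 2) Bᶜ := by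
  by_contra hno
  rw [not_or] at hno
  obtain ⟨hnB, hnR⟩ := hno
  set X := XF p F with hX
  set Y := YF p F w with hY
  have hXc : X.card = p + 1 := h.card_XF
  have hYc : Y.card = p + 2 := h.card_YF
  have hXY : Disjoint X Y := h.disjXY
  set Z : Finset V := (X ∪ Y)ᶜ with hZ
  have hXYZ : Disjoint (X ∪ Y) Z := disjoint_compl_right
  have hXZ : Disjoint X Z := hXYZ.mono_left Finset.subset_union_left
  have hYZ : Disjoint Y Z := hXYZ.mono_left Finset.subset_union_right
  have hZc : Z.card = n + p := by
    rw [hZ, Finset.card_compl, Finset.card_union_of_disjoint hXY, hXc, hYc, hV]; omega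
  have hFZ : ∀ i, F i ∉ Z := fun i hi => (Finset.mem_compl.1 hi) (h.mem_of i)
  have hwY : w ∈ Y := by rw [hY, mem_YF]; simp
  have hwZ : w ∉ Z := Finset.disjoint_left.1 hYZ hwY
  have hYn : ∀ y ∈ Y, y ∉ Z := fun y hy => Finset.disjoint_left.1 hYZ hy
  set Z1 : Finset V := Z.filter (fun z => ∀ y ∈ Y, ¬ B.Adj z y) with hZ1
  have hm1 : ∀ z, z ∈ Z1 ↔ z ∈ Z ∧ ∀ y ∈ Y, ¬ B.Adj z y := fun z => by rw [hZ1, Finset.mem_filter]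
  have hZ1Z : Z1 ⊆ Z := Finset.filter_subset _ _
  have hcl : ∀ y ∈ Y, ∀ y' ∈ Y, y ≠ y' → Bᶜ.Adj y y' := fun y hy y' hy' hne => by
    rw [SimpleGraph.compl_adj]; exact ⟨hne, h.clique hB hy hy' hne⟩
  have hYR : ∀ y ∈ Y, ∀ z ∈ Z1, Bᶜ.Adj y z := fun y hy z hz => by
    rw [SimpleGraph.compl_adj]
    exact ⟨fun e => hYn y hy (e ▸ hZ1Z hz), fun e => ((hm1 z).1 hz).2 y hy e.symm⟩
  have hblue : ∀ z ∈ Z, z ∉ Z1 → ∃ y ∈ Y, B.Adj z y := by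
    intro z hz hz1
    by_contra hc
    push Not at hc
    exact hz1 ((hm1 z).2 ⟨hz, hc⟩)
  have hXR : ∀ x ∈ X, ∀ z ∈ Z, z ∉ Z1 → Bᶜ.Adj x z := by
    intro x hx z hz hz1
    rw [SimpleGraph.compl_adj]
    refine ⟨fun e => Finset.disjoint_left.1 hXZ hx (e ▸ hz), fun e => ?_⟩
    obtain ⟨y, hy, hzy⟩ := hblue z hz hz1
    exact h.noboth hB (fun i e => hFZ i (e ▸ hz)) (fun e => hwZ (e ▸ hz)) hx hy e.symm hzy
  have hb1 : ∀ y ∈ Y, ∀ y' ∈ Y, y ≠ y' → n + 1 ≤ dg B.Adj Z y → dg B.Adj Z y' < 2 := by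
    intro y hy y' hy' hne hd
    by_contra hd'
    exact hnB (h.b1 hn2 (by omega) Z hFZ hwZ hy hy' hne hd (by omega))
  set 𝒜 : Finset V := Y.filter (fun y => dg B.Adj Z y ≤ n) with hA
  have hAY : 𝒜 ⊆ Y := Finset.filter_subset _ _
  have hmA : ∀ y, y ∈ 𝒜 ↔ y ∈ Y ∧ dg B.Adj Z y ≤ n := fun y => by rw [hA, Finset.mem_filter]
  have hAc : p + 1 ≤ 𝒜.card := by
    have h1 : (Y \ 𝒜).card ≤ 1 := by
      rw [Finset.card_le_one]
      intro a ha b hb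
      rw [Finset.mem_sdiff, hmA] at ha hb
      by_contra hab
      have ha2 : ¬ dg B.Adj Z a ≤ n := fun e => ha.2 ⟨ha.1, e⟩
      have hb2 : ¬ dg B.Adj Z b ≤ n := fun e => hb.2 ⟨hb.1, e⟩
      have := hb1 a ha.1 b hb.1 hab (by omega)
      omega
    rw [Finset.card_sdiff_of_subset hAY] at h1
    omega
  have hdd : ∀ y ∈ Y, dg B.Adj Z y + dg Bᶜ.Adj Z y = n + p := fun y hy => by
    rw [dg_compl B Z y (hYn y hy), hZc]
  have hdeg : ∀ y ∈ 𝒜, p ≤ dg Bᶜ.Adj Z y := by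
    intro y hy
    have h1 := hdd y (hAY hy)
    have h2 := ((hmA y).1 hy).2
    omega
  have hYZ1 : Disjoint Y Z1 := hYZ.mono_right hZ1Z
  have hXZ1 : Disjoint X Z1 := hXZ.mono_right hZ1Z
  rcases Nat.lt_or_ge p Z1.card with hc | hc
  · obtain ⟨g, hg⟩ := redCyc Bᶜ p Y Z1 (by omega) (by omega) hYZ1 hcl hYR
    exact hR g hg
  rcases hc.eq_or_lt with hc | hc
  · have hLc : (Z \ Z1).card = n := by rw [Finset.card_sdiff_of_subset hZ1Z]; omega
    by_cases hed : ∃ t ∈ Y ∪ Z1, ∃ v ∈ X ∪ Z \ Z1, Bᶜ.Adj t v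
    · obtain ⟨t, ht, v, hv, htv⟩ := hed
      rw [Finset.mem_union, Finset.mem_sdiff] at hv
      rcases hv with hv | hv
      · refine hnR (jpEdge Bᶜ p n (by omega) Y Z1 (Z \ Z1) v t ht hYc hc hYZ1 hcl hYR htv
          (Finset.disjoint_left.1 hXY hv) (Finset.disjoint_left.1 hXZ1 hv) hLc.ge
          (hYZ.symm.mono_left Finset.sdiff_subset) Finset.sdiff_disjoint
          (fun e => Finset.disjoint_left.1 hXZ hv (Finset.mem_sdiff.1 e).1) ?_)
        intro x hx
        rw [Finset.mem_sdiff] at hx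
        exact hXR v hv x hx.1 hx.2
      · exact hnR (jpEdge Bᶜ p n (by omega) Y Z1 X v t ht hYc hc hYZ1 hcl hYR htv
          (fun e => hYn v e hv.1) hv.2 (by omega) hXY hXZ1
          (fun e => Finset.disjoint_left.1 hXZ e hv.1) (fun x hx => (hXR x hx v hv.1 hv.2).symm))
    · push Not at hed
      have hdis : Disjoint (Y ∪ Z1) (X ∪ Z \ Z1) := by
        rw [Finset.disjoint_union_left, Finset.disjoint_union_right, Finset.disjoint_union_right]
        exact ⟨⟨hXY.symm, hYZ.mono_right Finset.sdiff_subset⟩, hXZ1.symm, Finset.disjoint_sdiff⟩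
      have hOc : (Y ∪ Z1).card = 2 * p + 2 := by
        rw [Finset.card_union_of_disjoint hYZ1]; omega
      have hXc2 : X.card ≤ (X ∪ Z \ Z1).card := Finset.card_le_card Finset.subset_union_left
      obtain ⟨x, hx⟩ := Finset.card_pos.1 (show 0 < X.card by omega)
      refine hnB (bipFull B p n (Y ∪ Z1) (X ∪ Z \ Z1) ∅ ?_ hdis (by simp) (by simp) x
        (Finset.mem_union_left _ hx) (by simp) (by omega) (by omega) (by simp; omega))
      intro o ho v hv
      have := hed o ho v hv
      rw [SimpleGraph.compl_adj] at this
      by_contra hcon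
      exact this ⟨fun e => Finset.disjoint_left.1 hdis ho (e ▸ hv), hcon⟩
  rcases Nat.lt_or_ge (Z1.card + 1) p with hc1 | hc1
  · exact hnR (redFinal Bᶜ p n hp hn2 hnp X Y 𝒜 Z Z1 hXc.ge hZc hAY hAc hdeg hXY hXZ hYZ hZ1Z
      (by omega) hXR hYR)
  have hc2 : Z1.card + 1 = p := by omega
  have hout : ∀ y ∈ 𝒜, ∃ z ∈ Z, z ∉ Z1 ∧ Bᶜ.Adj y z := fun y hy =>
    nbr_outside Bᶜ.Adj Z Z1 y (by have := hdeg y hy; omega)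
  have hsame : ∀ y1 ∈ 𝒜, ∀ y2 ∈ 𝒜, y1 ≠ y2 → ∀ z1 ∈ Z, z1 ∉ Z1 → ∀ a ∈ Z, a ∉ Z1 →
      Bᶜ.Adj y1 z1 → Bᶜ.Adj y2 a → z1 = a := by
    intro y1 hy1 y2 hy2 hne z1 hz1 hz1' a ha ha' h1 h2
    by_contra hza
    exact hnR (redMid Bᶜ p n hp hn2 hnp X Y Z Z1 hXc.ge (by omega) hZc hXY hXZ hYZ hZ1Z hc2 hXR hYR
      z1 a y1 y2 hz1 hz1' ha ha' hza (hAY hy1) (hAY hy2) hne h1 h2)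
  obtain ⟨y1, hy1, y2, hy2, hy12⟩ := Finset.one_lt_card.1 (show 1 < 𝒜.card by omega)
  obtain ⟨z1, hz1, hz1', hyz⟩ := hout y1 hy1
  have hall2 : ∀ y ∈ 𝒜, y ≠ y1 → ∀ a ∈ Z, a ∉ Z1 → Bᶜ.Adj y a → a = z1 :=
    fun y hy hne a ha ha' h2 => (hsame y1 hy1 y hy hne.symm z1 hz1 hz1' a ha ha' hyz h2).symm
  have hall1 : ∀ y ∈ 𝒜, Bᶜ.Adj y z1 := by
    intro y hy
    by_cases e : y = y1
    · rw [e]; exact hyz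
    · obtain ⟨a, ha, ha', hya⟩ := hout y hy
      rwa [hall2 y hy e a ha ha' hya] at hya
  have hd2 : n ≤ dg B.Adj Z y2 := by
    have h1 : dg Bᶜ.Adj Z y2 ≤ p := by
      have h2 : Z.filter (Bᶜ.Adj y2) ⊆ insert z1 Z1 := by
        intro v hv
        have hv' := (mem_dgf Bᶜ.Adj Z y2 v).1 (by convert hv)
        rw [Finset.mem_insert]
        by_cases hv1 : v ∈ Z1
        · exact Or.inr hv1
        · exact Or.inl (hall2 y2 hy2 hy12.symm v hv'.1 hv1 hv'.2)
      have h3 := Finset.card_le_card h2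
      have h4 := Finset.card_insert_le z1 Z1
      have h5 : dg Bᶜ.Adj Z y2 = (Z.filter (Bᶜ.Adj y2)).card := by unfold dg; congr
      omega
    have := hdd y2 (hAY hy2)
    omega
  obtain ⟨y0, hy0, hzy0⟩ := hblue z1 hz1 hz1'
  have hy0A : y0 ∉ 𝒜 := by
    intro hy
    have := hall1 y0 hy
    rw [SimpleGraph.compl_adj] at this
    exact this.2 hzy0.symm
  have hy0d : n + 1 ≤ dg B.Adj Z y0 := by
    by_contra hcon
    exact hy0A ((hmA y0).2 ⟨hy0, by omega⟩)
  have := hb1 y0 hy0 y2 (hAY hy2) (fun e => hy0A (e ▸ hy2)) hy0d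
  omega

theorem cycStat_witness [Fintype V] (H : SimpleGraph V) (C : Set V) (k : ℕ) (h : k + 1 ≤ cycStat H C) :
    ∃ z, z ∉ C ∧ k + 1 ≤ ({v ∈ C | H.Adj z v}).ncard := by
  unfold cycStat at h
  set S := (fun z => ({v ∈ C | H.Adj z v}).ncard) '' Cᶜ with hS
  have hne : S.Nonempty := by
    by_contra hc
    rw [Set.not_nonempty_iff_eq_empty] at hc
    rw [hc] at h
    simp at h
  have hfin : S.Finite := (Set.toFinite _).image _
  obtain ⟨z, hz, hz2⟩ := Nat.sSup_mem hne hfin.bddAbove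
  exact ⟨z, hz, by rw [← hz2] at h; exact h⟩

theorem mainB [Fintype V] (B : SimpleGraph V) (p n : ℕ) (hp : 4 ≤ p) (hn2 : 2 ≤ n)
    (hnp : n + 2 ≤ p) (hV : Fintype.card V = n + 3 * p + 3) (q : ZMod (2 * p + 2) → V)
    (hq : IsCycleMap B q) (hs : p + 1 ≤ cycStat B (Set.range q)) :
    HasCopy (LinkedDoubleStar (2 * p + 1) n 2) B ∨ HasCopy (LinkedDoubleStar (2 * p + 1) n 2) Bᶜ := by
  by_cases hB : ∃ g : ZMod (2 * p + 3) → V, IsCycleMap B g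
  · obtain ⟨g, hg⟩ := hB
    exact thmA B p n hp hn2 hnp hV g hg
  by_cases hR : ∃ g : ZMod (2 * p + 3) → V, IsCycleMap Bᶜ g
  · obtain ⟨g, hg⟩ := hR
    have := thmA Bᶜ p n hp hn2 hnp hV g hg
    rw [compl_compl] at this
    exact this.symm
  push Not at hB hR
  obtain ⟨w, hw, hwc⟩ := cycStat_witness B _ p hs
  have hqw : ∀ i, q i ≠ w := fun i e => hw ⟨i, e⟩
  set N : Finset (ZMod (2 * p + 2)) := Finset.univ.filter (fun i => B.Adj w (q i)) with hN
  have hmN : ∀ i, i ∈ N ↔ B.Adj w (q i) := fun i => by rw [hN, Finset.mem_filter]; simp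
  have hNc : p + 1 ≤ N.card := by
    have h1 : {v ∈ Set.range q | B.Adj w v} = ((N.image q : Finset V) : Set V) := by
      ext v
      simp only [Set.mem_setOf_eq, Set.mem_range, Finset.coe_image, Set.mem_image, Finset.mem_coe, hmN]
      constructor
      · rintro ⟨⟨i, rfl⟩, h⟩; exact ⟨i, h, rfl⟩
      · rintro ⟨i, h, rfl⟩; exact ⟨⟨i, rfl⟩, h⟩
    rw [h1, Set.ncard_coe_finset] at hwc
    exact hwc.trans Finset.card_image_le
  -- the rotated cycle
  have hcast : ((2 * p + 2 : ℕ) : ZMod (2 * p + 2)) = 0 := ZMod.natCast_self _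
  have hinj : ∀ (a : ZMod (2 * p + 2)) (i j : ℕ), i < j + (2 * p + 2) → j < i + (2 * p + 2) →
      q (a + i) = q (a + j) → i = j := by
    intro a i j h1 h2 h3
    have h4 := add_left_cancel (hq.1 h3)
    rw [ZMod.natCast_eq_natCast_iff'] at h4
    exact Nat.ModEq.eq_of_abs_lt (m := 2 * p + 2) h4 (by rw [abs_lt]; omega)
  have hadj : ∀ (a : ZMod (2 * p + 2)) (i : ℕ), B.Adj (q (a + i)) (q (a + (i + 1 : ℕ))) := by
    intro a i
    have := hq.2 (a + i)
    rwa [add_assoc, ← Nat.cast_succ] at this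
  have hcons : ∀ i ∈ N, i + 1 ∉ N := by
    intro a ha ha1
    rw [hmN] at ha ha1
    obtain ⟨g, hg⟩ := mkCyc B p (fun k => if k = 0 then w else q (a + k)) (by
      intro i hi j hj hij
      (try simp only at hij)
      split_ifs at hij
      · omega
      · exact absurd hij.symm (hqw _)
      · exact absurd hij (hqw _)
      · exact hinj a _ _ (by omega) (by omega) hij) (by
      intro i hi
      (try simp only)
      rw [if_neg (by omega : ¬ i + 1 = 0)]
      split_ifs with h1
      · rw [h1]; simpa using ha1
      · exact hadj a i) (by
      (try simp only)
      rw [if_neg (by omega), if_pos (by simp), hcast, add_zero]; exact ha.symm)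
    exact hB g hg
  have hinj1 : Function.Injective (fun i : ZMod (2 * p + 2) => i + 1) := add_left_injective 1
  have hdisj : Disjoint N (N.image (fun i => i + 1)) := by
    rw [Finset.disjoint_right]
    intro i hi
    rw [Finset.mem_image] at hi
    obtain ⟨j, hj, rfl⟩ := hi
    exact hcons j hj
  have huniv : N ∪ N.image (fun i => i + 1) = Finset.univ := by
    apply Finset.eq_univ_of_card
    have h1 := Finset.card_le_univ (N ∪ N.image (fun i => i + 1))
    rw [Finset.card_union_of_disjoint hdisj, Finset.card_image_of_injective _ hinj1, ZMod.card] at *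
    omega
  have hstep : ∀ i ∈ N, i + 2 ∈ N := by
    intro i hi
    have h1 : i + 2 ∈ N ∪ N.image (fun i => i + 1) := by rw [huniv]; exact Finset.mem_univ _
    rcases Finset.mem_union.1 h1 with h2 | h2
    · exact h2
    · rw [Finset.mem_image] at h2
      obtain ⟨j, hj, hji⟩ := h2
      have : j = i + 1 := by
        apply hinj1
        simp only [hji]; ring
      rw [this] at hj
      exact absurd hj (hcons i hi)
  obtain ⟨a, ha⟩ := Finset.card_pos.1 (show 0 < N.card by omega)
  have hev : ∀ k : ℕ, a + ((2 * k : ℕ) : ZMod (2 * p + 2)) ∈ N := by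
    intro k
    induction k with
    | zero => simpa using ha
    | succ k ih =>
      have := hstep _ ih
      have e : a + ((2 * (k + 1) : ℕ) : ZMod (2 * p + 2)) = a + ((2 * k : ℕ) : ZMod (2 * p + 2)) + 2 := by
        push_cast; ring
      rw [e]; exact this
  refine caseB B p n hp hn2 hnp hV (fun k => q (a + (k : ℕ))) w ⟨hinj a, ?_, hadj a, fun i => hqw _, ?_⟩ hB hR
  · intro i
    (try simp only)
    rw [Nat.cast_add, hcast, add_zero]
  · intro i hi
    have := hev (i / 2)
    rw [show 2 * (i / 2) = i by omega, hmN] at this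
    exact this

end LDS

/-- on `n + 3p + 3` vertices, if `Q` is a blue cycle on `2p+2`
vertices with `s(Q)` maximal among all monochromatic cycles on `2p+2` vertices
and `s(Q) ≥ p + 1`, then there is a monochromatic `S_c(n,2)`
(red edges form `G`, blue edges form `Gᶜ`). -/
theorem lds_sQ_large (p n : ℕ) (hp : 4 ≤ p) (hn2 : 2 ≤ n) (hnp : n ≤ p - 2)
    {V : Type*} [Fintype V] (hV : Fintype.card V = n + 3 * p + 3)
    (G : SimpleGraph V) (q : ZMod (2 * p + 2) → V) (hq : IsCycleMap Gᶜ q)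
    (hmaxR : ∀ f : ZMod (2 * p + 2) → V, IsCycleMap G f →
      cycStat G (Set.range f) ≤ cycStat Gᶜ (Set.range q))
    (hmaxB : ∀ f : ZMod (2 * p + 2) → V, IsCycleMap Gᶜ f →
      cycStat Gᶜ (Set.range f) ≤ cycStat Gᶜ (Set.range q))
    (hs : p + 1 ≤ cycStat Gᶜ (Set.range q)) :
    HasMonoLDS G (2 * p + 1) n 2 := by
  have h := LDS.mainB Gᶜ p n hp hn2 (by omega) hV q hq hs
  rw [compl_compl] at h
  exact h.symm
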